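/- arXiv:2104.07443 — 2 statements merged into one kernel-verified Lean document; each statement's English description precedes it below -/
import Mathlib

section
/- Let ℓ ≥ 0 be a fixed integer and define the additive function T_ℓ(n) = Σ_{p^ν || n} binom(ν+ℓ−1, ℓ) (sum over prime powers p^ν exactly dividing n, binom denoting the binomial coefficient). Then for every fixed integer N ≥ 1: Σ_{n ≤ x} T_ℓ(n) = x·log log x + C·x + x·Σ_{j=1}^{N} a_j / (log x)^j + O( x / (log x)^{N+1} ) as x → ∞, where C = γ + Σ_p ( log(1 − 1/p) + (1/p)·(1 − 1/p)^{−ℓ} ) (sum over all primes, absolutely convergent) and a_j = − ∫_1^∞ (t − ⌊t⌋)·(log t)^{j−1} / t² dt. -/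
section
/-- `(s-1)ζ(s)`, with value 1 at 1. -/
noncomputable def pntZ : ℂ → ℂ := Function.update (fun s => (s - 1) * riemannZeta s) 1 1

lemma pntZ_of_ne {s : ℂ} (hs : s ≠ 1) : pntZ s = (s - 1) * riemannZeta s := by
  simp [pntZ, hs]

lemma pntZ_one : pntZ 1 = 1 := by simp [pntZ]

lemma pntZ_diff : Differentiable ℂ pntZ := by
  rw [← differentiableOn_univ,
    ← Complex.differentiableOn_compl_singleton_and_continuousAt_iff (s := Set.univ) (c := 1)
      Filter.univ_mem]
  constructor
  · intro s hs
    have hs1 : s ≠ 1 := by simpa using hs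
    apply DifferentiableAt.differentiableWithinAt
    have h : DifferentiableAt ℂ (fun s => (s - 1) * riemannZeta s) s :=
      (differentiableAt_id.sub_const 1).mul (differentiableAt_riemannZeta hs1)
    refine h.congr_of_eventuallyEq ?_
    filter_upwards [isOpen_ne.mem_nhds hs1] with z hz
    exact pntZ_of_ne hz
  · exact continuousAt_update_same.mpr riemannZeta_residue_one

lemma cpow_diff_bound (s : ℂ) (hs : 0 < s.re) (n u : ℝ) (hn : 0 < n) (hu : n ≤ u) :
    ‖(u : ℂ) ^ (-s) - (n : ℂ) ^ (-s)‖ ≤ ‖s‖ * n ^ (-s.re - 1) * (u - n) := by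
  have key := Convex.norm_image_sub_le_of_norm_hasDerivWithin_le (𝕜 := ℝ)
    (f := fun v : ℝ => (v : ℂ) ^ (-s)) (f' := fun v : ℝ => (-s) * (v : ℂ) ^ (-s - 1))
    (s := Set.Ici n) (C := ‖s‖ * n ^ (-s.re - 1)) (x := n) (y := u) ?_ ?_ (convex_Ici n)
    (by simp) (by simpa using hu)
  · rwa [Real.norm_of_nonneg (by linarith)] at key
  · intro v hv
    have hv0 : 0 < v := lt_of_lt_of_le hn hv
    have hss : -s ≠ 0 := by
      intro h; rw [neg_eq_zero] at h; simp [h] at hs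
    exact (hasDerivAt_ofReal_cpow_const hv0.ne' hss).hasDerivWithinAt
  · intro v hv
    have hv0 : 0 < v := lt_of_lt_of_le hn hv
    rw [norm_mul, norm_neg, Complex.norm_cpow_eq_rpow_re_of_pos hv0]
    simp only [Complex.sub_re, Complex.neg_re, Complex.one_re]
    gcongr ?_ * ?_
    exact Real.rpow_le_rpow_of_nonpos hn hv (by linarith)

lemma cpow_diff_bound2 (s : ℂ) (hs : 0 < s.re) (n u : ℝ) (hn : 0 < n) (hu : n ≤ u) :
    ‖(u : ℂ) ^ (-s) - (n : ℂ) ^ (-s)‖ ≤ 2 * n ^ (-s.re) := by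
  refine (norm_sub_le _ _).trans ?_
  rw [Complex.norm_cpow_eq_rpow_re_of_pos hn, Complex.norm_cpow_eq_rpow_re_of_pos (hn.trans_le hu)]
  have : u ^ (-s.re) ≤ n ^ (-s.re) := Real.rpow_le_rpow_of_nonpos hn hu (by linarith)
  simp only [Complex.neg_re]
  linarith

lemma cpow_diff_bound3 (s : ℂ) (hs : 0 < s.re) (θ : ℝ) (h0 : 0 ≤ θ) (h1 : θ ≤ 1)
    (n u : ℝ) (hn : 0 < n) (hu : n ≤ u) (hu1 : u ≤ n + 1) :
    ‖(u : ℂ) ^ (-s) - (n : ℂ) ^ (-s)‖ ≤ 2 * ‖s‖ ^ θ * n ^ (-s.re - θ) := by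
  set a := ‖(u : ℂ) ^ (-s) - (n : ℂ) ^ (-s)‖ with ha
  have ha0 : 0 ≤ a := norm_nonneg _
  have b1 : a ≤ ‖s‖ * n ^ (-s.re - 1) := by
    refine (cpow_diff_bound s hs n u hn hu).trans ?_
    exact mul_le_of_le_one_right (by positivity) (by linarith)
  have b2 : a ≤ 2 * n ^ (-s.re) := cpow_diff_bound2 s hs n u hn hu
  have : a = a ^ θ * a ^ (1 - θ) := by
    rw [← Real.rpow_add_of_nonneg ha0 h0 (by linarith)]
    simp
  rw [this]
  calc a ^ θ * a ^ (1 - θ) ≤ (‖s‖ * n ^ (-s.re - 1)) ^ θ * (2 * n ^ (-s.re)) ^ (1 - θ) := by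
        have h2 : 0 ≤ 1 - θ := by linarith
        gcongr
    _ = ‖s‖ ^ θ * 2 ^ (1 - θ) * (n ^ ((-s.re - 1) * θ) * n ^ (-s.re * (1 - θ))) := by
        rw [Real.mul_rpow (by positivity) (by positivity),
          Real.mul_rpow (by positivity) (by positivity), ← Real.rpow_mul hn.le,
          ← Real.rpow_mul hn.le]
        ring
    _ = ‖s‖ ^ θ * 2 ^ (1 - θ) * n ^ (-s.re - θ) := by
        rw [← Real.rpow_add hn]
        ring_nf
    _ ≤ ‖s‖ ^ θ * 2 * n ^ (-s.re - θ) := by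
        gcongr
        calc (2:ℝ) ^ (1 - θ) ≤ 2 ^ (1:ℝ) := Real.rpow_le_rpow_of_exponent_le (by norm_num) (by linarith)
          _ = 2 := by simp
    _ = _ := by ring

/-- term of the series for `(s-1)ζ(s) - 1` -/
noncomputable def pntE (n : ℕ) (s : ℂ) : ℂ :=
  (s - 1) * ((n : ℂ) + 1) ^ (-s) + (((n : ℂ) + 2) ^ (1 - s) - ((n : ℂ) + 1) ^ (1 - s))

lemma pntE_bound (s : ℂ) (hs : 0 < s.re) (θ : ℝ) (h0 : 0 ≤ θ) (h1 : θ ≤ 1) (n : ℕ) :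
    ‖pntE n s‖ ≤ ‖s - 1‖ * (2 * ‖s‖ ^ θ * ((n : ℝ) + 1) ^ (-s.re - θ)) := by
  set m : ℝ := (n : ℝ) + 1 with hm
  have hm0 : 0 < m := by positivity
  by_cases hs1 : s = 1
  · subst hs1
    simp [pntE]
  have key := Convex.norm_image_sub_le_of_norm_hasDerivWithin_le (𝕜 := ℝ)
    (f := fun v : ℝ => (s - 1) * (m : ℂ) ^ (-s) * (v : ℂ) + (v : ℂ) ^ (1 - s))
    (f' := fun v : ℝ => (s - 1) * (m : ℂ) ^ (-s) + (1 - s) * (v : ℂ) ^ (1 - s - 1))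
    (s := Set.Icc m (m + 1)) (C := ‖s - 1‖ * (2 * ‖s‖ ^ θ * m ^ (-s.re - θ))) (x := m) (y := m + 1)
    ?_ ?_ (convex_Icc _ _) (by simp) (by simp)
  · have e : pntE n s = ((s - 1) * (m : ℂ) ^ (-s) * ((m + 1 : ℝ) : ℂ) + ((m + 1 : ℝ) : ℂ) ^ (1 - s))
        - ((s - 1) * (m : ℂ) ^ (-s) * (m : ℂ) + (m : ℂ) ^ (1 - s)) := by
      rw [pntE, hm]
      push_cast
      rw [show (n : ℂ) + 1 + 1 = n + 2 by ring]
      ring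
    rw [e]
    refine key.trans ?_
    simp
  · intro v hv
    have hv0 : 0 < v := lt_of_lt_of_le hm0 hv.1
    have hss : 1 - s ≠ 0 := sub_ne_zero.mpr (Ne.symm hs1)
    have d1 : HasDerivAt (fun v : ℝ => (s - 1) * (m : ℂ) ^ (-s) * (v : ℂ)) ((s - 1) * (m : ℂ) ^ (-s)) v := by
      simpa using (Complex.ofRealCLM.hasDerivAt (x := v)).const_mul ((s - 1) * (m : ℂ) ^ (-s))
    exact (d1.add (hasDerivAt_ofReal_cpow_const hv0.ne' hss)).hasDerivWithinAt
  · intro v hv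
    have : (s - 1) * (m : ℂ) ^ (-s) + (1 - s) * (v : ℂ) ^ (1 - s - 1)
      = (s - 1) * -((v : ℂ) ^ (-s) - (m : ℂ) ^ (-s)) := by
      rw [show 1 - s - 1 = -s by ring]; ring
    rw [this, norm_mul, norm_neg]
    gcongr
    exact cpow_diff_bound3 s hs θ h0 h1 m v hm0 hv.1 hv.2

lemma summable_shift_rpow {a : ℝ} (ha : a < -1) : Summable (fun n : ℕ => ((n : ℝ) + 1) ^ a) := by
  have := (summable_nat_add_iff 1).mpr (Real.summable_nat_rpow.mpr ha)
  simpa using this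

lemma pntE_diff (n : ℕ) : Differentiable ℂ (pntE n) := by
  unfold pntE
  have h1 : (n : ℂ) + 1 ≠ 0 := by exact_mod_cast Nat.succ_ne_zero n
  have h2 : (n : ℂ) + 2 ≠ 0 := by exact_mod_cast Nat.succ_ne_zero (n + 1)
  intro s
  refine DifferentiableAt.add (DifferentiableAt.mul (by fun_prop) ?_) (DifferentiableAt.sub ?_ ?_)
  · exact DifferentiableAt.const_cpow (by fun_prop) (Or.inl h1)
  · exact DifferentiableAt.const_cpow (by fun_prop) (Or.inl h2)
  · exact DifferentiableAt.const_cpow (by fun_prop) (Or.inl h1)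

lemma pntZ_series_one_lt {s : ℂ} (hs : 1 < s.re) : pntZ s = 1 + ∑' n, pntE n s := by
  have hs1 : s ≠ 1 := by rintro rfl; simp at hs
  have hz : HasSum (fun n : ℕ => ((n : ℂ) + 1) ^ (-s)) (riemannZeta s) := by
    rw [zeta_eq_tsum_one_div_nat_add_one_cpow hs]
    have h : Summable (fun n : ℕ => 1 / ((n : ℂ) + 1) ^ s) := by
      have := (summable_nat_add_iff 1).mpr (Complex.summable_one_div_nat_cpow.mpr hs)
      simpa using this
    have e : (fun n : ℕ => ((n : ℂ) + 1) ^ (-s)) = (fun n : ℕ => 1 / ((n : ℂ) + 1) ^ s) := by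
      ext n; rw [Complex.cpow_neg, one_div]
    rw [e]
    exact h.hasSum
  have hE : Summable (fun n => pntE n s) := by
    refine Summable.of_norm_bounded (g := fun n : ℕ => ‖s - 1‖ * (2 * ‖s‖ ^ (0:ℝ) * ((n : ℝ) + 1) ^ (-s.re - 0))) ?_
      (fun n => pntE_bound s (by linarith) 0 le_rfl zero_le_one n)
    exact ((summable_shift_rpow (by linarith)).mul_left _).mul_left _
  have htel : HasSum (fun n : ℕ => ((n : ℂ) + 2) ^ (1 - s) - ((n : ℂ) + 1) ^ (1 - s)) (-1) := by
    have hsm : Summable (fun n : ℕ => ((n : ℂ) + 2) ^ (1 - s) - ((n : ℂ) + 1) ^ (1 - s)) := by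
      have := hE.sub (hz.summable.mul_left (s - 1))
      refine this.congr ?_
      intro n; simp [pntE]
    have ht := hsm.hasSum.tendsto_sum_nat
    have : (∑' n : ℕ, (((n : ℂ) + 2) ^ (1 - s) - ((n : ℂ) + 1) ^ (1 - s))) = -1 := by
      refine tendsto_nhds_unique ht ?_
      have e : ∀ N : ℕ, ∑ n ∈ Finset.range N, (((n : ℂ) + 2) ^ (1 - s) - ((n : ℂ) + 1) ^ (1 - s))
          = ((N : ℂ) + 1) ^ (1 - s) - 1 := by
        intro N
        have := Finset.sum_range_sub (fun n : ℕ => ((n : ℂ) + 1) ^ (1 - s)) N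
        simp only [Nat.cast_zero, zero_add, Complex.one_cpow] at this
        rw [← this]
        refine Finset.sum_congr rfl fun n _ => ?_
        push_cast
        rw [show (n : ℂ) + 1 + 1 = n + 2 by ring]
      simp_rw [e]
      have h0 : Filter.Tendsto (fun N : ℕ => ((N : ℂ) + 1) ^ (1 - s)) Filter.atTop (nhds 0) := by
        rw [tendsto_zero_iff_norm_tendsto_zero]
        have e2 : (fun N : ℕ => ‖((N : ℂ) + 1) ^ (1 - s)‖) = fun N : ℕ => ((N + 1 : ℕ) : ℝ) ^ (-(s.re - 1)) := by
          ext N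
          have := Complex.norm_cpow_eq_rpow_re_of_pos (x := (N : ℝ) + 1) (by positivity) (1 - s)
          push_cast at this ⊢
          rw [this]
          simp
        rw [e2]
        exact ((tendsto_rpow_neg_atTop (by linarith : 0 < s.re - 1)).comp
          tendsto_natCast_atTop_atTop).comp (Filter.tendsto_add_atTop_nat 1)
      simpa using h0.sub_const 1
    rw [← this]; exact hsm.hasSum
  have := ((hz.mul_left (s - 1)).add htel).tsum_eq
  rw [pntZ_of_ne hs1]
  simp only [pntE]
  rw [this]; ring

lemma pntZ_series {s : ℂ} (hs : 1 / 4 < s.re) : pntZ s = 1 + ∑' n, pntE n s := by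
  obtain ⟨R, hR2, hRs⟩ : ∃ R : ℝ, 3 < R ∧ ‖s‖ < R := ⟨max 3 ‖s‖ + 1, by
    linarith [le_max_left 3 ‖s‖], by linarith [le_max_right 3 ‖s‖]⟩
  set U : Set ℂ := {z | 1 / 4 < z.re} ∩ Metric.ball 0 R with hU
  have hUo : IsOpen U := (isOpen_lt continuous_const Complex.continuous_re).inter Metric.isOpen_ball
  have hUc : Convex ℝ U := (convex_halfSpace_re_gt _).inter (convex_ball _ _)
  have hd : DifferentiableOn ℂ (fun z => 1 + ∑' n, pntE n z) U := by
    refine (differentiableOn_const _).add ?_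
    refine Complex.differentiableOn_tsum_of_summable_norm
      (u := fun n : ℕ => (R + 1) * (2 * R * ((n : ℝ) + 1) ^ (-(5/4 : ℝ)))) ?_ ?_ hUo ?_
    · exact ((summable_shift_rpow (by norm_num)).mul_left _).mul_left _
    · exact fun n => (pntE_diff n).differentiableOn
    · intro n z hz
      have hz1 : 1 / 4 < z.re := hz.1
      have hz2 : ‖z‖ < R := by simpa using hz.2
      refine (pntE_bound z (by linarith) 1 zero_le_one le_rfl n).trans ?_
      rw [Real.rpow_one]
      have h3 : ‖z - 1‖ ≤ R + 1 := (norm_sub_le _ _).trans (by simp; linarith)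
      have h4 : ((n : ℝ) + 1) ^ (-z.re - 1) ≤ ((n : ℝ) + 1) ^ (-(5/4 : ℝ)) :=
        Real.rpow_le_rpow_of_exponent_le (by linarith [Nat.cast_nonneg (α := ℝ) n]) (by linarith)
      gcongr
  have := AnalyticOnNhd.eqOn_of_preconnected_of_eventuallyEq (f := pntZ)
    (g := fun z => 1 + ∑' n, pntE n z) (U := U) (z₀ := 2)
    (pntZ_diff.differentiableOn.analyticOnNhd hUo) (hd.analyticOnNhd hUo) hUc.isPreconnected
    ⟨by norm_num, by simp; linarith⟩ ?_
  · exact this ⟨hs, by simpa using hRs⟩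
  · have : {z : ℂ | 1 < z.re} ∈ nhds (2 : ℂ) :=
      (isOpen_lt continuous_const Complex.continuous_re).mem_nhds (by norm_num)
    filter_upwards [this] with z hz
    exact pntZ_series_one_lt hz

/-- Bound for zeta slightly to the left of the 1-line. -/
lemma zeta_bound (ε : ℝ) (h0 : 0 < ε) (h1 : ε ≤ 1 / 2) : ∃ C > 0, ∀ s : ℂ, 1 - ε ≤ s.re →
    s.re ≤ 3 → 1 ≤ |s.im| → ‖riemannZeta s‖ ≤ C * (|s.im| + 3) ^ (2 * ε) := by
  have hsm := summable_shift_rpow (a := -(1 + ε)) (by linarith)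
  set K := ∑' n : ℕ, ((n : ℝ) + 1) ^ (-(1 + ε)) with hK
  have hK0 : 0 ≤ K := tsum_nonneg fun n => by positivity
  refine ⟨1 + 2 * K, by positivity, fun s hs1 hs2 hs3 => ?_⟩
  have hne : s ≠ 1 := by rintro rfl; simp at hs3; linarith
  have hn1 : 1 ≤ ‖s - 1‖ := hs3.trans (by simpa using Complex.abs_im_le_norm (s - 1))
  have hns : ‖s‖ ≤ |s.im| + 3 := by
    refine (Complex.norm_le_abs_re_add_abs_im s).trans ?_
    rw [abs_of_nonneg (by linarith)]; linarith
  have e := pntZ_series (s := s) (by linarith)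
  rw [pntZ_of_ne hne] at e
  have hb : ∀ n : ℕ, ‖pntE n s‖ ≤ ‖s - 1‖ * (2 * (|s.im| + 3) ^ (2 * ε)) * ((n : ℝ) + 1) ^ (-(1 + ε)) := by
    intro n
    refine (pntE_bound s (by linarith) (2 * ε) (by linarith) (by linarith) n).trans ?_
    rw [mul_assoc ‖s - 1‖]
    have h4 : ((n : ℝ) + 1) ^ (-s.re - 2 * ε) ≤ ((n : ℝ) + 1) ^ (-(1 + ε)) :=
        Real.rpow_le_rpow_of_exponent_le (by linarith [Nat.cast_nonneg (α := ℝ) n]) (by linarith)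
    have h5 : ‖s‖ ^ (2 * ε) ≤ (|s.im| + 3) ^ (2 * ε) := by gcongr
    gcongr
  have hT : ‖∑' n, pntE n s‖ ≤ ‖s - 1‖ * (2 * (|s.im| + 3) ^ (2 * ε)) * K := by
    rw [hK, ← tsum_mul_left]
    exact tsum_of_norm_bounded (hsm.mul_left _).hasSum hb
  have h1' : 1 ≤ (|s.im| + 3) ^ (2 * ε) := Real.one_le_rpow (by linarith) (by linarith)
  have : ‖s - 1‖ * ‖riemannZeta s‖ ≤ ‖s - 1‖ * ((1 + 2 * K) * (|s.im| + 3) ^ (2 * ε)) := by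
    rw [← norm_mul, e]
    refine (norm_add_le _ _).trans ?_
    rw [norm_one]
    have : (1:ℝ) ≤ ‖s - 1‖ * (|s.im| + 3) ^ (2 * ε) := one_le_mul_of_one_le_of_one_le hn1 h1'
    nlinarith
  exact le_of_mul_le_mul_left this (by linarith)
end

section
lemma zeta_deriv_bound (δ : ℝ) (h0 : 0 < δ) (h1 : δ ≤ 1) : ∃ C > 0, ∀ s : ℂ, 1 - δ / 4 ≤ s.re →
    s.re ≤ 2 → 2 ≤ |s.im| → ‖riemannZeta s‖ ≤ C * (|s.im| + 3) ^ δ ∧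
      ‖deriv riemannZeta s‖ ≤ C * (|s.im| + 3) ^ δ := by
  obtain ⟨C, hC, hb⟩ := zeta_bound (δ / 2) (by linarith) (by linarith)
  rw [show 2 * (δ / 2) = δ by ring] at hb
  refine ⟨max C (C * 2 ^ δ / (δ / 4)), by positivity, fun s hs1 hs2 hs3 => ⟨?_, ?_⟩⟩
  · refine (hb s (by linarith) (by linarith) (by linarith)).trans ?_
    gcongr; exact le_max_left _ _
  · have hr : 0 < δ / 4 := by linarith
    have key := Complex.norm_deriv_le_of_forall_mem_sphere_norm_le (f := riemannZeta) (c := s)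
      (R := δ / 4) (C := C * (2 * (|s.im| + 3)) ^ δ) hr ?_ ?_
    · refine key.trans ?_
      rw [Real.mul_rpow (by norm_num) (by positivity)]
      calc C * (2 ^ δ * (|s.im| + 3) ^ δ) / (δ / 4) = (C * 2 ^ δ / (δ / 4)) * (|s.im| + 3) ^ δ := by ring
        _ ≤ _ := by gcongr; exact le_max_right _ _
    · apply DifferentiableOn.diffContOnCl
      rw [closure_ball _ hr.ne']
      intro z hz
      apply DifferentiableAt.differentiableWithinAt
      apply differentiableAt_riemannZeta
      rintro rfl
      have : |(1 - s).im| ≤ δ / 4 := (Complex.abs_im_le_norm _).trans (by simpa [dist_eq_norm] using hz)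
      simp at this; linarith
    · intro z hz
      have hz' : ‖z - s‖ = δ / 4 := by simpa [dist_eq_norm] using hz
      have a1 : |z.re - s.re| ≤ δ / 4 := by simpa [hz'] using Complex.abs_re_le_norm (z - s)
      have a2 : |z.im - s.im| ≤ δ / 4 := by simpa [hz'] using Complex.abs_im_le_norm (z - s)
      have a3 := abs_sub_abs_le_abs_sub s.im z.im
      have a4 := abs_sub_abs_le_abs_sub z.im s.im
      rw [abs_sub_comm] at a3
      rw [abs_le] at a1
      refine (hb z (by linarith) (by linarith) (by linarith)).trans ?_
      gcongr
      linarith [abs_nonneg s.im]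

lemma zeta_near_one : ∃ C > 0, ∀ x : ℝ, 0 < x → x ≤ 1 → ‖riemannZeta (1 + x)‖ ≤ C / x := by
  obtain ⟨C, hC⟩ := (isCompact_closedBall (1:ℂ) 1).exists_bound_of_continuousOn pntZ_diff.continuous.continuousOn
  refine ⟨max C 1, by positivity, fun x hx hx1 => ?_⟩
  have h := hC (1 + x) (by simp [abs_of_pos hx, hx1])
  rw [pntZ_of_ne (by simpa using hx.ne')] at h
  simp only [add_sub_cancel_left, norm_mul, Complex.norm_real, Real.norm_of_nonneg hx.le] at h
  rw [le_div_iff₀ hx, mul_comm]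
  exact h.trans (le_max_left _ _)

lemma zeta_341 (x : ℝ) (hx : 0 < x) (y : ℝ) :
    1 ≤ ‖riemannZeta (1 + x)‖ ^ 3 * ‖riemannZeta (1 + x + Complex.I * y)‖ ^ 4 *
      ‖riemannZeta (1 + x + 2 * Complex.I * y)‖ := by
  have := DirichletCharacter.norm_LFunction_product_ge_one (N := 1) 1 hx y
  rw [DirichletCharacter.LFunctionTrivChar, DirichletCharacter.LFunction_modOne_eq,
    DirichletCharacter.LFunction_modOne_eq] at this
  simpa [norm_mul, norm_pow] using this

lemma seg_aux (s z w : ℂ) (h1 : z.im = s.im) (h2 : s.re ≤ z.re) (hw : w ∈ segment ℝ s z) :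
    w.im = s.im ∧ s.re ≤ w.re ∧ w.re ≤ z.re := by
  obtain ⟨a, b', ha, hb', hab, rfl⟩ := hw
  have ha' : a = 1 - b' := by linarith
  subst ha'
  simp [h1]
  refine ⟨by ring, ?_, ?_⟩ <;> nlinarith

lemma zeta_lower (δ : ℝ) (h0 : 0 < δ) (h1 : δ ≤ 1) : ∃ c > 0, c ≤ δ / 4 ∧ ∀ s : ℂ,
    1 - c * (|s.im| + 3) ^ (-(5 * δ)) ≤ s.re → s.re ≤ 2 → 2 ≤ |s.im| →
      c * (|s.im| + 3) ^ (-(4 * δ)) ≤ ‖riemannZeta s‖ := by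
  obtain ⟨C, hC, hb⟩ := zeta_deriv_bound δ h0 h1
  obtain ⟨D, hD, hD1⟩ := zeta_near_one
  set κ := max (D ^ 3 * (C * 2 ^ δ)) 1 with hκ
  have hκ1 : 1 ≤ κ := le_max_right _ _
  have hκ0 : 0 < κ := by linarith
  have hκ4 : D ^ 3 * (C * 2 ^ δ) ≤ κ ^ 4 := (le_max_left _ _).trans (le_self_pow₀ hκ1 (by norm_num))
  set b := min (δ / 4) (1 / (4 * C * κ)) with hbd
  have hb0 : 0 < b := by positivity
  have hbδ : b ≤ δ / 4 := min_le_left _ _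
  have hb1 : b ≤ 1 := by linarith
  have hbC : b * (4 * C * κ) ≤ 1 := by
    rw [← le_div_iff₀ (by positivity)]; exact min_le_right _ _
  set c := min (b ^ 4) (b ^ 3 / (2 * κ)) with hc
  have hc0 : 0 < c := by positivity
  have hcb : c ≤ b ^ 4 := min_le_left _ _
  have hcb3 : c ≤ b ^ 3 / (2 * κ) := min_le_right _ _
  refine ⟨c, hc0, (hcb.trans (pow_le_of_le_one hb0.le hb1 (by norm_num))).trans hbδ, fun s hs1 hs2 hs3 => ?_⟩
  set τ := |s.im| + 3 with hτ
  have hτ1 : 1 ≤ τ := by linarith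
  have hτ0 : 0 < τ := by linarith
  set q := τ ^ (-δ) with hq
  have hq0 : 0 < q := by positivity
  have hq1 : q ≤ 1 := Real.rpow_le_one_of_one_le_of_nonpos hτ1 (by linarith)
  have e5 : τ ^ (-(5 * δ)) = q ^ 5 := by
    rw [hq, ← Real.rpow_natCast, ← Real.rpow_mul hτ0.le]; congr 1; push_cast; ring
  have e4 : τ ^ (-(4 * δ)) = q ^ 4 := by
    rw [hq, ← Real.rpow_natCast, ← Real.rpow_mul hτ0.le]; congr 1; push_cast; ring
  have eq : τ ^ δ * q = 1 := by rw [hq, ← Real.rpow_add hτ0]; simp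
  have eq' : τ ^ δ = q⁻¹ := eq_inv_of_mul_eq_one_left eq
  rw [e5] at hs1
  rw [e4]
  have hq5 : q ^ 5 ≤ 1 := pow_le_one₀ hq0.le hq1
  set η := b ^ 4 * q ^ 5 with hη
  have hη0 : 0 < η := by positivity
  have hη1 : η ≤ δ / 4 := by
    have : b ^ 4 ≤ b := pow_le_of_le_one hb0.le hb1 (by norm_num)
    calc η ≤ b * 1 := by rw [hη]; gcongr
      _ ≤ _ := by linarith
  -- lower bound to the right
  have right : ∀ x : ℝ, η ≤ x → x ≤ 1 → b ^ 3 / κ * q ^ 4 ≤ ‖riemannZeta (1 + x + Complex.I * s.im)‖ := by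
    intro x hx hx1
    have hx0 : 0 < x := by linarith
    have h := zeta_341 x hx0 s.im
    have h2 := (hb (1 + x + 2 * Complex.I * s.im) (by simp; linarith) (by simp; linarith)
      (by simp [abs_mul]; linarith)).1
    have h3 := hD1 x hx0 hx1
    set A := ‖riemannZeta (1 + x + Complex.I * s.im)‖ with hA
    have hA0 : 0 ≤ A := norm_nonneg _
    have h4 : ‖riemannZeta (1 + x + 2 * Complex.I * s.im)‖ ≤ C * 2 ^ δ * q⁻¹ := by
      refine h2.trans ?_
      rw [← eq', mul_assoc C, ← Real.mul_rpow (by norm_num) hτ0.le]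
      gcongr
      simp [abs_mul]; linarith
    have h5 : 1 ≤ (D / x) ^ 3 * A ^ 4 * (C * 2 ^ δ * q⁻¹) := by
      refine h.trans ?_
      gcongr
    have h6 : x ^ 3 * q ≤ κ ^ 4 * A ^ 4 := by
      have : x ^ 3 * q * ((D / x) ^ 3 * A ^ 4 * (C * 2 ^ δ * q⁻¹)) = D ^ 3 * (C * 2 ^ δ) * A ^ 4 := by
        field_simp
      calc x ^ 3 * q = x ^ 3 * q * 1 := by ring
        _ ≤ x ^ 3 * q * ((D / x) ^ 3 * A ^ 4 * (C * 2 ^ δ * q⁻¹)) := by gcongr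
        _ = _ := this
        _ ≤ _ := by gcongr
    have h7 : (b ^ 3 * q ^ 4) ^ 4 ≤ (κ * A) ^ 4 := by
      calc (b ^ 3 * q ^ 4) ^ 4 = η ^ 3 * q := by rw [hη]; ring
        _ ≤ x ^ 3 * q := by gcongr
        _ ≤ _ := h6
        _ = _ := by ring
    have h8 : b ^ 3 * q ^ 4 ≤ κ * A := le_of_pow_le_pow_left₀ (by norm_num) (by positivity) h7
    rw [div_mul_eq_mul_div, div_le_iff₀ hκ0]; linarith
  by_cases hcase : 1 + η ≤ s.re
  · have := right (s.re - 1) (by linarith) (by linarith)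
    have e : (1 + ((s.re - 1 : ℝ) : ℂ) + Complex.I * s.im) = s := by
      apply Complex.ext <;> simp
    rw [e] at this
    refine le_trans ?_ this
    have : b ^ 3 / (2 * κ) ≤ b ^ 3 / κ := by gcongr; linarith
    gcongr; linarith
  · push Not at hcase
    have hr := right η le_rfl (by linarith)
    set z : ℂ := 1 + η + Complex.I * s.im with hz
    have hzre : z.re = 1 + η := by simp [hz]
    have hzim : z.im = s.im := by simp [hz]
    have hcη : c * q ^ 5 ≤ η := by rw [hη]; gcongr
    have hseg : ‖riemannZeta z - riemannZeta s‖ ≤ (C * τ ^ δ) * ‖z - s‖ := by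
      refine Convex.norm_image_sub_le_of_norm_deriv_le (𝕜 := ℂ) (s := segment ℝ s z) ?_ ?_ (convex_segment _ _)
        (left_mem_segment _ _ _) (right_mem_segment _ _ _)
      all_goals
        intro w hw
        obtain ⟨him, hre⟩ := seg_aux s z w hzim (by linarith) hw
        rw [hzre] at hre
      · apply differentiableAt_riemannZeta
        rintro rfl
        simp at him
        rw [← him] at hs3; simp at hs3; linarith
      · have := (hb w (by linarith) (by linarith) (by rw [him]; exact hs3)).2
        rwa [him] at this
    have hzs : ‖z - s‖ ≤ 2 * η := by
      have : z - s = ((1 + η - s.re : ℝ) : ℂ) := by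
        apply Complex.ext <;> simp [hzre, hzim]
      rw [this, Complex.norm_real, Real.norm_of_nonneg (by linarith)]
      linarith
    have h9 : C * τ ^ δ * ‖z - s‖ ≤ b ^ 3 / (2 * κ) * q ^ 4 := by
      calc C * τ ^ δ * ‖z - s‖ ≤ C * τ ^ δ * (2 * η) := by gcongr
        _ = 2 * C * b ^ 4 * q ^ 4 * (τ ^ δ * q) := by rw [hη]; ring
        _ = 2 * C * b ^ 4 * q ^ 4 := by rw [eq]; ring
        _ = (b * (4 * C * κ)) * (b ^ 3 / (2 * κ) * q ^ 4) := by field_simp; ring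
        _ ≤ 1 * (b ^ 3 / (2 * κ) * q ^ 4) := by gcongr
        _ = _ := by ring
    have h10 : ‖riemannZeta z‖ ≤ ‖riemannZeta z - riemannZeta s‖ + ‖riemannZeta s‖ := by
      simpa using norm_add_le (riemannZeta z - riemannZeta s) (riemannZeta s)
    have h11 : c * q ^ 4 ≤ b ^ 3 / (2 * κ) * q ^ 4 := by gcongr
    have h12 : b ^ 3 / κ * q ^ 4 = 2 * (b ^ 3 / (2 * κ) * q ^ 4) := by field_simp
    linarith
end

section
noncomputable def pntF (s : ℂ) : ℂ := -deriv pntZ s / pntZ s - dslope pntZ 1 s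

lemma pntF_eq {s : ℂ} (hs : s ≠ 1) (hz : riemannZeta s ≠ 0) :
    pntF s = -deriv riemannZeta s / riemannZeta s - riemannZeta s := by
  have hs' : s - 1 ≠ 0 := sub_ne_zero.mpr hs
  have hd : deriv pntZ s = riemannZeta s + (s - 1) * deriv riemannZeta s := by
    have h : HasDerivAt (fun s => (s - 1) * riemannZeta s)
        (1 * riemannZeta s + (s - 1) * deriv riemannZeta s) s :=
      ((hasDerivAt_id s).sub_const 1).mul (differentiableAt_riemannZeta hs).hasDerivAt
    rw [one_mul] at h
    refine HasDerivAt.deriv (h.congr_of_eventuallyEq ?_)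
    filter_upwards [isOpen_ne.mem_nhds hs] with z hz
    exact pntZ_of_ne hz
  rw [pntF, hd, pntZ_of_ne hs, dslope_of_ne _ hs, slope_def_field, pntZ_one, pntZ_of_ne hs]
  field_simp
  ring

lemma pntF_diffAt {s : ℂ} (hz : pntZ s ≠ 0) : DifferentiableAt ℂ pntF s := by
  have h1 : DifferentiableAt ℂ (deriv pntZ) s := by
    have : DifferentiableOn ℂ (deriv pntZ) Set.univ :=
      pntZ_diff.differentiableOn.deriv isOpen_univ
    exact this.differentiableAt Filter.univ_mem
  have h2 : DifferentiableAt ℂ (dslope pntZ 1) s := by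
    have := (Complex.differentiableOn_dslope (f := pntZ) (s := Set.univ) (c := 1) Filter.univ_mem).mpr
      pntZ_diff.differentiableOn
    exact this.differentiableAt Filter.univ_mem
  exact (h1.neg.div (pntZ_diff s) hz).sub h2

lemma pntF_region (δ : ℝ) (h0 : 0 < δ) (h1 : δ ≤ 1) : ∃ c > 0, c ≤ 1 / 4 ∧ ∃ C > 0, ∀ s : ℂ,
    1 - c * (|s.im| + 3) ^ (-(5 * δ)) ≤ s.re → s.re ≤ 2 →
      pntZ s ≠ 0 ∧ ‖pntF s‖ ≤ C * (|s.im| + 3) ^ (5 * δ) := by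
  obtain ⟨C, hC, hb⟩ := zeta_deriv_bound δ h0 h1
  obtain ⟨c, hc, hc4, hl⟩ := zeta_lower δ h0 h1
  set K : Set ℂ := Set.Icc 1 2 ×ℂ Set.Icc (-2) 2 with hK
  have hKc : IsCompact K := isCompact_Icc.reProdIm isCompact_Icc
  have hV : IsOpen {s | pntZ s ≠ 0} := isOpen_ne_fun pntZ_diff.continuous continuous_const
  have hKV : K ⊆ {s | pntZ s ≠ 0} := by
    intro s hs
    simp only [Set.mem_ofPred_eq]
    by_cases h : s = 1
    · rw [h, pntZ_one]; exact one_ne_zero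
    · rw [pntZ_of_ne h]
      exact mul_ne_zero (sub_ne_zero.mpr h) (riemannZeta_ne_zero_of_one_le_re (by exact hs.1.1))
  obtain ⟨r, hr, hrK⟩ := hKc.exists_cthickening_subset_open hV hKV
  obtain ⟨B, hB⟩ := (hKc.cthickening (r := r)).exists_bound_of_continuousOn (f := pntF)
    (fun s hs => (pntF_diffAt (hrK hs)).continuousAt.continuousWithinAt)
  refine ⟨min c r, by positivity, (min_le_left _ _).trans (by linarith),
    max (C / c + C) (max B 1), by positivity, fun s hs1 hs2 => ?_⟩
  set τ := |s.im| + 3 with hτ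
  have hτ1 : 1 ≤ τ := by linarith [abs_nonneg s.im]
  have hτ0 : 0 < τ := by linarith
  by_cases him : 2 ≤ |s.im|
  · have hs1' : 1 - c * τ ^ (-(5 * δ)) ≤ s.re := by
      refine le_trans ?_ hs1
      gcongr
      exact min_le_left _ _
    have hτ' : τ ^ (-(5 * δ)) ≤ 1 := Real.rpow_le_one_of_one_le_of_nonpos hτ1 (by linarith)
    have hre : 1 - δ / 4 ≤ s.re := by
      have : c * τ ^ (-(5 * δ)) ≤ c * 1 := by gcongr
      linarith
    have hz := hl s hs1' hs2 him
    obtain ⟨b1, b2⟩ := hb s hre hs2 him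
    have hzpos : 0 < ‖riemannZeta s‖ := lt_of_lt_of_le (by positivity) hz
    have hz0 : riemannZeta s ≠ 0 := norm_pos_iff.mp hzpos
    have hne : s ≠ 1 := by rintro rfl; simp at him; linarith
    refine ⟨by rw [pntZ_of_ne hne]; exact mul_ne_zero (sub_ne_zero.mpr hne) hz0, ?_⟩
    rw [pntF_eq hne hz0]
    refine (norm_sub_le _ _).trans ?_
    rw [norm_div, norm_neg]
    have e1 : ‖deriv riemannZeta s‖ / ‖riemannZeta s‖ ≤ C / c * τ ^ (5 * δ) := by
      rw [div_le_iff₀ hzpos]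
      calc ‖deriv riemannZeta s‖ ≤ C * τ ^ δ := b2
        _ = C / c * τ ^ (5 * δ) * (c * τ ^ (-(4 * δ))) := by
            have : τ ^ (5 * δ) * τ ^ (-(4 * δ)) = τ ^ δ := by
              rw [← Real.rpow_add hτ0]; ring_nf
            rw [← this]; field_simp
        _ ≤ _ := by gcongr
    have e2 : τ ^ δ ≤ τ ^ (5 * δ) := Real.rpow_le_rpow_of_exponent_le hτ1 (by linarith)
    calc _ ≤ C / c * τ ^ (5 * δ) + C * τ ^ (5 * δ) := by
          refine add_le_add e1 (b1.trans ?_); gcongr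
      _ = (C / c + C) * τ ^ (5 * δ) := by ring
      _ ≤ _ := by gcongr; exact le_max_left _ _
  · push Not at him
    have hτ' : τ ^ (-(5 * δ)) ≤ 1 := Real.rpow_le_one_of_one_le_of_nonpos hτ1 (by linarith)
    have hre : 1 - r ≤ s.re := by
      have : min c r * τ ^ (-(5 * δ)) ≤ r * 1 := by gcongr; exact min_le_right _ _
      linarith
    have hmem : s ∈ Metric.cthickening r K := by
      refine Metric.mem_cthickening_of_dist_le s (⟨max 1 s.re, s.im⟩ : ℂ) r K ?_ ?_
      · have := abs_le.mp him.le
        rw [hK, Complex.mem_reProdIm]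
        exact ⟨⟨le_max_left _ _, max_le (by norm_num) hs2⟩, ⟨this.1, this.2⟩⟩
      · have : s - (⟨max 1 s.re, s.im⟩ : ℂ) = ((s.re - max 1 s.re : ℝ) : ℂ) := by
          apply Complex.ext <;> simp
        rw [dist_eq_norm, this, Complex.norm_real, Real.norm_eq_abs, abs_le]
        constructor
        · have : max 1 s.re ≤ s.re + r := max_le (by linarith) (by linarith)
          linarith
        · linarith [le_max_right 1 s.re]
    refine ⟨hrK hmem, (hB s hmem).trans ?_⟩
    have e2 : 1 ≤ τ ^ (5 * δ) := Real.one_le_rpow hτ1 (by linarith)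
    calc B ≤ max (C / c + C) (max B 1) := le_trans (le_max_left _ _) (le_max_right _ _)
      _ ≤ _ := le_mul_of_one_le_right (by positivity) e2

noncomputable def pntQ (s : ℂ) : ℂ := pntF s / (s * (s + 1))

lemma pntQ_deriv_bound (k : ℕ) : ∃ C > 0, ∀ s : ℂ, 1 < s.re → s.re ≤ 3 / 2 →
    ‖iteratedDeriv k pntQ s‖ ≤ C * (|s.im| + 3) ^ (-(3 / 2 : ℝ)) := by
  set δ : ℝ := 1 / (10 * (k + 1)) with hδ
  have hδ0 : 0 < δ := by positivity
  have hδ1 : δ ≤ 1 := by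
    rw [hδ, div_le_one (by positivity)]; linarith [Nat.cast_nonneg (α := ℝ) k]
  obtain ⟨c, hc, hc4, C, hC, hF⟩ := pntF_region δ hδ0 hδ1
  refine ⟨k.factorial * (64 * C) / c ^ k * 2 ^ (1 / 2 : ℝ), by positivity, fun s hs1 hs2 => ?_⟩
  set τ := |s.im| + 3 with hτ
  have hτ3 : 3 ≤ τ := by linarith [abs_nonneg s.im]
  have hτ0 : 0 < τ := by linarith
  set ρ := c * (2 * τ) ^ (-(5 * δ)) with hρ
  have hρ0 : 0 < ρ := by positivity
  have hρ4 : ρ ≤ 1 / 4 := by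
    have : (2 * τ) ^ (-(5 * δ)) ≤ 1 := Real.rpow_le_one_of_one_le_of_nonpos (by linarith) (by linarith)
    calc ρ ≤ c * 1 := by rw [hρ]; gcongr
      _ ≤ _ := by linarith
  have hball : ∀ z ∈ Metric.closedBall s ρ, 3 / 4 ≤ z.re ∧ τ / 8 ≤ ‖z‖ ∧ pntZ z ≠ 0 ∧
      ‖pntF z‖ ≤ C * (2 * τ) ^ (5 * δ) := by
    intro z hz
    have hz' : ‖z - s‖ ≤ ρ := by simpa [dist_eq_norm] using hz
    have a1 : |z.re - s.re| ≤ ρ := (by simpa using Complex.abs_re_le_norm (z - s) : |z.re - s.re| ≤ ‖z - s‖).trans hz'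
    have a2 : |z.im - s.im| ≤ ρ := (by simpa using Complex.abs_im_le_norm (z - s) : |z.im - s.im| ≤ ‖z - s‖).trans hz'
    have a3 := abs_sub_abs_le_abs_sub s.im z.im
    have a4 := abs_sub_abs_le_abs_sub z.im s.im
    rw [abs_sub_comm] at a3
    rw [abs_le] at a1
    have hzτ : |z.im| + 3 ≤ 2 * τ := by linarith
    have hpos : 0 < |z.im| + 3 := by positivity
    have h5 : (2 * τ) ^ (-(5 * δ)) ≤ (|z.im| + 3) ^ (-(5 * δ)) :=
      Real.rpow_le_rpow_of_nonpos hpos hzτ (by linarith)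
    have h6 : ρ ≤ c * (|z.im| + 3) ^ (-(5 * δ)) := by rw [hρ]; gcongr
    obtain ⟨g1, g2⟩ := hF z (by linarith) (by linarith)
    refine ⟨by linarith, ?_, g1, g2.trans ?_⟩
    · have n1 : z.re ≤ ‖z‖ := (le_abs_self _).trans (Complex.abs_re_le_norm z)
      have n2 := Complex.abs_im_le_norm z
      by_cases h : |s.im| ≤ 2 <;> linarith
    · gcongr
  have hz0 : ∀ z ∈ Metric.closedBall s ρ, z * (z + 1) ≠ 0 := by
    intro z hz
    have := (hball z hz).1
    refine mul_ne_zero ?_ ?_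
    · intro h; rw [h] at this; simp at this; linarith
    · intro h
      have h2 : z.re = -1 := by
        have := congrArg Complex.re h; simp at this; linarith
      linarith
  have key := Complex.norm_iteratedDeriv_le_of_forall_mem_sphere_norm_le (f := pntQ) (c := s)
    (R := ρ) (C := 64 * C * (2 * τ) ^ (5 * δ) * τ ^ (-(2:ℝ))) k hρ0 ?_ ?_
  · refine key.trans (le_of_eq ?_)
    have e1 : ρ ^ k = c ^ k * (2 * τ) ^ (-(5 * δ * k)) := by
      rw [hρ, mul_pow, ← Real.rpow_natCast ((2 * τ) ^ (-(5 * δ))), ← Real.rpow_mul (by positivity)]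
      ring_nf
    have e2 : (2 * τ) ^ (5 * δ) = (2 * τ) ^ (-(5 * δ * k)) * (2 * τ) ^ (1 / 2 : ℝ) := by
      rw [← Real.rpow_add (by positivity)]
      congr 1
      rw [hδ]; field_simp; ring
    have e3 : τ ^ (-(3 / 2 : ℝ)) = τ ^ (1 / 2 : ℝ) * τ ^ (-(2 : ℝ)) := by
      rw [← Real.rpow_add hτ0]; norm_num
    have e4 : (2 * τ) ^ (1 / 2 : ℝ) = 2 ^ (1 / 2 : ℝ) * τ ^ (1 / 2 : ℝ) :=
      Real.mul_rpow (by norm_num) hτ0.le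
    have e5 : (2 * τ) ^ (-(5 * δ * k)) ≠ 0 := by positivity
    rw [e1, e2, e3, e4]
    field_simp
  · apply DifferentiableOn.diffContOnCl
    rw [closure_ball _ hρ0.ne']
    intro z hz
    apply DifferentiableAt.differentiableWithinAt
    exact (pntF_diffAt (hball z hz).2.2.1).div (by fun_prop) (hz0 z hz)
  · intro z hz
    have hz' := Metric.sphere_subset_closedBall hz
    obtain ⟨g1, g2, g3, g4⟩ := hball z hz'
    have n3 : ‖z‖ ≤ ‖z + 1‖ := by
      rw [← sq_le_sq₀ (norm_nonneg _) (norm_nonneg _), ← Complex.normSq_eq_norm_sq,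
        ← Complex.normSq_eq_norm_sq, Complex.normSq_apply, Complex.normSq_apply]
      simp; nlinarith
    rw [pntQ, norm_div, norm_mul]
    have hden : τ ^ 2 / 64 ≤ ‖z‖ * ‖z + 1‖ := by
      calc τ ^ 2 / 64 = (τ / 8) * (τ / 8) := by ring
        _ ≤ _ := by gcongr; linarith
    calc ‖pntF z‖ / (‖z‖ * ‖z + 1‖) ≤ C * (2 * τ) ^ (5 * δ) / (τ ^ 2 / 64) := by gcongr
      _ = _ := by
        rw [Real.rpow_neg hτ0.le, Real.rpow_two]; field_simp
end

section
noncomputable def pntc (n : ℕ) : ℝ := if n = 0 then 0 else ArithmeticFunction.vonMangoldt n - 1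

noncomputable def pntphi (t : ℝ) : ℝ := max 0 (1 - t)

noncomputable def pntw (t : ℝ) : ℂ := ∑' n : ℕ, (pntc n : ℂ) * (pntphi (n * t) : ℂ)

lemma pntphi_cont : Continuous pntphi := by unfold pntphi; fun_prop

lemma pntphi_mellin {s : ℂ} (hs : 0 < s.re) :
    HasMellin (fun t => (pntphi t : ℂ)) s (1 / (s * (s + 1))) := by
  have h1 := hasMellin_one_Ioc hs
  have h2 := hasMellin_cpow_Ioc 1 (s := s) (by simp; linarith)
  have h3 := hasMellin_sub h1.1 h2.1
  have hcongr : Set.EqOn (fun t : ℝ => (t : ℂ) ^ (s - 1) • (((Set.Ioc 0 1).indicator (fun x => 1) t : ℂ)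
      - (Set.Ioc 0 1).indicator (fun t : ℝ => (t : ℂ) ^ (1 : ℂ)) t))
      (fun t : ℝ => (t : ℂ) ^ (s - 1) • (pntphi t : ℂ)) (Set.Ioi 0) := by
    intro t ht
    have ht' : 0 < t := ht
    by_cases h : t ≤ 1
    · have : t ∈ Set.Ioc (0 : ℝ) 1 := ⟨ht, h⟩
      simp [Set.indicator_of_mem this, pntphi, max_eq_right (sub_nonneg.mpr h)]
    · have h' : t ∉ Set.Ioc (0 : ℝ) 1 := fun hh => h hh.2
      have : max 0 (1 - t) = 0 := max_eq_left (by linarith)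
      simp [Set.indicator_of_notMem h', pntphi, this]
  have hs0 : s ≠ 0 := by rintro rfl; simp at hs
  have hs1 : s + 1 ≠ 0 := by
    intro h
    have := congrArg Complex.re h
    simp at this; linarith
  constructor
  · exact (MeasureTheory.integrableOn_congr_fun hcongr measurableSet_Ioi).mp h3.1
  · have := h3.2
    rw [h1.2, h2.2] at this
    rw [mellin] at this ⊢
    rw [← MeasureTheory.setIntegral_congr_fun measurableSet_Ioi hcongr, this]
    field_simp
    ring

lemma pntc_term {s : ℂ} (n : ℕ) :
    (pntc n : ℂ) * (n : ℂ) ^ (-s) = LSeries.term ((fun n => (ArithmeticFunction.vonMangoldt n : ℂ)) - 1) s n := by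
  rw [LSeries.term_def, pntc]
  split_ifs with h
  · simp
  · simp [Complex.cpow_neg, div_eq_mul_inv]

lemma pntc_summable {s : ℂ} (hs : 1 < s.re) :
    LSeriesSummable ((fun n => (ArithmeticFunction.vonMangoldt n : ℂ)) - 1) s :=
  (ArithmeticFunction.LSeriesSummable_vonMangoldt hs).sub (LSeriesSummable_one_iff.mpr hs)

lemma pntc_LSeries {s : ℂ} (hs : 1 < s.re) :
    LSeries ((fun n => (ArithmeticFunction.vonMangoldt n : ℂ)) - 1) s = pntF s := by
  rw [LSeries_sub (ArithmeticFunction.LSeriesSummable_vonMangoldt hs) (LSeriesSummable_one_iff.mpr hs),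
    ArithmeticFunction.LSeries_vonMangoldt_eq_deriv_riemannZeta_div hs, LSeries_one_eq_riemannZeta hs,
    pntF_eq (by rintro rfl; simp at hs) (riemannZeta_ne_zero_of_one_le_re hs.le)]

lemma pntphi_int (s : ℂ) {n : ℕ} (hn : 0 < n) :
    ∫ t in Set.Ioi (0:ℝ), ‖(t : ℂ) ^ (s - 1) • (pntphi (n * t) : ℂ)‖ =
      ‖(n : ℂ) ^ (-s)‖ * ∫ t in Set.Ioi (0:ℝ), ‖(t : ℂ) ^ (s - 1) • (pntphi t : ℂ)‖ := by
  have hn' : (0:ℝ) < n := by exact_mod_cast hn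
  have h := MeasureTheory.integral_comp_mul_left_Ioi
    (fun t : ℝ => ‖(t : ℂ) ^ (s - 1) • (pntphi t : ℂ)‖) 0 hn'
  rw [mul_zero] at h
  have h2 : ∫ t in Set.Ioi (0:ℝ), ‖((n * t : ℝ) : ℂ) ^ (s - 1) • (pntphi (n * t) : ℂ)‖ =
      ∫ t in Set.Ioi (0:ℝ), (n:ℝ) ^ (s.re - 1) * ‖(t : ℂ) ^ (s - 1) • (pntphi (n * t) : ℂ)‖ := by
    refine MeasureTheory.setIntegral_congr_fun measurableSet_Ioi ?_
    intro t ht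
    have ht' : 0 < t := ht
    simp only [norm_smul]
    rw [Complex.norm_cpow_eq_rpow_re_of_pos (by positivity), Complex.norm_cpow_eq_rpow_re_of_pos ht',
      Real.mul_rpow hn'.le ht'.le]
    simp [mul_assoc]
  rw [h2, MeasureTheory.integral_const_mul] at h
  rw [Complex.norm_natCast_cpow_of_pos hn]
  have h3 : (n:ℝ) ^ (s.re - 1) = (n:ℝ) ^ s.re * (n:ℝ)⁻¹ := by
    rw [Real.rpow_sub_one hn'.ne', div_eq_mul_inv]
  rw [h3, smul_eq_mul] at h
  have h4 : 0 < (n:ℝ) ^ s.re := by positivity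
  rw [Complex.neg_re, Real.rpow_neg hn'.le]
  field_simp at h ⊢
  linarith

lemma pntw_mellin {s : ℂ} (hs : 1 < s.re) : mellin pntw s = pntQ s := by
  have hs0 : 0 < s.re := by linarith
  have hphi := pntphi_mellin hs0
  have hF : ∀ n : ℕ, MeasureTheory.Integrable
      (fun t : ℝ => (pntc n : ℂ) * ((t : ℂ) ^ (s - 1) • (pntphi (n * t) : ℂ)))
      (MeasureTheory.volume.restrict (Set.Ioi 0)) := by
    intro n
    rcases Nat.eq_zero_or_pos n with rfl | hn
    · simp [pntc]
    · have hn' : (0:ℝ) < n := by exact_mod_cast hn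
      have := (MellinConvergent.comp_mul_left (f := fun t => (pntphi t : ℂ)) (s := s) hn').mpr hphi.1
      exact this.const_mul _
  have hsum : Summable (fun n : ℕ => ∫ t in Set.Ioi (0:ℝ),
      ‖(pntc n : ℂ) * ((t : ℂ) ^ (s - 1) • (pntphi (n * t) : ℂ))‖) := by
    have h := ((pntc_summable hs).norm).mul_right
      (∫ t in Set.Ioi (0:ℝ), ‖(t : ℂ) ^ (s - 1) • (pntphi t : ℂ)‖)
    refine h.congr ?_
    intro n
    rw [← pntc_term]
    rcases Nat.eq_zero_or_pos n with rfl | hn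
    · simp [pntc]
    · simp only [norm_mul]
      rw [MeasureTheory.integral_const_mul, pntphi_int s hn]
      ring
  have h := MeasureTheory.hasSum_integral_of_summable_integral_norm hF hsum
  have e1 : (∫ t in Set.Ioi (0:ℝ), ∑' n : ℕ, (pntc n : ℂ) * ((t : ℂ) ^ (s - 1) • (pntphi (n * t) : ℂ)))
      = mellin pntw s := by
    rw [mellin]
    congr 1
    ext t
    rw [pntw, smul_eq_mul, ← tsum_mul_left]
    congr 1
    ext n
    simp only [smul_eq_mul]; ring
  rw [e1] at h
  have e2 : ∀ n : ℕ, (∫ t in Set.Ioi (0:ℝ), (pntc n : ℂ) * ((t : ℂ) ^ (s - 1) • (pntphi (n * t) : ℂ)))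
      = LSeries.term ((fun n => (ArithmeticFunction.vonMangoldt n : ℂ)) - 1) s n * (1 / (s * (s + 1))) := by
    intro n
    rw [← pntc_term]
    rcases Nat.eq_zero_or_pos n with rfl | hn
    · simp [pntc]
    · have hn' : (0:ℝ) < n := by exact_mod_cast hn
      rw [MeasureTheory.integral_const_mul]
      have := mellin_comp_mul_left (fun t => (pntphi t : ℂ)) s hn'
      rw [hphi.2, mellin] at this
      rw [this]
      simp [mul_assoc]
  simp_rw [e2] at h
  have h2 := ((pntc_summable hs).hasSum).mul_right (1 / (s * (s + 1)))
  rw [h.unique h2, pntQ, ← pntc_LSeries hs, LSeries]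
  ring

lemma pntphi_zero {t : ℝ} (h : 1 ≤ t) : pntphi t = 0 := max_eq_left (by linarith)

lemma pntw_eq_sum {t : ℝ} {M : ℕ} (h : 1 ≤ M * t) (ht : 0 < t) :
    pntw t = ∑ n ∈ Finset.range M, (pntc n : ℂ) * (pntphi (n * t) : ℂ) := by
  rw [pntw, tsum_eq_sum]
  intro n hn
  have hn' : M ≤ n := by simpa using hn
  have : (M:ℝ) ≤ n := by exact_mod_cast hn'
  rw [pntphi_zero (by nlinarith)]
  simp

lemma pntw_contAt {t : ℝ} (ht : 0 < t) : ContinuousAt pntw t := by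
  obtain ⟨M, hM⟩ := exists_nat_gt (2 / t)
  have hc : Continuous (fun t : ℝ => ∑ n ∈ Finset.range M, (pntc n : ℂ) * (pntphi (n * t) : ℂ)) := by
    have := pntphi_cont
    fun_prop
  refine hc.continuousAt.congr ?_
  have : Set.Ioi (t / 2) ∈ nhds t := Ioi_mem_nhds (by linarith)
  filter_upwards [this] with u hu
  have hu' : t / 2 < u := hu
  refine (pntw_eq_sum ?_ (by linarith)).symm
  rw [div_lt_iff₀ ht] at hM
  have : (0:ℝ) ≤ M := by positivity
  nlinarith

lemma pntw_zero {t : ℝ} (h : 1 ≤ t) : pntw t = 0 := by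
  rw [pntw_eq_sum (M := 1) (by simpa using h) (by linarith)]
  simp [pntc]

lemma pntw_bound : ∃ C > 0, ∀ t : ℝ, 0 < t → ‖pntw t‖ ≤ C / t := by
  refine ⟨(Real.log 4 + 4) + 1, by positivity, ?_⟩
  intro t ht
  rcases le_or_gt 1 t with h1 | h1
  · rw [pntw_zero h1]; simp; positivity
  have hM : 1 ≤ ((⌊1 / t⌋₊ + 1 : ℕ) : ℝ) * t := by
    have := Nat.lt_floor_add_one (1 / t)
    rw [div_lt_iff₀ ht] at this
    push_cast; linarith
  rw [pntw_eq_sum hM ht, Finset.sum_range_succ']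
  have h0 : (pntc 0 : ℂ) = 0 := by simp [pntc]
  rw [h0, zero_mul, add_zero]
  have hpsi := Chebyshev.psi_le_const_mul_self (x := 1 / t) (by positivity)
  have hle : (∑ n ∈ Finset.range ⌊1 / t⌋₊, (ArithmeticFunction.vonMangoldt (n + 1) + 1))
      ≤ (Real.log 4 + 4 + 1) / t := by
    rw [Finset.sum_add_distrib]
    have e : (∑ n ∈ Finset.range ⌊1 / t⌋₊, ArithmeticFunction.vonMangoldt (n + 1)) = Chebyshev.psi (1 / t) := by
      have hI : Finset.Ioc 0 ⌊1 / t⌋₊ = Finset.Ico (0 + 1) (⌊1 / t⌋₊ + 1) := by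
        ext; simp; omega
      rw [Chebyshev.psi, hI, Finset.range_eq_Ico,
        Finset.sum_Ico_add' (fun n => ArithmeticFunction.vonMangoldt n)]
    have := Nat.floor_le (a := 1 / t) (by positivity)
    simp only [Finset.sum_const, Finset.card_range, nsmul_eq_mul, mul_one]
    rw [e]
    calc _ ≤ (Real.log 4 + 4) * (1 / t) + 1 / t := by linarith
      _ = _ := by ring
  refine le_trans (norm_sum_le _ _) (le_trans (Finset.sum_le_sum ?_) hle)
  intro n _
  have hL := ArithmeticFunction.vonMangoldt_nonneg (n := n + 1)
  rw [norm_mul, Complex.norm_real, Complex.norm_real]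
  have a1 : ‖pntc (n + 1)‖ ≤ ArithmeticFunction.vonMangoldt (n + 1) + 1 := by
    rw [pntc, if_neg (by omega), Real.norm_eq_abs, abs_le]
    constructor <;> linarith
  have a2 : ‖pntphi ((n + 1 : ℕ) * t)‖ ≤ 1 := by
    rw [pntphi, Real.norm_eq_abs, abs_of_nonneg (le_max_left _ _)]
    refine max_le (by norm_num) ?_
    have : 0 ≤ ((n + 1 : ℕ) : ℝ) * t := by positivity
    linarith
  calc _ ≤ ‖pntc (n + 1)‖ * 1 := by gcongr
    _ ≤ _ := by linarith
end

section
open Filter Topology Asymptotics in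
lemma pntwk_bigO (k : ℕ) {b : ℝ} (hb : 1 < b) :
    (fun t => (Real.log t) ^ k • pntw t) =O[𝓝[>] 0] fun x : ℝ => x ^ (-b) := by
  obtain ⟨C, hC, h⟩ := pntw_bound
  have h1 : (fun t => pntw t) =O[𝓝[>] 0] fun x : ℝ => x ^ (-1 : ℝ) := by
    refine IsBigO.of_bound C ?_
    filter_upwards [self_mem_nhdsWithin] with t ht
    have ht' : 0 < t := ht
    refine (h t ht).trans (le_of_eq ?_)
    rw [Real.rpow_neg_one, norm_inv, Real.norm_of_nonneg ht'.le, div_eq_mul_inv]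
  have h2 : (fun t : ℝ => Real.log t ^ k) =O[𝓝[>] 0] fun x : ℝ => x ^ (1 - b) := by
    have := (isLittleO_abs_log_rpow_rpow_nhdsGT_zero (s := 1 - b) (k : ℝ) (by linarith)).isBigO
    refine IsBigO.trans ?_ this
    refine IsBigO.of_bound 1 (Eventually.of_forall fun t => ?_)
    simp
  refine (h2.smul h1).trans ?_
  refine IsBigO.of_bound 1 ?_
  filter_upwards [self_mem_nhdsWithin] with t ht
  have ht' : 0 < t := ht
  rw [smul_eq_mul, ← Real.rpow_add ht', one_mul]
  apply le_of_eq; congr 2; ring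

lemma pntwk_cont (k : ℕ) {t : ℝ} (ht : 0 < t) :
    ContinuousAt (fun t => (Real.log t) ^ k • pntw t) t :=
  ((Real.continuousAt_log ht.ne').pow k).smul (pntw_contAt ht)

open Filter Topology Asymptotics in
lemma pntwk_step (k : ℕ) {s : ℂ} (hs : 1 < s.re) :
    MellinConvergent (fun t => (Real.log t) ^ (k+1) • pntw t) s ∧
    HasDerivAt (mellin (fun t => (Real.log t) ^ k • pntw t))
      (mellin (fun t => (Real.log t) ^ (k+1) • pntw t) s) s := by
  have h := mellin_hasDerivAt_of_isBigO_rpow (a := s.re + 1) (b := (1 + s.re) / 2) (s := s)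
    (f := fun t => (Real.log t) ^ k • pntw t) ?_ ?_ (by linarith) (pntwk_bigO k (by linarith)) (by linarith)
  · have e : (fun t => Real.log t • (Real.log t) ^ k • pntw t) =
        (fun t => (Real.log t) ^ (k+1) • pntw t) := by
      ext t; rw [smul_smul, pow_succ']
    simp only [e] at h
    exact h
  · refine ContinuousOn.locallyIntegrableOn ?_ measurableSet_Ioi
    intro t ht
    exact (pntwk_cont k ht).continuousWithinAt
  · refine IsBigO.of_bound 1 ?_
    filter_upwards [eventually_ge_atTop 1] with t ht
    rw [pntw_zero ht]; simp

lemma pntwk_mellin (k : ℕ) {s : ℂ} (hs : 1 < s.re) :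
    mellin (fun t => (Real.log t) ^ k • pntw t) s = iteratedDeriv k pntQ s := by
  induction k generalizing s with
  | zero => simpa using pntw_mellin hs
  | succ k ih =>
    rw [iteratedDeriv_succ]
    have h := (pntwk_step k hs).2
    rw [← h.deriv]
    apply Filter.EventuallyEq.deriv_eq
    have : {s : ℂ | 1 < s.re} ∈ nhds s := (isOpen_lt continuous_const Complex.continuous_re).mem_nhds hs
    filter_upwards [this] with z hz
    exact ih hz

lemma pnt_integrable : MeasureTheory.Integrable (fun y : ℝ => (|y| + 3) ^ (-(3/2:ℝ))) := by
  have h := integrable_one_add_norm (E := ℝ) (μ := MeasureTheory.volume) (r := 3/2) (by simp; norm_num)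
  refine h.mono' ?_ ?_
  · apply Continuous.aestronglyMeasurable
    refine Continuous.rpow_const (by fun_prop) ?_
    intro y; left; positivity
  · refine Filter.Eventually.of_forall fun y => ?_
    rw [Real.norm_of_nonneg (by positivity)]
    apply Real.rpow_le_rpow_of_nonpos (by positivity) _ (by norm_num)
    rw [Real.norm_eq_abs]; linarith

lemma pntwk_bound (k : ℕ) : ∃ C > 0, ∀ t : ℝ, 0 < t → ‖pntw t‖ * |Real.log t| ^ k ≤ C / t := by
  obtain ⟨C, hC, hb⟩ := pntQ_deriv_bound (k + 1)
  set I := ∫ y : ℝ, (|y| + 3) ^ (-(3/2:ℝ)) with hI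
  have hI0 : 0 ≤ I := MeasureTheory.integral_nonneg fun y => by positivity
  have key : ∀ t : ℝ, 0 < t → ∀ σ : ℝ, 1 < σ → σ ≤ 3/2 →
      ‖(Real.log t) ^ (k+1) • pntw t‖ ≤ (C * I) * t ^ (-σ) := by
    intro t ht σ h1 h2
    have hre : ∀ y : ℝ, ((σ : ℂ) + y * Complex.I).re = σ := by intro y; simp
    have him : ∀ y : ℝ, ((σ : ℂ) + y * Complex.I).im = y := by intro y; simp
    have hconv := (pntwk_step k (s := (σ : ℂ)) (by simpa using h1)).1
    have hbd : ∀ y : ℝ, ‖mellin (fun t => (Real.log t) ^ (k+1) • pntw t) ((σ : ℂ) + y * Complex.I)‖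
        ≤ C * (|y| + 3) ^ (-(3/2:ℝ)) := by
      intro y
      rw [pntwk_mellin (k+1) (by rw [hre]; exact h1)]
      have := hb ((σ : ℂ) + y * Complex.I) (by rw [hre]; exact h1) (by rw [hre]; exact h2)
      rwa [him] at this
    have hvert : Complex.VerticalIntegrable (mellin (fun t => (Real.log t) ^ (k+1) • pntw t)) σ := by
      refine (pnt_integrable.const_mul C).mono' ?_ (Filter.Eventually.of_forall hbd)
      apply Continuous.aestronglyMeasurable
      rw [continuous_iff_continuousAt]
      intro y
      have hd := ((pntwk_step (k+1) (s := (σ : ℂ) + y * Complex.I) (by rw [hre]; exact h1)).2).continuousAt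
      exact ContinuousAt.comp (f := fun y : ℝ => (σ : ℂ) + y * Complex.I) hd (by fun_prop)
    have hinv := mellinInv_mellin_eq σ (fun t => (Real.log t) ^ (k+1) • pntw t) ht hconv hvert
      (pntwk_cont (k+1) ht)
    rw [← hinv, mellinInv, norm_smul]
    have hn : ‖(1 / (2 * Real.pi) : ℝ)‖ ≤ 1 := by
      rw [Real.norm_of_nonneg (by positivity), div_le_one (by positivity)]
      linarith [Real.pi_gt_three]
    have hint : ‖∫ y : ℝ, (t : ℂ) ^ (-((σ : ℂ) + y * Complex.I)) •
        mellin (fun t => (Real.log t) ^ (k+1) • pntw t) ((σ : ℂ) + y * Complex.I)‖ ≤ C * I * t ^ (-σ) := by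
      have e : C * I * t ^ (-σ) = ∫ y : ℝ, (C * t ^ (-σ)) * (|y| + 3) ^ (-(3/2:ℝ)) := by
        rw [MeasureTheory.integral_const_mul]; ring
      rw [e]
      refine MeasureTheory.norm_integral_le_of_norm_le (pnt_integrable.const_mul _) ?_
      refine Filter.Eventually.of_forall fun y => ?_
      rw [norm_smul, Complex.norm_cpow_eq_rpow_re_of_pos ht, Complex.neg_re, hre]
      have := hbd y
      have h0 : 0 ≤ t ^ (-σ) := by positivity
      calc _ ≤ t ^ (-σ) * (C * (|y| + 3) ^ (-(3/2:ℝ))) := by gcongr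
        _ = _ := by ring
    have h0 : 0 ≤ C * I * t ^ (-σ) := by positivity
    calc _ ≤ 1 * (C * I * t ^ (-σ)) := by gcongr
      _ = _ := one_mul _
  have key2 : ∀ t : ℝ, 0 < t → ‖(Real.log t) ^ (k+1) • pntw t‖ ≤ (C * I) / t := by
    intro t ht
    have hc : Filter.Tendsto (fun σ : ℝ => (C * I) * t ^ (-σ)) (nhdsWithin 1 (Set.Ioi 1)) (nhds ((C * I) * t ^ (-(1:ℝ)))) := by
      have : Continuous (fun σ : ℝ => (C * I) * t ^ (-σ)) := by
        refine continuous_const.mul ?_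
        exact (Real.continuous_const_rpow ht.ne').comp continuous_neg
      exact (this.tendsto 1).mono_left nhdsWithin_le_nhds
    have := ge_of_tendsto hc (b := ‖(Real.log t) ^ (k+1) • pntw t‖) ?_
    · rwa [Real.rpow_neg_one, ← div_eq_mul_inv] at this
    · filter_upwards [Ioc_mem_nhdsGT (show (1:ℝ) < 3/2 by norm_num)] with σ hσ
      exact key t ht σ hσ.1 hσ.2
  obtain ⟨D, hD, hw⟩ := pntw_bound
  refine ⟨C * I + D, by positivity, ?_⟩
  intro t ht
  have h1 := key2 t ht
  have h2 := hw t ht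
  rw [norm_smul, norm_pow, Real.norm_eq_abs] at h1
  have h3 : 0 ≤ ‖pntw t‖ := norm_nonneg _
  rcases le_total (|Real.log t|) 1 with h | h
  · have : |Real.log t| ^ k ≤ 1 := pow_le_one₀ (abs_nonneg _) h
    have h4 : 0 ≤ C * I / t := by positivity
    rw [add_div]
    nlinarith
  · have : |Real.log t| ^ k ≤ |Real.log t| ^ (k+1) := pow_le_pow_right₀ h (by omega)
    have h4 : 0 ≤ D / t := by positivity
    rw [add_div]
    nlinarith
end

section
open ArithmeticFunction (vonMangoldt)

noncomputable def pntS (x : ℝ) : ℝ := ∑ n ∈ Finset.Ioc 0 ⌊x⌋₊, vonMangoldt n * (x - n)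

lemma pntS_eq {x : ℝ} {M : ℕ} (hM : ⌊x⌋₊ ≤ M) (hx : 0 ≤ x) :
    pntS x = ∑ n ∈ Finset.Ioc 0 M, vonMangoldt n * max 0 (x - n) := by
  rw [pntS]
  have hsub : Finset.Ioc 0 ⌊x⌋₊ ⊆ Finset.Ioc 0 M := Finset.Ioc_subset_Ioc_right hM
  rw [← Finset.sum_subset hsub]
  · refine Finset.sum_congr rfl fun n hn => ?_
    have : (n:ℝ) ≤ x := (Nat.le_floor_iff hx).mp (Finset.mem_Ioc.mp hn).2
    rw [max_eq_right (by linarith)]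
  · intro n hn hn2
    have : x < n := by
      by_contra! h
      exact hn2 (Finset.mem_Ioc.mpr ⟨(Finset.mem_Ioc.mp hn).1, Nat.le_floor h⟩)
    rw [max_eq_left (by linarith), mul_zero]

lemma psi_eq_sum_ite {x : ℝ} {M : ℕ} (hM : ⌊x⌋₊ ≤ M) (hx : 0 ≤ x) :
    Chebyshev.psi x = ∑ n ∈ Finset.Ioc 0 M, vonMangoldt n * (if (n:ℝ) ≤ x then 1 else 0) := by
  rw [Chebyshev.psi]
  have hsub : Finset.Ioc 0 ⌊x⌋₊ ⊆ Finset.Ioc 0 M := Finset.Ioc_subset_Ioc_right hM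
  rw [← Finset.sum_subset hsub]
  · refine Finset.sum_congr rfl fun n hn => ?_
    have : (n:ℝ) ≤ x := (Nat.le_floor_iff hx).mp (Finset.mem_Ioc.mp hn).2
    rw [if_pos this, mul_one]
  · intro n hn hn2
    have : x < n := by
      by_contra! h
      exact hn2 (Finset.mem_Ioc.mpr ⟨(Finset.mem_Ioc.mp hn).1, Nat.le_floor h⟩)
    rw [if_neg (by linarith), mul_zero]

lemma pntS_convex {x y : ℝ} (hx : 0 ≤ x) (hy : 0 ≤ y) :
    pntS x + (y - x) * Chebyshev.psi x ≤ pntS y := by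
  rw [pntS_eq (le_max_left ⌊x⌋₊ ⌊y⌋₊) hx, pntS_eq (le_max_right ⌊x⌋₊ ⌊y⌋₊) hy,
    psi_eq_sum_ite (le_max_left ⌊x⌋₊ ⌊y⌋₊) hx, Finset.mul_sum, ← Finset.sum_add_distrib]
  refine Finset.sum_le_sum fun n _ => ?_
  have h := ArithmeticFunction.vonMangoldt_nonneg (n := n)
  have : max 0 (x - n) + (y - x) * (if (n:ℝ) ≤ x then 1 else 0) ≤ max 0 (y - n) := by
    split_ifs with h1
    · rw [max_eq_right (by linarith)]
      exact le_trans (by linarith) (le_max_right _ _)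
    · rw [max_eq_left (by linarith)]
      simp
  nlinarith

lemma pnt_S0 {x : ℝ} (hx : 1 ≤ x) :
    |∑ n ∈ Finset.Ioc 0 ⌊x⌋₊, (x - n) - x ^ 2 / 2| ≤ x := by
  have h1 : ∀ m : ℕ, ∑ n ∈ Finset.Ioc 0 m, (x - n) = m * x - m * (m + 1) / 2 := by
    intro m
    induction m with
    | zero => simp
    | succ m ih =>
      rw [Finset.sum_Ioc_succ_top (Nat.zero_le _), ih]
      push_cast; ring
  rw [h1]
  have h2 := Nat.floor_le (a := x) (by linarith)
  have h3 := Nat.lt_floor_add_one x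
  set m : ℝ := (⌊x⌋₊ : ℝ)
  have h4 : 0 ≤ m := Nat.cast_nonneg _
  rw [abs_le]
  constructor <;> nlinarith

lemma pntS_pntw {x : ℝ} (hx : 1 ≤ x) :
    ((pntS x - ∑ n ∈ Finset.Ioc 0 ⌊x⌋₊, (x - n) : ℝ) : ℂ) = x * pntw (1 / x) := by
  have hx0 : 0 < x := by linarith
  have hM : 1 ≤ ((⌊x⌋₊ + 1 : ℕ) : ℝ) * (1 / x) := by
    have := Nat.lt_floor_add_one x
    rw [mul_one_div, le_div_iff₀ hx0]
    push_cast; linarith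
  rw [pntw_eq_sum hM (by positivity), pntS, ← Finset.sum_sub_distrib, Finset.mul_sum]
  have hI : Finset.range (⌊x⌋₊ + 1) = insert 0 (Finset.Ioc 0 ⌊x⌋₊) := by
    ext n; simp
  rw [hI, Finset.sum_insert (by simp)]
  simp only [pntc, if_true, Complex.ofReal_zero, zero_mul, mul_zero, zero_add]
  push_cast
  refine Finset.sum_congr rfl fun n hn => ?_
  have h2 := Finset.mem_Ioc.mp hn
  have : (n:ℝ) ≤ x := (Nat.le_floor_iff hx0.le).mp h2.2
  rw [if_neg (by omega), pntphi, max_eq_right]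
  · have : (x:ℂ) ≠ 0 := by exact_mod_cast hx0.ne'
    push_cast
    field_simp
  · rw [mul_one_div, sub_nonneg, div_le_one hx0]; exact this

lemma pow_log_le (k : ℕ) : ∃ C > 0, ∀ x : ℝ, 1 ≤ x → Real.log x ^ k ≤ C * x := by
  refine ⟨(k.factorial : ℝ), by positivity, ?_⟩
  intro x hx
  have h := Real.pow_div_factorial_le_exp (Real.log x) (Real.log_nonneg hx) k
  rw [Real.exp_log (by linarith), div_le_iff₀ (by positivity)] at h
  linarith

lemma pntS_asymp (k : ℕ) : ∃ C > 0, ∀ x : ℝ, 2 ≤ x →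
    |pntS x - x ^ 2 / 2| ≤ C * x ^ 2 / Real.log x ^ k := by
  obtain ⟨C, hC, h⟩ := pntwk_bound k
  obtain ⟨D, hD, hl⟩ := pow_log_le k
  refine ⟨C + D, by positivity, ?_⟩
  intro x hx
  have hx0 : 0 < x := by linarith
  have hlog : 0 < Real.log x := Real.log_pos (by linarith)
  have h1 := h (1 / x) (by positivity)
  have h2 := pntS_pntw (x := x) (by linarith)
  have h3 := congrArg norm h2
  rw [Complex.norm_real, norm_mul, Complex.norm_real, Real.norm_eq_abs, Real.norm_eq_abs, abs_of_pos hx0] at h3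
  rw [one_div, Real.log_inv, abs_neg, abs_of_pos hlog, div_inv_eq_mul, ← one_div] at h1
  have h4 := pnt_S0 (x := x) (by linarith)
  have h5 := hl x (by linarith)
  have hp : 0 < Real.log x ^ k := by positivity
  rw [le_div_iff₀ hp]
  have h6 : |pntS x - x ^ 2 / 2| ≤ x * ‖pntw (1 / x)‖ + x := by
    rw [← h3]
    have := abs_add_le (pntS x - ∑ n ∈ Finset.Ioc 0 ⌊x⌋₊, (x - n)) (∑ n ∈ Finset.Ioc 0 ⌊x⌋₊, (x - n) - x ^ 2 / 2)
    rw [sub_add_sub_cancel] at this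
    linarith
  calc _ ≤ (x * ‖pntw (1 / x)‖ + x) * Real.log x ^ k := by gcongr
    _ = x * (‖pntw (1 / x)‖ * Real.log x ^ k) + x * Real.log x ^ k := by ring
    _ ≤ x * (C * x) + x * (D * x) := by gcongr
    _ = _ := by ring

lemma psi_asymp (A : ℕ) : ∃ C > 0, ∀ x : ℝ, 4 ≤ x →
    |Chebyshev.psi x - x| ≤ C * x / Real.log x ^ A := by
  obtain ⟨C, hC, h⟩ := pntS_asymp (2 * A)
  refine ⟨1 + 2 * (4 * C + C + 2 ^ (2 * A) * C), by positivity, ?_⟩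
  intro x hx
  have hx0 : 0 < x := by linarith
  have hlog : 1 ≤ Real.log x := by
    rw [Real.le_log_iff_exp_le hx0]
    linarith [Real.exp_one_lt_d9]
  set L := Real.log x ^ A with hL
  have hL1 : 1 ≤ L := one_le_pow₀ hlog
  have hL0 : 0 < L := by linarith
  set d := x / (2 * L) with hd
  have hd0 : 0 < d := by positivity
  have hd2 : d ≤ x / 2 := by
    rw [hd]; gcongr; linarith
  have e1 := h x (by linarith)
  have e2 := h (x + d) (by linarith)
  have e3 := h (x - d) (by linarith)
  have hpow : Real.log x ^ (2 * A) = L ^ 2 := by rw [hL, mul_comm, pow_mul]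
  have hE : d * (2 * d * (2 * C)) = C * x ^ 2 / L ^ 2 := by rw [hd]; field_simp
  rw [hpow, ← hE] at e1
  have e2' : |pntS (x + d) - (x + d) ^ 2 / 2| ≤ d * (2 * d * (2 * C)) * 4 := by
    refine e2.trans ?_
    have : Real.log x ≤ Real.log (x + d) := Real.log_le_log hx0 (by linarith)
    have h2 : L ^ 2 ≤ Real.log (x + d) ^ (2 * A) := by
      rw [← hpow]; gcongr
    calc C * (x + d) ^ 2 / Real.log (x + d) ^ (2 * A) ≤ C * (2 * x) ^ 2 / L ^ 2 := by gcongr; linarith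
      _ = _ := by rw [hE]; ring
  have e3' : |pntS (x - d) - (x - d) ^ 2 / 2| ≤ d * (2 * d * (2 * C)) * 2 ^ (2 * A) := by
    refine e3.trans ?_
    have h1 : Real.log x / 2 ≤ Real.log (x - d) := by
      have : Real.log (Real.sqrt x) ≤ Real.log (x - d) := by
        apply Real.log_le_log (by positivity)
        have hs : 2 ≤ Real.sqrt x := Real.le_sqrt_of_sq_le (by linarith)
        have := Real.mul_self_sqrt hx0.le
        nlinarith
      rwa [Real.log_sqrt hx0.le] at this
    have h2 : L ^ 2 / 2 ^ (2 * A) ≤ Real.log (x - d) ^ (2 * A) := by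
      rw [← hpow, ← div_pow]; gcongr
    calc C * (x - d) ^ 2 / Real.log (x - d) ^ (2 * A) ≤ C * x ^ 2 / (L ^ 2 / 2 ^ (2 * A)) := by
          gcongr
          · linarith
          · linarith
      _ = _ := by rw [hE]; field_simp
  have c1 := pntS_convex (x := x) (y := x + d) hx0.le (by linarith)
  have c2 := pntS_convex (x := x) (y := x - d) hx0.le (by linarith)
  rw [abs_le] at e1 e2' e3'
  set P : ℝ := 2 ^ (2 * A)
  have hP : 0 < P := by positivity
  have goal : |Chebyshev.psi x - x| ≤ d * (2 * (1 + 2 * (4 * C + C + P * C))) := by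
    have f1 : d * (Chebyshev.psi x - x) ≤ d * (d / 2 + 2 * d * (2 * C) * (4 + 1)) := by nlinarith
    have f2 : d * (-(Chebyshev.psi x - x)) ≤ d * (d / 2 + 2 * d * (2 * C) * (P + 1)) := by nlinarith
    have f1' := le_of_mul_le_mul_left f1 hd0
    have f2' := le_of_mul_le_mul_left f2 hd0
    have : 0 < d * C := by positivity
    have : 0 < d * C * P := by positivity
    rw [abs_le]
    constructor <;> nlinarith
  refine goal.trans (le_of_eq ?_)
  rw [hd]; field_simp

lemma theta_asymp (A : ℕ) : ∃ C > 0, ∀ x : ℝ, 2 ≤ x →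
    |Chebyshev.theta x - x| ≤ C * x / Real.log x ^ A := by
  obtain ⟨C, hC, h⟩ := psi_asymp A
  obtain ⟨D, hD, hl⟩ := pow_log_le (A + 1)
  set K := Real.log 4 + 4 + 1 with hK
  have hK0 : 0 < K := by positivity
  refine ⟨C + 2 * (D * 2 ^ (A + 1)) + K * (2 ^ A), by positivity, ?_⟩
  intro x hx
  have hx0 : 0 < x := by linarith
  have hlog : 0 < Real.log x := Real.log_pos (by linarith)
  have hp : 0 < Real.log x ^ A := by positivity
  rw [le_div_iff₀ hp]
  rcases le_total 4 x with h4 | h4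
  · have h1 := h x h4
    rw [le_div_iff₀ hp] at h1
    have h2 := Chebyshev.abs_psi_sub_theta_le_sqrt_mul_log (x := x) (by linarith)
    have h3 := hl (Real.sqrt x) (by rw [Real.one_le_sqrt]; linarith)
    rw [Real.log_sqrt hx0.le, div_pow, div_le_iff₀ (by positivity)] at h3
    have h5 : |Chebyshev.theta x - x| ≤ |Chebyshev.psi x - x| + |Chebyshev.psi x - Chebyshev.theta x| := by
      have := abs_sub (Chebyshev.psi x - x) (Chebyshev.psi x - Chebyshev.theta x)
      rwa [sub_sub_sub_cancel_left] at this
    have hs := Real.mul_self_sqrt hx0.le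
    have hs0 := Real.sqrt_nonneg x
    have hKA : 0 < K * 2 ^ A * x := by positivity
    calc |Chebyshev.theta x - x| * Real.log x ^ A
        ≤ (|Chebyshev.psi x - x| + 2 * √x * Real.log x) * Real.log x ^ A := by gcongr; linarith
      _ = |Chebyshev.psi x - x| * Real.log x ^ A + 2 * √x * Real.log x ^ (A + 1) := by ring
      _ ≤ C * x + 2 * √x * (D * √x * 2 ^ (A + 1)) := by gcongr
      _ = C * x + 2 * (D * 2 ^ (A + 1)) * (√x * √x) := by ring
      _ ≤ _ := by rw [hs]; linarith
  · have h1 := Chebyshev.theta_le_log4_mul_x (x := x) hx0.le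
    have h2 := Chebyshev.theta_nonneg x
    have h3 : Real.log x ≤ 2 := by
      have : Real.log x ≤ Real.log 4 := Real.log_le_log hx0 h4
      have h4' : Real.log 4 = 2 * Real.log 2 := by
        rw [show (4:ℝ) = 2 ^ 2 by norm_num, Real.log_pow]; norm_num
      linarith [Real.log_two_lt_d9]
    have hl4 : 0 ≤ Real.log 4 := Real.log_nonneg (by norm_num)
    have h5 : |Chebyshev.theta x - x| ≤ K * x := by
      rw [abs_le]; constructor <;> nlinarith
    have h6 : Real.log x ^ A ≤ 2 ^ A := by gcongr
    have h7 : 0 < (C + 2 * (D * 2 ^ (A + 1))) * x := by positivity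
    calc _ ≤ K * x * 2 ^ A := by gcongr
      _ ≤ _ := by linarith
end

section
open Finset in
lemma abel_theta {x : ℝ} (hx : 2 ≤ x) {f f' : ℝ → ℝ}
    (hf : ∀ t, 2 ≤ t → HasDerivAt f (f' t) t) (hf' : ContinuousOn f' (Set.Ici 2)) :
    ∑ p ∈ Ioc 0 ⌊x⌋₊ with p.Prime, f p * Real.log p =
      (∫ t in (2:ℝ)..x, f t) + 2 * f 2 + f x * (Chebyshev.theta x - x)
        - ∫ t in (2:ℝ)..x, f' t * (Chebyshev.theta t - t) := by
  have hu : Set.uIcc 2 x = Set.Icc 2 x := Set.uIcc_of_le hx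
  have hsub : Set.Icc 2 x ⊆ Set.Ici 2 := Set.Icc_subset_Ici_self
  have hci : IntervalIntegrable f' MeasureTheory.volume 2 x :=
    ContinuousOn.intervalIntegrable (by rw [hu]; exact hf'.mono hsub)
  have hfi : IntervalIntegrable f MeasureTheory.volume 2 x :=
    ContinuousOn.intervalIntegrable (by
      rw [hu]; intro t ht; exact (hf t ht.1).continuousAt.continuousWithinAt)
  let c : ℕ → ℝ := fun n => if n.Prime then Real.log n else 0
  have hc0 : c 0 = 0 := by simp [c]
  have hc1 : c 1 = 0 := by simp [c]
  have hsum : ∀ t : ℝ, ∑ k ∈ Icc 0 ⌊t⌋₊, c k = Chebyshev.theta t := by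
    intro t
    rw [Chebyshev.theta_eq_sum_Icc, Finset.sum_filter]
  have hd : ∀ t ∈ Set.Icc 2 x, deriv f t = f' t := fun t ht => (hf t ht.1).deriv
  have h := sum_mul_eq_sub_integral_mul₁ c hc0 hc1 x (f := f) (fun t ht => (hf t ht.1).differentiableAt) (by
    rw [MeasureTheory.integrableOn_congr_fun hd measurableSet_Icc]
    exact (hf'.mono hsub).integrableOn_Icc)
  have h1 : ∑ k ∈ Icc 0 ⌊x⌋₊, f k * c k = ∑ p ∈ Ioc 0 ⌊x⌋₊ with p.Prime, f p * Real.log p := by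
    rw [Finset.Icc_eq_cons_Ioc (Nat.zero_le _), Finset.sum_cons, hc0, mul_zero, zero_add, Finset.sum_filter]
    refine Finset.sum_congr rfl fun n _ => ?_
    simp only [c]; split_ifs <;> simp
  rw [← h1, h]
  simp only [hsum]
  rw [← intervalIntegral.integral_of_le hx]
  have e1 : ∫ t in (2:ℝ)..x, deriv f t * Chebyshev.theta t = ∫ t in (2:ℝ)..x, f' t * Chebyshev.theta t :=
    intervalIntegral.integral_congr (by rw [hu]; intro t ht; simp only [hd t ht])
  have i1 : IntervalIntegrable (fun t => f' t * Chebyshev.theta t) MeasureTheory.volume 2 x :=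
    (Chebyshev.theta_mono.intervalIntegrable).continuousOn_mul (by rw [hu]; exact hf'.mono hsub)
  have i2 : IntervalIntegrable (fun t => f' t * t) MeasureTheory.volume 2 x :=
    hci.mul_continuousOn continuousOn_id
  have e2 : ∫ t in (2:ℝ)..x, f' t * (Chebyshev.theta t - t) =
      (∫ t in (2:ℝ)..x, f' t * Chebyshev.theta t) - ∫ t in (2:ℝ)..x, f' t * t := by
    rw [← intervalIntegral.integral_sub i1 i2]
    congr 1; ext t; ring
  have e3 : ∫ t in (2:ℝ)..x, (f' t * t + f t) = f x * x - f 2 * 2 := by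
    refine intervalIntegral.integral_eq_sub_of_hasDerivAt (f := fun t => f t * t) ?_ (i2.add hfi)
    intro t ht
    rw [hu] at ht
    have := (hf t ht.1).mul (hasDerivAt_id t)
    rw [id, mul_one] at this
    exact this
  rw [intervalIntegral.integral_add i2 hfi] at e3
  rw [e1, e2]
  linarith

/-- integral bound -/
lemma int_log_bound (B : ℕ) (C : ℝ) (hC : 0 < C) : ∃ K > 0, ∀ (g : ℝ → ℝ),
    (∀ t, 2 ≤ t → |g t| ≤ C / Real.log t ^ B) → ∀ x, 2 ≤ x →
    |∫ t in (2:ℝ)..x, g t| ≤ K * x / Real.log x ^ B := by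
  obtain ⟨D, hD, hl⟩ := pow_log_le B
  have hl2 : 0 < Real.log 2 := Real.log_pos (by norm_num)
  set c := C / Real.log 2 ^ B with hc
  have hc0 : 0 < c := by positivity
  refine ⟨c * D * 2 ^ B + C * 2 ^ B + c * 2 ^ B, by positivity, ?_⟩
  intro g hg x hx
  have hx0 : 0 < x := by linarith
  have hlog : 0 < Real.log x := Real.log_pos (by linarith)
  have hp : 0 < Real.log x ^ B := by positivity
  have hgc : ∀ t, 2 ≤ t → |g t| ≤ c := by
    intro t ht
    refine (hg t ht).trans ?_
    rw [hc]; gcongr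
  by_cases hint : IntervalIntegrable g MeasureTheory.volume 2 x
  swap
  · rw [intervalIntegral.integral_undef hint, abs_zero]; positivity
  rw [le_div_iff₀ hp]
  rcases le_total 4 x with h4 | h4
  · have hs2 : 2 ≤ √x := Real.le_sqrt_of_sq_le (by linarith)
    have hss := Real.mul_self_sqrt hx0.le
    have hsx : √x ≤ x := by nlinarith
    have hm : √x ∈ Set.uIcc 2 x := by rw [Set.uIcc_of_le hx]; exact ⟨hs2, hsx⟩
    have hi1 := hint.mono_set (Set.uIcc_subset_uIcc_left hm)
    have hi2 := hint.mono_set (Set.uIcc_subset_uIcc_right hm)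
    rw [← intervalIntegral.integral_add_adjacent_intervals hi1 hi2]
    have b1 : |∫ t in (2:ℝ)..√x, g t| ≤ c * |√x - 2| := by
      rw [← Real.norm_eq_abs (∫ t in _.._, g t)]
      refine intervalIntegral.norm_integral_le_of_norm_le_const ?_
      intro t ht
      rw [Set.uIoc_of_le hs2] at ht
      exact hgc t ht.1.le
    have b2 : |∫ t in √x..x, g t| ≤ C * 2 ^ B / Real.log x ^ B * |x - √x| := by
      rw [← Real.norm_eq_abs (∫ t in _.._, g t)]
      refine intervalIntegral.norm_integral_le_of_norm_le_const ?_
      intro t ht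
      rw [Set.uIoc_of_le hsx] at ht
      have ht2 : 2 ≤ t := hs2.trans ht.1.le
      refine (hg t ht2).trans ?_
      have : Real.log x / 2 ≤ Real.log t := by
        rw [← Real.log_sqrt hx0.le]
        exact Real.log_le_log (by linarith) ht.1.le
      calc C / Real.log t ^ B ≤ C / (Real.log x / 2) ^ B := by gcongr
        _ = _ := by rw [div_pow]; field_simp
    rw [abs_of_nonneg (show (0:ℝ) ≤ √x - 2 by linarith)] at b1
    rw [abs_of_nonneg (show (0:ℝ) ≤ x - √x by linarith)] at b2
    have b1' : |∫ t in (2:ℝ)..√x, g t| ≤ c * √x := b1.trans (by gcongr; linarith)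
    have b2' : |∫ t in √x..x, g t| * Real.log x ^ B ≤ C * 2 ^ B * x := by
      calc _ ≤ C * 2 ^ B / Real.log x ^ B * (x - √x) * Real.log x ^ B := by gcongr
        _ = C * 2 ^ B * (x - √x) := by field_simp
        _ ≤ _ := by gcongr; linarith [Real.sqrt_nonneg x]
    have h3 := hl (Real.sqrt x) (by linarith)
    rw [Real.log_sqrt hx0.le, div_pow, div_le_iff₀ (by positivity)] at h3
    have h7 : 0 < c * 2 ^ B * x := by positivity
    calc |(∫ t in (2:ℝ)..√x, g t) + ∫ t in √x..x, g t| * Real.log x ^ B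
        ≤ (|∫ t in (2:ℝ)..√x, g t| + |∫ t in √x..x, g t|) * Real.log x ^ B := by
          gcongr; exact abs_add_le _ _
      _ = |∫ t in (2:ℝ)..√x, g t| * Real.log x ^ B + |∫ t in √x..x, g t| * Real.log x ^ B := by ring
      _ ≤ c * √x * (D * √x * 2 ^ B) + C * 2 ^ B * x := by gcongr
      _ = c * D * 2 ^ B * (√x * √x) + C * 2 ^ B * x := by ring
      _ ≤ _ := by rw [hss]; linarith
  · have b1 : |∫ t in (2:ℝ)..x, g t| ≤ c * |x - 2| := by
      rw [← Real.norm_eq_abs (∫ t in _.._, g t)]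
      refine intervalIntegral.norm_integral_le_of_norm_le_const ?_
      intro t ht
      rw [Set.uIoc_of_le hx] at ht
      exact hgc t ht.1.le
    rw [abs_of_nonneg (show (0:ℝ) ≤ x - 2 by linarith)] at b1
    have h3 : Real.log x ≤ 2 := by
      have : Real.log x ≤ Real.log 4 := Real.log_le_log hx0 h4
      have h4' : Real.log 4 = 2 * Real.log 2 := by
        rw [show (4:ℝ) = 2 ^ 2 by norm_num, Real.log_pow]; norm_num
      linarith [Real.log_two_lt_d9]
    have h6 : Real.log x ^ B ≤ 2 ^ B := by gcongr
    have h7 : 0 < (c * D * 2 ^ B + C * 2 ^ B) * x := by positivity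
    calc _ ≤ c * x * 2 ^ B := by
          gcongr; exact b1.trans (by gcongr; linarith)
      _ ≤ _ := by linarith

noncomputable def pntLi (x : ℝ) : ℝ := ∫ t in (2:ℝ)..x, 1 / Real.log t

lemma pi_asymp (A : ℕ) : ∃ C > 0, ∀ x : ℝ, 2 ≤ x →
    |(((Finset.Ioc 0 ⌊x⌋₊).filter Nat.Prime).card : ℝ) - pntLi x| ≤ C * x / Real.log x ^ A := by
  obtain ⟨C, hC, h⟩ := theta_asymp A
  obtain ⟨K, hK, hk⟩ := int_log_bound A (C / Real.log 2 ^ 2) (by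
    have : 0 < Real.log 2 := Real.log_pos (by norm_num)
    positivity)
  obtain ⟨D, hD, hl⟩ := pow_log_le A
  have hl2 : 0 < Real.log 2 := Real.log_pos (by norm_num)
  refine ⟨2 * (1 / Real.log 2) * D + C / Real.log 2 + K, by positivity, ?_⟩
  intro x hx
  have hx0 : 0 < x := by linarith
  have hlog : 0 < Real.log x := Real.log_pos (by linarith)
  have hp : 0 < Real.log x ^ A := by positivity
  have hab := abel_theta hx (f := fun t => 1 / Real.log t) (f' := fun t => -(1 / (t * Real.log t ^ 2))) (by
    intro t ht
    have h1 : 0 < Real.log t := Real.log_pos (by linarith)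
    have := (Real.hasDerivAt_log (show t ≠ 0 by linarith)).inv h1.ne'
    simp only [one_div]
    refine this.congr_deriv ?_
    field_simp) (by
    have h0 : ∀ t ∈ Set.Ici (2:ℝ), t ≠ 0 := fun t ht => by have : (2:ℝ) ≤ t := ht; linarith
    refine (ContinuousOn.div continuousOn_const (continuousOn_id.mul ((Real.continuousOn_log.mono ?_).pow 2)) ?_).neg
    · intro t ht; exact h0 t ht
    · intro t ht
      have ht2 : (2:ℝ) ≤ t := ht
      have h1 : 0 < Real.log t := Real.log_pos (by linarith)
      exact mul_ne_zero (h0 t ht) (pow_ne_zero 2 h1.ne'))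
  have hcard : ∑ p ∈ Finset.Ioc 0 ⌊x⌋₊ with p.Prime, 1 / Real.log p * Real.log p
      = (((Finset.Ioc 0 ⌊x⌋₊).filter Nat.Prime).card : ℝ) := by
    rw [Finset.card_eq_sum_ones]; push_cast
    refine Finset.sum_congr rfl fun p hp => ?_
    have h2 : 2 ≤ p := (Finset.mem_filter.mp hp).2.two_le
    have : 0 < Real.log p := Real.log_pos (by exact_mod_cast h2)
    field_simp
  rw [hcard] at hab
  have hb := hk (fun t => -(1 / (t * Real.log t ^ 2)) * (Chebyshev.theta t - t)) (by
    intro t ht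
    have h1 : Real.log 2 ≤ Real.log t := Real.log_le_log (by norm_num) ht
    have h1' : 0 < Real.log t := by linarith
    have ht0 : 0 < t := by linarith
    rw [abs_mul, abs_neg, abs_of_nonneg (by positivity)]
    have := h t ht
    calc _ ≤ 1 / (t * Real.log 2 ^ 2) * (C * t / Real.log t ^ A) := by gcongr
      _ = _ := by field_simp) x hx
  have h2 := h x hx
  have h3 := hl x (by linarith)
  have hll : Real.log 2 ≤ Real.log x := Real.log_le_log (by norm_num) hx
  have t1 : |2 * (1 / Real.log 2)| ≤ 2 * (1 / Real.log 2) * D * x / Real.log x ^ A := by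
    rw [abs_of_nonneg (by positivity), le_div_iff₀ hp, mul_assoc _ D x]
    gcongr
  have t2 : |1 / Real.log x * (Chebyshev.theta x - x)| ≤ C / Real.log 2 * x / Real.log x ^ A := by
    rw [abs_mul, abs_of_nonneg (by positivity)]
    calc _ ≤ 1 / Real.log 2 * (C * x / Real.log x ^ A) := by gcongr
      _ = _ := by ring
  have : (((Finset.Ioc 0 ⌊x⌋₊).filter Nat.Prime).card : ℝ) - pntLi x =
      2 * (1 / Real.log 2) + 1 / Real.log x * (Chebyshev.theta x - x)
        - ∫ t in (2:ℝ)..x, -(1 / (t * Real.log t ^ 2)) * (Chebyshev.theta t - t) := by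
    rw [hab, pntLi]; ring
  rw [this]
  refine (abs_sub _ _).trans ?_
  refine (add_le_add (abs_add_le _ _) le_rfl).trans ?_
  refine (add_le_add (add_le_add t1 t2) hb).trans (le_of_eq ?_)
  ring
end

section
open MeasureTheory
lemma log_tail (A : ℕ) {x : ℝ} (hx : 1 < x) :
    IntegrableOn (fun t : ℝ => 1 / (t * Real.log t ^ (A + 2))) (Set.Ioi x) ∧
    ∫ t in Set.Ioi x, 1 / (t * Real.log t ^ (A + 2)) = 1 / ((A + 1) * Real.log x ^ (A + 1)) := by
  have hd : ∀ t ∈ Set.Ici x, HasDerivAt (fun t => -(1 / (((A:ℝ) + 1) * Real.log t ^ (A + 1))))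
      (1 / (t * Real.log t ^ (A + 2))) t := by
    intro t ht
    have ht1 : 1 < t := lt_of_lt_of_le hx ht
    have h1 : 0 < Real.log t := Real.log_pos ht1
    have := ((((Real.hasDerivAt_log (show t ≠ 0 by linarith)).pow (A + 1)).const_mul ((A:ℝ) + 1)).inv
      (by simp only [Pi.pow_apply]; positivity)).neg
    simp only [one_div]
    refine this.congr_deriv ?_
    simp
    field_simp
    ring
  have hpos : ∀ t ∈ Set.Ioi x, 0 ≤ 1 / (t * Real.log t ^ (A + 2)) := by
    intro t ht
    have ht1 : 1 < t := lt_trans hx ht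
    have h1 : 0 < Real.log t := Real.log_pos ht1
    positivity
  have hl : Filter.Tendsto (fun t => -(1 / (((A:ℝ) + 1) * Real.log t ^ (A + 1)))) Filter.atTop (nhds 0) := by
    rw [← neg_zero]
    apply Filter.Tendsto.neg
    simp only [one_div]
    apply Filter.Tendsto.inv_tendsto_atTop
    apply Filter.Tendsto.const_mul_atTop (by positivity)
    exact (Filter.tendsto_pow_atTop (by omega)).comp Real.tendsto_log_atTop
  refine ⟨integrableOn_Ioi_deriv_of_nonneg' hd hpos hl, ?_⟩
  rw [integral_Ioi_of_hasDerivAt_of_nonneg' hd hpos hl]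
  ring

lemma mertens_asymp : ∃ M : ℝ, ∀ A : ℕ, ∃ C > 0, ∀ x : ℝ, 2 ≤ x →
    |(∑ p ∈ Finset.Ioc 0 ⌊x⌋₊ with p.Prime, 1 / (p:ℝ)) - Real.log (Real.log x) - M|
      ≤ C / Real.log x ^ (A + 1) := by
  set f' : ℝ → ℝ := fun t => -((Real.log t + 1) / (t ^ 2 * Real.log t ^ 2)) with hf'
  set g : ℝ → ℝ := fun t => f' t * (Chebyshev.theta t - t) with hg
  have hl2 : 0 < Real.log 2 := Real.log_pos (by norm_num)
  have hgm : AEStronglyMeasurable g (volume) := by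
    apply Measurable.aestronglyMeasurable
    have := Chebyshev.theta_mono.measurable
    simp only [hg, hf']
    fun_prop
  have hb : ∀ A : ℕ, ∃ C > 0, ∀ t, 2 ≤ t → |g t| ≤ C * (1 / (t * Real.log t ^ (A + 2))) := by
    intro A
    obtain ⟨C, hC, h⟩ := theta_asymp (A + 1)
    refine ⟨C * (1 + 1 / Real.log 2), by positivity, ?_⟩
    intro t ht
    have h1 : Real.log 2 ≤ Real.log t := Real.log_le_log (by norm_num) ht
    have h1' : 0 < Real.log t := by linarith
    have ht0 : 0 < t := by linarith
    have h3 : Real.log t + 1 ≤ (1 + 1 / Real.log 2) * Real.log t := by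
      have : 1 ≤ 1 / Real.log 2 * Real.log t := by
        rw [one_div_mul_eq_div, le_div_iff₀ hl2]; linarith
      linarith
    simp only [hg, hf']
    rw [abs_mul, abs_neg, abs_of_nonneg (by positivity)]
    calc _ ≤ ((1 + 1 / Real.log 2) * Real.log t) / (t ^ 2 * Real.log t ^ 2) * (C * t / Real.log t ^ (A + 1)) := by
          gcongr; exact h t ht
      _ = _ := by rw [pow_succ _ (A + 1)]; field_simp
  have hint : ∀ x, 2 ≤ x → IntegrableOn g (Set.Ioi x) := by
    intro x hx
    obtain ⟨C, hC, h⟩ := hb 0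
    refine Integrable.mono' ((log_tail 0 (show 1 < x by linarith)).1.const_mul C) hgm.restrict ?_
    filter_upwards [ae_restrict_mem measurableSet_Ioi] with t ht
    have : x < t := ht
    exact h t (by linarith)
  refine ⟨-Real.log (Real.log 2) + 1 / Real.log 2 - ∫ t in Set.Ioi 2, g t, ?_⟩
  intro A
  obtain ⟨C, hC, h⟩ := hb A
  obtain ⟨D, hD, hth⟩ := theta_asymp A
  refine ⟨C + D, by positivity, ?_⟩
  intro x hx
  have hx0 : 0 < x := by linarith
  have hlog : 0 < Real.log x := Real.log_pos (by linarith)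
  have hab := abel_theta hx (f := fun t => 1 / (t * Real.log t)) (f' := f') (by
    intro t ht
    have h1 : 0 < Real.log t := Real.log_pos (by linarith)
    have ht0 : t ≠ 0 := by linarith
    have := ((hasDerivAt_id t).mul (Real.hasDerivAt_log ht0)).inv (by simp; constructor; linarith; constructor <;> linarith)
    simp only [one_div]
    refine this.congr_deriv ?_
    simp [hf']
    field_simp
    ring) (by
    have h0 : ∀ t ∈ Set.Ici (2:ℝ), t ≠ 0 := fun t ht => by have : (2:ℝ) ≤ t := ht; linarith
    have hlc : ContinuousOn Real.log (Set.Ici (2:ℝ)) := Real.continuousOn_log.mono (fun t ht => h0 t ht)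
    refine (ContinuousOn.div (hlc.add continuousOn_const) ((continuousOn_id.pow 2).mul (hlc.pow 2)) ?_).neg
    intro t ht
    have ht2 : (2:ℝ) ≤ t := ht
    have h1 : 0 < Real.log t := Real.log_pos (by linarith)
    exact mul_ne_zero (pow_ne_zero 2 (h0 t ht)) (pow_ne_zero 2 h1.ne'))
  have hsum : ∑ p ∈ Finset.Ioc 0 ⌊x⌋₊ with p.Prime, 1 / ((p:ℝ) * Real.log p) * Real.log p
      = ∑ p ∈ Finset.Ioc 0 ⌊x⌋₊ with p.Prime, 1 / (p:ℝ) := by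
    refine Finset.sum_congr rfl fun p hp => ?_
    have h2 : 2 ≤ p := (Finset.mem_filter.mp hp).2.two_le
    have : 0 < Real.log p := Real.log_pos (by exact_mod_cast h2)
    field_simp
  have hmain : ∫ t in (2:ℝ)..x, 1 / (t * Real.log t) = Real.log (Real.log x) - Real.log (Real.log 2) := by
    have hu : Set.uIcc 2 x = Set.Icc 2 x := Set.uIcc_of_le hx
    refine intervalIntegral.integral_eq_sub_of_hasDerivAt (f := fun t => Real.log (Real.log t)) ?_ ?_
    · intro t ht
      rw [hu] at ht
      have h1 : 0 < Real.log t := Real.log_pos (by linarith [ht.1])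
      have := (Real.hasDerivAt_log (show t ≠ 0 by linarith [ht.1])).log h1.ne'
      refine this.congr_deriv ?_
      field_simp
    · apply ContinuousOn.intervalIntegrable
      rw [hu]
      intro t ht
      have h1 : 0 < Real.log t := Real.log_pos (by linarith [ht.1])
      have h0 : t ≠ 0 := by linarith [ht.1]
      have : t * Real.log t ≠ 0 := mul_ne_zero h0 h1.ne'
      apply ContinuousAt.continuousWithinAt
      fun_prop (disch := assumption)
  rw [hsum, hmain] at hab
  have htail : (∫ t in (2:ℝ)..x, g t) + ∫ t in Set.Ioi x, g t = ∫ t in Set.Ioi 2, g t :=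
    intervalIntegral.integral_interval_add_Ioi (hint 2 le_rfl) (hint x hx)
  have htb : |∫ t in Set.Ioi x, g t| ≤ C / Real.log x ^ (A + 1) := by
    rw [← Real.norm_eq_abs]
    refine (norm_integral_le_of_norm_le ((log_tail A (show 1 < x by linarith)).1.const_mul C) ?_).trans ?_
    · filter_upwards [ae_restrict_mem measurableSet_Ioi] with t ht
      have : x < t := ht
      exact h t (by linarith)
    · rw [integral_const_mul, (log_tail A (show 1 < x by linarith)).2, mul_one_div]
      gcongr
      have : 0 < Real.log x ^ (A + 1) := by positivity
      have hA : (0:ℝ) ≤ A := Nat.cast_nonneg _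
      nlinarith
  have hE : |1 / (x * Real.log x) * (Chebyshev.theta x - x)| ≤ D / Real.log x ^ (A + 1) := by
    rw [abs_mul, abs_of_nonneg (by positivity)]
    calc _ ≤ 1 / (x * Real.log x) * (D * x / Real.log x ^ A) := by gcongr; exact hth x hx
      _ = _ := by rw [pow_succ]; field_simp
  have e : (∑ p ∈ Finset.Ioc 0 ⌊x⌋₊ with p.Prime, 1 / (p:ℝ)) - Real.log (Real.log x)
      - (-Real.log (Real.log 2) + 1 / Real.log 2 - ∫ t in Set.Ioi 2, g t) =
      1 / (x * Real.log x) * (Chebyshev.theta x - x) + ∫ t in Set.Ioi x, g t := by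
    rw [hab, ← htail]
    have : 2 * (1 / (2 * Real.log 2)) = 1 / Real.log 2 := by field_simp
    rw [this]
    ring
  rw [e]
  refine (abs_add_le _ _).trans ((add_le_add hE htb).trans (le_of_eq ?_))
  ring
end

section
open Filter Topology

lemma hasSum_primes_finset (s : Finset ℕ) (f : ℕ → ℝ) :
    HasSum (fun p : Nat.Primes => if (p : ℕ) ∈ s then f p else 0) (∑ p ∈ s.filter Nat.Prime, f p) := by
  have h : HasSum (fun n : ℕ => if n.Prime then (if n ∈ s then f n else 0) else 0)
      (∑ n ∈ s, if n.Prime then (if n ∈ s then f n else 0) else 0) := by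
    apply hasSum_sum_of_ne_finset_zero
    intro n hn
    simp [hn]
  have e : (∑ n ∈ s, if n.Prime then (if n ∈ s then f n else 0) else 0)
      = ∑ p ∈ s.filter Nat.Prime, f p := by
    rw [Finset.sum_filter]
    refine Finset.sum_congr rfl fun n hn => ?_
    simp [hn]
  rw [e] at h
  have h2 := (Nat.Primes.coe_nat_injective.hasSum_iff (a := ∑ p ∈ s.filter Nat.Prime, f p)
    (f := fun n : ℕ => if n.Prime then (if n ∈ s then f n else 0) else 0) (by
      intro n hn
      rw [if_neg]
      intro hp
      exact hn ⟨⟨n, hp⟩, rfl⟩)).mpr h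
  have e2 : (fun p : Nat.Primes => if (p : ℕ) ∈ s then f p else 0) =
      (fun n : ℕ => if n.Prime then (if n ∈ s then f n else 0) else 0) ∘ (fun p : Nat.Primes => (p : ℕ)) := by
    funext p
    simp [p.2]
  rw [e2]
  exact h2

lemma log_one_sub_bound {x : ℝ} (h0 : 0 ≤ x) (h1 : x ≤ 1 / 2) :
    |Real.log (1 - x) + x| ≤ 2 * x ^ 2 := by
  have h := Real.abs_log_sub_add_sum_range_le (x := x) (by rw [abs_of_nonneg h0]; linarith) 1
  simp only [Finset.range_one, Finset.sum_singleton, zero_add, pow_one, Nat.cast_zero, div_one, abs_of_nonneg h0] at h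
  rw [add_comm]
  refine h.trans ?_
  rw [div_le_iff₀ (by linarith)]
  norm_num
  nlinarith [sq_nonneg x]

lemma prime_rpow_le (p : Nat.Primes) {s : ℝ} (hs : 0 ≤ s) :
    0 < ((p:ℕ):ℝ) ^ (-1 - s) ∧ ((p:ℕ):ℝ) ^ (-1 - s) ≤ 1 / ((p:ℕ):ℝ) ∧ 1 / ((p:ℕ):ℝ) ≤ 1 / 2 := by
  have hp : (2:ℝ) ≤ ((p:ℕ):ℝ) := by exact_mod_cast p.2.two_le
  refine ⟨by positivity, ?_, ?_⟩
  · rw [one_div, ← Real.rpow_neg_one]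
    exact Real.rpow_le_rpow_of_exponent_le (by linarith) (by linarith)
  · gcongr

lemma primes_inv_sq_summable : Summable (fun p : Nat.Primes => 2 * (1 / ((p:ℕ):ℝ)) ^ 2) := by
  have := (Nat.Primes.summable_rpow (r := -2)).mpr (by norm_num)
  refine (this.mul_left 2).congr fun p => ?_
  rw [Real.rpow_neg (by positivity)]
  norm_num

noncomputable def cstH (s : ℝ) : ℝ := ∑' p : Nat.Primes,
  (Real.log (1 - ((p:ℕ):ℝ) ^ (-1 - s)) + ((p:ℕ):ℝ) ^ (-1 - s))

lemma cstH_bound (p : Nat.Primes) {s : ℝ} (hs : 0 ≤ s) :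
    ‖Real.log (1 - ((p:ℕ):ℝ) ^ (-1 - s)) + ((p:ℕ):ℝ) ^ (-1 - s)‖ ≤ 2 * (1 / ((p:ℕ):ℝ)) ^ 2 := by
  obtain ⟨h1, h2, h3⟩ := prime_rpow_le p hs
  refine (log_one_sub_bound h1.le (h2.trans h3)).trans ?_
  gcongr

lemma cstH_summable {s : ℝ} (hs : 0 ≤ s) : Summable (fun p : Nat.Primes =>
    (Real.log (1 - ((p:ℕ):ℝ) ^ (-1 - s)) + ((p:ℕ):ℝ) ^ (-1 - s))) :=
  Summable.of_norm_bounded primes_inv_sq_summable fun p => cstH_bound p hs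

lemma cstH_tendsto : Tendsto cstH (𝓝[>] 0) (𝓝 (cstH 0)) := by
  refine tendsto_tsum_of_dominated_convergence primes_inv_sq_summable ?_ ?_
  · intro p
    have hp : (2:ℝ) ≤ ((p:ℕ):ℝ) := by exact_mod_cast p.2.two_le
    obtain ⟨h1, h2, h3⟩ := prime_rpow_le p le_rfl
    have hc : ContinuousAt (fun s : ℝ => ((p:ℕ):ℝ) ^ (-1 - s)) 0 :=
      ((Real.continuous_const_rpow (by positivity)).comp (by fun_prop)).continuousAt
    have : ContinuousAt (fun s : ℝ => Real.log (1 - ((p:ℕ):ℝ) ^ (-1 - s)) + ((p:ℕ):ℝ) ^ (-1 - s)) 0 :=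
      (((continuousAt_const (y := (1:ℝ))).sub hc).log (by
        have : (1:ℝ) - ((p:ℕ):ℝ) ^ (-1 - (0:ℝ)) ≠ 0 := (sub_pos.mpr (lt_of_le_of_lt (h2.trans h3) (by norm_num))).ne'
        exact this)).add hc
    exact this.tendsto.mono_left nhdsWithin_le_nhds
  · filter_upwards [self_mem_nhdsWithin] with s hs p
    exact cstH_bound p (le_of_lt hs)

noncomputable def cstZ (s : ℝ) : ℝ := ∑' p : Nat.Primes, ((p:ℕ):ℝ) ^ (-1 - s)

lemma cstZ_summable {s : ℝ} (hs : 0 < s) : Summable (fun p : Nat.Primes => ((p:ℕ):ℝ) ^ (-1 - s)) :=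
  Nat.Primes.summable_rpow.mpr (by linarith)

lemma zeta_real {s : ℝ} (hs : 0 < s) :
    riemannZeta ((1 + s : ℝ) : ℂ) = ((Real.exp (cstZ s - cstH s) : ℝ) : ℂ) := by
  rw [← riemannZeta_eulerProduct_exp_log (by simpa using hs), Complex.ofReal_exp]
  congr 1
  rw [cstZ, cstH, ← (cstZ_summable hs).tsum_sub (cstH_summable hs.le), Complex.ofReal_tsum]
  refine tsum_congr fun p => ?_
  obtain ⟨h1, h2, h3⟩ := prime_rpow_le p hs.le
  have e : (((p:ℕ):ℂ)) ^ (-((1 + s : ℝ) : ℂ)) = ((((p:ℕ):ℝ) ^ (-1 - s) : ℝ) : ℂ) := by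
    rw [Complex.ofReal_cpow (by positivity)]
    congr 1
    push_cast; ring
  rw [e, ← Complex.ofReal_one, ← Complex.ofReal_sub, ← Complex.ofReal_log (by linarith)]
  push_cast; ring

lemma zeta_real_tendsto : Tendsto (fun s : ℝ => s * Real.exp (cstZ s - cstH s)) (𝓝[>] 0) (𝓝 1) := by
  have h1 : Tendsto (fun s : ℝ => ((1 + s : ℝ) : ℂ)) (𝓝[>] 0) (𝓝[≠] 1) := by
    rw [tendsto_nhdsWithin_iff]
    constructor
    · have : Continuous (fun s : ℝ => ((1 + s : ℝ) : ℂ)) := by fun_prop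
      have h := (this.tendsto 0).mono_left (nhdsWithin_le_nhds (s := Set.Ioi 0))
      simpa using h
    · filter_upwards [self_mem_nhdsWithin] with s hs
      have : (0:ℝ) < s := hs
      simp [this.ne']
  have h2 := (riemannZeta_residue_one.comp h1).norm
  rw [norm_one] at h2
  refine h2.congr' ?_
  filter_upwards [self_mem_nhdsWithin] with s hs
  have hs' : (0:ℝ) < s := hs
  simp only [Function.comp]
  rw [zeta_real hs', norm_mul, Complex.norm_real, Real.norm_of_nonneg (Real.exp_pos _).le]
  simp [abs_of_pos hs']

noncomputable def cstk (p : Nat.Primes) : ℕ := ⌈Real.log ((p:ℕ):ℝ)⌉₊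

noncomputable def cstc (m : ℕ) : ℝ := ∑' p : cstk ⁻¹' {m}, 1 / (((p:Nat.Primes):ℕ):ℝ)

lemma cstk_le_iff (p : Nat.Primes) (m : ℕ) : cstk p ≤ m ↔ (p:ℕ) ∈ Finset.Ioc 0 ⌊Real.exp m⌋₊ := by
  have hp : 0 < (p:ℕ) := p.2.pos
  have hp' : (0:ℝ) < (p:ℕ) := by exact_mod_cast hp
  rw [cstk, Nat.ceil_le, Finset.mem_Ioc, Nat.le_floor_iff (Real.exp_pos _).le, Real.log_le_iff_le_exp hp']
  simp [hp]

lemma cstc_partial (m : ℕ) : ∑ j ∈ Finset.range (m + 1), cstc j =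
    ∑ p ∈ Finset.Ioc 0 ⌊Real.exp m⌋₊ with p.Prime, 1 / (p:ℝ) := by
  have h := (hasSum_primes_finset (Finset.Ioc 0 ⌊Real.exp m⌋₊) (fun n => 1 / (n:ℝ))).tsum_fiberwise cstk
  have h2 : HasSum (fun j => ∑' b : cstk ⁻¹' {j}, if (((b:Nat.Primes)):ℕ) ∈ Finset.Ioc 0 ⌊Real.exp m⌋₊ then 1 / ((((b:Nat.Primes)):ℕ):ℝ) else 0)
      (∑ j ∈ Finset.range (m + 1), cstc j) := by
    have e : ∀ j, (∑' b : cstk ⁻¹' {j}, if (((b:Nat.Primes)):ℕ) ∈ Finset.Ioc 0 ⌊Real.exp m⌋₊ then 1 / ((((b:Nat.Primes)):ℕ):ℝ) else 0)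
        = if j ∈ Finset.range (m + 1) then cstc j else 0 := by
      intro j
      split_ifs with hj
      · rw [cstc]
        refine tsum_congr fun b => ?_
        have hb : cstk b = j := b.2
        rw [if_pos]
        rw [← cstk_le_iff, hb]
        simpa [Nat.lt_succ_iff] using hj
      · refine Eq.trans (tsum_congr fun b => ?_) (tsum_zero (α := ℝ) (β := cstk ⁻¹' {j}))
        have hb : cstk b = j := b.2
        refine if_neg ?_
        rw [← cstk_le_iff, hb]
        simpa [Nat.lt_succ_iff] using hj
    simp_rw [e]
    have := hasSum_sum_of_ne_finset_zero (L := SummationFilter.unconditional ℕ) (s := Finset.range (m + 1))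
      (f := fun j => if j ∈ Finset.range (m + 1) then cstc j else 0) (by intro b hb; simp only [hb, if_false])
    convert this using 1
    refine Finset.sum_congr rfl fun j hj => ?_
    rw [if_pos hj]
  exact h2.unique h

lemma cstQ_bound (p : Nat.Primes) {s : ℝ} (hs : 0 < s) :
    1 / ((p:ℕ):ℝ) * Real.exp (-s) ^ cstk p ≤ ((p:ℕ):ℝ) ^ (-1 - s) ∧
    ((p:ℕ):ℝ) ^ (-1 - s) * Real.exp (-s) ≤ 1 / ((p:ℕ):ℝ) * Real.exp (-s) ^ cstk p := by
  have hp : 0 < (p:ℕ) := p.2.pos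
  have hp' : (0:ℝ) < (p:ℕ) := by exact_mod_cast hp
  have hlog : 0 ≤ Real.log ((p:ℕ):ℝ) := Real.log_nonneg (by exact_mod_cast hp)
  have e : ((p:ℕ):ℝ) ^ (-1 - s) = 1 / ((p:ℕ):ℝ) * Real.exp (-s * Real.log (p:ℕ)) := by
    rw [sub_eq_add_neg, Real.rpow_add hp', Real.rpow_neg_one, one_div, Real.rpow_def_of_pos hp' (-s), mul_comm (-s)]
  rw [e, ← Real.exp_nat_mul]
  have c1 := Nat.le_ceil (Real.log ((p:ℕ):ℝ))
  have c2 := Nat.ceil_lt_add_one hlog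
  constructor
  · refine mul_le_mul_of_nonneg_left (Real.exp_le_exp.mpr ?_) (by positivity)
    change (⌈Real.log ((p:ℕ):ℝ)⌉₊ : ℝ) * -s ≤ _
    nlinarith
  · rw [mul_assoc, ← Real.exp_add]
    refine mul_le_mul_of_nonneg_left (Real.exp_le_exp.mpr ?_) (by positivity)
    change _ ≤ (⌈Real.log ((p:ℕ):ℝ)⌉₊ : ℝ) * -s
    nlinarith

lemma cstQ_hasSum {s : ℝ} (hs : 0 < s) : ∃ Q : ℝ, HasSum (fun m => cstc m * Real.exp (-s) ^ m) Q ∧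
    Q ≤ cstZ s ∧ cstZ s * Real.exp (-s) ≤ Q := by
  have hsum : Summable (fun p : Nat.Primes => 1 / ((p:ℕ):ℝ) * Real.exp (-s) ^ cstk p) :=
    Summable.of_nonneg_of_le (fun p => by positivity) (fun p => (cstQ_bound p hs).1) (cstZ_summable hs)
  refine ⟨∑' p : Nat.Primes, 1 / ((p:ℕ):ℝ) * Real.exp (-s) ^ cstk p, ?_, ?_, ?_⟩
  · have h := hsum.hasSum.tsum_fiberwise cstk
    have e : (fun m => cstc m * Real.exp (-s) ^ m) = fun c => ∑' b : cstk ⁻¹' {c},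
        1 / (((b:Nat.Primes):ℕ):ℝ) * Real.exp (-s) ^ cstk (b : Nat.Primes) := by
      funext m
      rw [cstc, ← tsum_mul_right]
      refine tsum_congr fun b => ?_
      have hb : cstk b = m := b.2
      rw [hb]
    rw [e]
    exact h
  · exact hsum.tsum_le_tsum (fun p => (cstQ_bound p hs).1) (cstZ_summable hs)
  · rw [cstZ, ← tsum_mul_right]
    exact ((cstZ_summable hs).mul_right _).tsum_le_tsum (fun p => (cstQ_bound p hs).2) hsum
end

section
open Filter Topology

lemma cst_partial_tendsto {M : ℝ} (hM : Tendsto (fun x : ℝ => (∑ p ∈ Finset.Ioc 0 ⌊x⌋₊ with p.Prime, 1 / (p:ℝ)) - Real.log (Real.log x)) atTop (𝓝 M)) :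
    Tendsto (fun n => ∑ i ∈ Finset.range n, (cstc i - 1 / (i:ℝ))) atTop
      (𝓝 (M - Real.eulerMascheroniConstant)) := by
  rw [← tendsto_add_atTop_iff_nat 1]
  have h1 : Tendsto (fun n : ℕ => Real.exp n) atTop atTop :=
    Real.tendsto_exp_atTop.comp tendsto_natCast_atTop_atTop
  have h2 := (hM.comp h1).sub Real.tendsto_harmonic_sub_log
  refine h2.congr fun n => ?_
  simp only [Function.comp]
  rw [Finset.sum_sub_distrib, cstc_partial, Real.log_exp, Finset.sum_range_succ' (fun i : ℕ => 1 / (i:ℝ)), harmonic]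
  push_cast
  simp only [one_div, inv_zero]
  ring

lemma cst_series {r : ℝ} (h0 : 0 < r) (h1 : r < 1) : HasSum (fun n : ℕ => 1 / (n:ℝ) * r ^ n) (-Real.log (1 - r)) := by
  have h := Real.hasSum_pow_div_log_of_abs_lt_one (x := r) (by rw [abs_of_pos h0]; exact h1)
  rw [← hasSum_nat_add_iff' 1]
  simp only [Finset.range_one, Finset.sum_singleton, Nat.cast_zero, div_zero, zero_mul, sub_zero]
  have e : (fun n : ℕ => 1 / ((n + 1 : ℕ):ℝ) * r ^ (n + 1)) = fun n : ℕ => r ^ (n + 1) / ((n:ℝ) + 1) := by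
    funext n; push_cast; ring
  rw [e]; exact h

lemma cst_E_tendsto : Tendsto (fun s : ℝ => 1 - Real.exp (-s)) (𝓝[>] 0) (𝓝[>] 0) := by
  rw [tendsto_nhdsWithin_iff]
  constructor
  · have : Continuous (fun s : ℝ => 1 - Real.exp (-s)) := by fun_prop
    have h := (this.tendsto 0).mono_left (nhdsWithin_le_nhds (s := Set.Ioi 0))
    simpa using h
  · filter_upwards [self_mem_nhdsWithin] with s hs
    have : (0:ℝ) < s := hs
    simpa using this

lemma cst_Ediv_tendsto : Tendsto (fun s : ℝ => (1 - Real.exp (-s)) / s) (𝓝[>] 0) (𝓝 1) := by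
  have h : HasDerivAt (fun s : ℝ => 1 - Real.exp (-s)) 1 0 := by
    have := ((hasDerivAt_id (0:ℝ)).neg.exp).const_sub 1
    simpa using this
  have h2 := hasDerivAt_iff_tendsto_slope.mp h
  have h3 := h2.mono_left (nhdsWithin_mono (0:ℝ) (s := Set.Ioi 0) (by intro x hx; simpa using (ne_of_gt hx)))
  refine h3.congr fun s => ?_
  simp [slope_def_field]

lemma cst_Z_tendsto : Tendsto (fun s : ℝ => cstZ s + Real.log (1 - Real.exp (-s))) (𝓝[>] 0) (𝓝 (cstH 0)) := by
  have h1 := (zeta_real_tendsto.log (by norm_num))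
  have h2 := (cst_Ediv_tendsto.log (by norm_num))
  have h3 := (h1.add h2).add cstH_tendsto
  rw [Real.log_one, add_zero, zero_add] at h3
  refine h3.congr' ?_
  filter_upwards [self_mem_nhdsWithin] with s hs
  have hs : (0:ℝ) < s := hs
  have hE : 0 < 1 - Real.exp (-s) := by simpa using hs
  rw [Real.log_mul hs.ne' (Real.exp_pos _).ne', Real.log_exp, Real.log_div hE.ne' hs.ne']
  ring

lemma cst_eq {M : ℝ} (hM : Tendsto (fun x : ℝ => (∑ p ∈ Finset.Ioc 0 ⌊x⌋₊ with p.Prime, 1 / (p:ℝ)) - Real.log (Real.log x)) atTop (𝓝 M)) :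
    M = Real.eulerMascheroniConstant + cstH 0 := by
  have h1 := Real.tendsto_tsum_powerSeries_nhdsWithin_lt (cst_partial_tendsto hM)
  have hr : Tendsto (fun s : ℝ => Real.exp (-s)) (𝓝[>] 0) (𝓝[<] 1) := by
    rw [tendsto_nhdsWithin_iff]
    constructor
    · have : Continuous (fun s : ℝ => Real.exp (-s)) := by fun_prop
      have h := (this.tendsto 0).mono_left (nhdsWithin_le_nhds (s := Set.Ioi 0))
      simpa using h
    · filter_upwards [self_mem_nhdsWithin] with s hs
      have : (0:ℝ) < s := hs
      simpa using this
  have h2 := h1.comp hr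
  have hE : Tendsto (fun s : ℝ => 1 - Real.exp (-s)) (𝓝[>] 0) (𝓝 0) := cst_E_tendsto.mono_right nhdsWithin_le_nhds
  have hEl : Tendsto (fun s : ℝ => (1 - Real.exp (-s)) * Real.log (1 - Real.exp (-s))) (𝓝[>] 0) (𝓝 0) := by
    have := (Real.continuous_mul_log.tendsto 0).comp hE
    simpa [Function.comp_def] using this
  have hEZ : Tendsto (fun s : ℝ => (1 - Real.exp (-s)) * cstZ s) (𝓝[>] 0) (𝓝 0) := by
    have := (hE.mul cst_Z_tendsto).sub hEl
    rw [zero_mul, sub_zero] at this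
    refine this.congr fun s => ?_
    ring
  have hlow := cst_Z_tendsto.sub hEZ
  rw [sub_zero] at hlow
  have h3 : Tendsto (fun s : ℝ => ∑' n : ℕ, (cstc n - 1 / (n:ℝ)) * Real.exp (-s) ^ n) (𝓝[>] 0) (𝓝 (cstH 0)) := by
    refine tendsto_of_tendsto_of_tendsto_of_le_of_le' hlow cst_Z_tendsto ?_ ?_
    all_goals
      filter_upwards [self_mem_nhdsWithin] with s hs
      have hs : (0:ℝ) < s := hs
      have hE : 0 < 1 - Real.exp (-s) := by simpa using hs
      obtain ⟨Q, hQ, hQ1, hQ2⟩ := cstQ_hasSum hs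
      have h4 := hQ.sub (cst_series (Real.exp_pos (-s)) (by linarith))
      have h5 : (fun n : ℕ => cstc n * Real.exp (-s) ^ n - 1 / (n:ℝ) * Real.exp (-s) ^ n) =
        (fun n : ℕ => (cstc n - 1 / (n:ℝ)) * Real.exp (-s) ^ n) := by funext n; ring
      rw [h5] at h4
      rw [h4.tsum_eq]
      linarith
  have := tendsto_nhds_unique h2 h3
  linarith

theorem mertens_full (A : ℕ) : ∃ C > 0, ∀ x : ℝ, 2 ≤ x →
    |(∑ p ∈ Finset.Ioc 0 ⌊x⌋₊ with p.Prime, 1 / (p:ℝ)) - Real.log (Real.log x) - (Real.eulerMascheroniConstant + cstH 0)|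
      ≤ C / Real.log x ^ (A + 1) := by
  obtain ⟨M, hM⟩ := mertens_asymp
  have h : Tendsto (fun x : ℝ => (∑ p ∈ Finset.Ioc 0 ⌊x⌋₊ with p.Prime, 1 / (p:ℝ)) - Real.log (Real.log x)) atTop (𝓝 M) := by
    obtain ⟨C, hC, h⟩ := hM 0
    rw [tendsto_iff_dist_tendsto_zero]
    have h0 : Tendsto (fun x : ℝ => C / Real.log x) atTop (𝓝 0) := Real.tendsto_log_atTop.const_div_atTop C
    refine squeeze_zero' (Eventually.of_forall fun x => dist_nonneg) ?_ h0
    filter_upwards [eventually_ge_atTop 2] with x hx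
    rw [Real.dist_eq]
    simpa using h x hx
  rw [← cst_eq h]
  exact hM A
end

section
open Filter Topology

def tld (l k : ℕ) : ℕ := match l with
  | 0 => 0
  | m + 1 => Nat.choose (k + 1 + m) m

lemma tld_hasSum (l : ℕ) {r : ℝ} (h0 : 0 ≤ r) (h1 : r < 1) :
    HasSum (fun k : ℕ => (tld l k : ℝ) * r ^ (k + 2)) (r * (1 - r) ^ (-(l : ℤ)) - r) := by
  cases l with
  | zero => simp [tld]
  | succ m =>
    have h := hasSum_choose_mul_geometric_of_norm_lt_one m (r := r) (by rw [Real.norm_of_nonneg h0]; exact h1)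
    rw [← hasSum_nat_add_iff' 1] at h
    have h2 := h.mul_left r
    have e : (fun k : ℕ => (tld (m + 1) k : ℝ) * r ^ (k + 2)) =
        fun k : ℕ => r * (((k + 1 + m).choose m : ℝ) * r ^ (k + 1)) := by
      funext k
      simp only [tld]; ring
    rw [e]
    have e2 : r * (1 - r) ^ (-((m + 1 : ℕ) : ℤ)) - r =
        r * (1 / (1 - r) ^ (m + 1) - ∑ i ∈ Finset.range 1, ((i + m).choose m : ℝ) * r ^ i) := by
      rw [zpow_neg, zpow_natCast]
      simp
      ring
    rw [e2]
    exact h2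

lemma tld_sum (l w : ℕ) : Nat.choose (w + l) l = 1 + ∑ k ∈ Finset.range w, tld l k := by
  induction w with
  | zero => simp
  | succ w ih =>
    rw [Finset.sum_range_succ, ← add_assoc, ← ih]
    cases l with
    | zero => simp [tld]
    | succ m =>
      simp only [tld]
      rw [show w + 1 + (m + 1) = (w + m + 1) + 1 by ring, Nat.choose_succ_succ,
        show w + 1 + m = w + m + 1 by ring, show w + (m + 1) = w + m + 1 by ring]
      ring

lemma tl_point (l X n : ℕ) (hn : n ∈ Finset.Icc 1 X) :
    ∑ p ∈ n.primeFactors, Nat.choose (n.factorization p + l - 1) l =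
    ∑ p ∈ Finset.Ioc 0 X with p.Prime, ((if p ∣ n then 1 else 0) +
      ∑ k ∈ Finset.range X, tld l k * (if p ^ (k + 2) ∣ n then 1 else 0)) := by
  rw [Finset.mem_Icc] at hn
  have hn0 : n ≠ 0 := by omega
  have hsub : n.primeFactors ⊆ (Finset.Ioc 0 X).filter Nat.Prime := by
    intro p hp
    have h1 := Nat.prime_of_mem_primeFactors hp
    have h2 := Nat.le_of_mem_primeFactors hp
    simp only [Finset.mem_filter, Finset.mem_Ioc]
    exact ⟨⟨h1.pos, by omega⟩, h1⟩
  rw [← Finset.sum_subset hsub]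
  · refine Finset.sum_congr rfl fun p hp => ?_
    have h1 := Nat.prime_of_mem_primeFactors hp
    have h2 := Nat.dvd_of_mem_primeFactors hp
    have hv : 1 ≤ n.factorization p := (h1.dvd_iff_one_le_factorization hn0).mp h2
    have hvX : n.factorization p < n := Nat.factorization_lt p hn0
    obtain ⟨w, hw⟩ := Nat.exists_eq_add_of_le hv
    rw [if_pos h2, hw, show 1 + w + l - 1 = w + l by omega, tld_sum]
    congr 1
    simp only [mul_ite, mul_one, mul_zero]
    rw [← Finset.sum_filter]
    refine Finset.sum_congr ?_ fun _ _ => rfl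
    ext k
    rw [Finset.mem_filter, Finset.mem_range, Finset.mem_range, h1.pow_dvd_iff_le_factorization hn0, hw]
    omega
  · intro p hp hpn
    rw [Finset.mem_filter] at hp
    have hnd : ¬ p ∣ n := fun h => hpn (Nat.mem_primeFactors.mpr ⟨hp.2, h, hn0⟩)
    rw [if_neg hnd, zero_add]
    refine Finset.sum_eq_zero fun k _ => ?_
    rw [if_neg, mul_zero]
    exact fun h => hnd ((dvd_pow_self p (by omega)).trans h)

lemma card_dvd (X m : ℕ) : ∑ n ∈ Finset.Icc 1 X, (if m ∣ n then 1 else 0) = X / m := by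
  rw [← Finset.card_filter, ← Nat.Ioc_filter_dvd_card_eq_div X m]
  rfl

lemma tl_sum (l X : ℕ) :
    ∑ n ∈ Finset.Icc 1 X, ∑ p ∈ n.primeFactors, Nat.choose (n.factorization p + l - 1) l =
    ∑ p ∈ Finset.Ioc 0 X with p.Prime, X / p +
    ∑ p ∈ Finset.Ioc 0 X with p.Prime, ∑ k ∈ Finset.range X, tld l k * (X / p ^ (k + 2)) := by
  rw [Finset.sum_congr rfl (tl_point l X), Finset.sum_comm, ← Finset.sum_add_distrib]
  refine Finset.sum_congr rfl fun p hp => ?_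
  rw [Finset.sum_add_distrib, card_dvd, Finset.sum_comm]
  congr 1
  refine Finset.sum_congr rfl fun k hk => ?_
  rw [← Finset.mul_sum, card_dvd]

lemma tl_prime (l : ℕ) : ∃ C > 0, ∀ x : ℝ, 1 ≤ x → ∀ p : Nat.Primes,
    |(if (p:ℕ) ∈ Finset.Ioc 0 ⌊x⌋₊ then
        ∑ k ∈ Finset.range ⌊x⌋₊, (tld l k : ℝ) * ((⌊x⌋₊ / (p:ℕ) ^ (k + 2) : ℕ) : ℝ) else 0) -
      x * (1 / ((p:ℕ):ℝ) * (1 - 1 / ((p:ℕ):ℝ)) ^ (-(l:ℤ)) - 1 / ((p:ℕ):ℝ))| ≤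
      C * x ^ (3 / 4 : ℝ) * ((p:ℕ):ℝ) ^ (-(3 / 2) : ℝ) := by
  set ρ : ℝ := (2:ℝ) ^ (-(3/4) : ℝ) with hρ
  have hρ0 : 0 < ρ := by positivity
  have hρ1 : ρ < 1 := Real.rpow_lt_one_of_one_lt_of_neg (by norm_num) (by norm_num)
  have hS := tld_hasSum l hρ0.le hρ1
  set S := ρ * (1 - ρ) ^ (-(l : ℤ)) - ρ
  have hS0 : 0 ≤ S := hS.nonneg fun k => by positivity
  refine ⟨S / ρ ^ 2 + 1, by positivity, fun x hx p => ?_⟩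
  have hp : (2:ℝ) ≤ ((p:ℕ):ℝ) := by exact_mod_cast p.2.two_le
  set X := ⌊x⌋₊
  set q : ℕ := (p:ℕ) with hq
  have hq2 : 2 ≤ q := p.2.two_le
  have hq0 : (0:ℝ) < (q:ℝ) := by linarith
  have h1 : HasSum (fun k : ℕ => (tld l k : ℝ) * ((X / q ^ (k + 2) : ℕ) : ℝ))
      (if q ∈ Finset.Ioc 0 X then ∑ k ∈ Finset.range X, (tld l k : ℝ) * ((X / q ^ (k + 2) : ℕ) : ℝ) else 0) := by
    split_ifs with h
    · apply hasSum_sum_of_ne_finset_zero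
      intro k hk
      have : X < q ^ (k + 2) := by
        have hk : X ≤ k := by simpa using hk
        calc X ≤ k := hk
          _ < 2 ^ k := Nat.lt_two_pow_self
          _ ≤ q ^ k := Nat.pow_le_pow_left hq2 k
          _ ≤ q ^ (k + 2) := Nat.pow_le_pow_right (by omega) (by omega)
      rw [Nat.div_eq_of_lt this]; simp
    · have e : (fun k : ℕ => (tld l k : ℝ) * ((X / q ^ (k + 2) : ℕ) : ℝ)) = fun _ => 0 := by
        funext k
        have : X < q ^ (k + 2) := by
          have hX : X < q := by
            simp only [Finset.mem_Ioc, not_and, not_le] at h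
            exact h (by omega)
          exact hX.trans_le (Nat.le_self_pow (by omega) q)
        rw [Nat.div_eq_of_lt this]; simp
      rw [e]
      exact hasSum_zero
  have hr1 : 1 / (q:ℝ) < 1 := by rw [div_lt_one hq0]; linarith
  have h2 := (tld_hasSum l (r := 1 / (q:ℝ)) (by positivity) hr1).mul_left x
  have h3 := hS.mul_left (x ^ (3 / 4 : ℝ) * (q:ℝ) ^ (-(3 / 2) : ℝ) / ρ ^ 2)
  have h12 := h1.sub h2
  have hb : ∀ k : ℕ, ‖(tld l k : ℝ) * ((X / q ^ (k + 2) : ℕ) : ℝ) - x * ((tld l k : ℝ) * (1 / (q:ℝ)) ^ (k + 2))‖ ≤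
      (x ^ (3 / 4 : ℝ) * (q:ℝ) ^ (-(3 / 2) : ℝ) / ρ ^ 2) * ((tld l k : ℝ) * ρ ^ (k + 2)) := by
    intro k
    set y : ℝ := x / (q:ℝ) ^ (k + 2) with hy
    have hy0 : 0 ≤ y := by positivity
    have e1 : ((X / q ^ (k + 2) : ℕ) : ℝ) = ⌊y⌋₊ := by
      have := Nat.floor_div_natCast x (q ^ (k + 2))
      rw [← this]
      push_cast
      rfl
    have e2 : (tld l k : ℝ) * ((X / q ^ (k + 2) : ℕ) : ℝ) - x * ((tld l k : ℝ) * (1 / (q:ℝ)) ^ (k + 2)) =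
        (tld l k : ℝ) * -(y - ⌊y⌋₊) := by
      rw [e1, hy, one_div, inv_pow]; ring
    have f1 : 0 ≤ y - ⌊y⌋₊ := sub_nonneg.mpr (Nat.floor_le hy0)
    have f2 : y - ⌊y⌋₊ ≤ y ^ (3 / 4 : ℝ) := by
      rcases le_or_gt 1 y with h | h
      · have := Nat.lt_floor_add_one y
        have := Real.one_le_rpow h (by norm_num : (0:ℝ) ≤ 3 / 4)
        linarith
      · have := Real.rpow_le_rpow_of_exponent_ge' hy0 h.le (by norm_num : (0:ℝ) ≤ 3/4) (by norm_num : (3/4:ℝ) ≤ 1)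
        rw [Real.rpow_one] at this
        have : (0:ℝ) ≤ ⌊y⌋₊ := by positivity
        linarith
    have f3 : y ^ (3 / 4 : ℝ) ≤ x ^ (3 / 4 : ℝ) * (q:ℝ) ^ (-(3 / 2) : ℝ) * ρ ^ k := by
      rw [hy, Real.div_rpow (by linarith) (by positivity), div_eq_mul_inv, mul_assoc]
      refine mul_le_mul_of_nonneg_left ?_ (by positivity)
      have g1 : (((q:ℝ) ^ (k + 2)) ^ (3 / 4 : ℝ))⁻¹ = (q:ℝ) ^ (-(3 / 2) : ℝ) * ((q:ℝ) ^ (-(3 / 4) : ℝ)) ^ k := by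
        rw [← Real.rpow_natCast, ← Real.rpow_mul hq0.le, ← Real.rpow_neg hq0.le, ← Real.rpow_natCast, ← Real.rpow_mul hq0.le,
          ← Real.rpow_add hq0]
        congr 1
        push_cast; ring
      rw [g1]
      refine mul_le_mul_of_nonneg_left ?_ (by positivity)
      refine pow_le_pow_left₀ (by positivity) ?_ k
      exact Real.rpow_le_rpow_of_nonpos (by norm_num) hp (by norm_num)
    rw [e2, Real.norm_eq_abs, abs_mul, abs_neg, abs_of_nonneg f1, Nat.abs_cast]
    have : (x ^ (3 / 4 : ℝ) * (q:ℝ) ^ (-(3 / 2) : ℝ) / ρ ^ 2) * ((tld l k : ℝ) * ρ ^ (k + 2)) =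
       (tld l k : ℝ) * (x ^ (3 / 4 : ℝ) * (q:ℝ) ^ (-(3 / 2) : ℝ) * ρ ^ k) := by
      rw [pow_add]
      field_simp
    rw [this]
    exact mul_le_mul_of_nonneg_left (f2.trans f3) (by positivity)
  have h4 := tsum_of_norm_bounded h3 hb
  rw [h12.tsum_eq] at h4
  rw [← Real.norm_eq_abs]
  refine h4.trans ?_
  have : 0 ≤ x ^ (3 / 4 : ℝ) * (q:ℝ) ^ (-(3 / 2) : ℝ) := by positivity
  have e : x ^ (3 / 4 : ℝ) * (q:ℝ) ^ (-(3 / 2) : ℝ) / ρ ^ 2 * S = S / ρ ^ 2 * (x ^ (3 / 4 : ℝ) * (q:ℝ) ^ (-(3 / 2) : ℝ)) := by ring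
  rw [e]
  nlinarith

lemma tl_G_summable (l : ℕ) : Summable (fun p : Nat.Primes =>
    (1 / ((p:ℕ):ℝ) * (1 - 1 / ((p:ℕ):ℝ)) ^ (-(l:ℤ)) - 1 / ((p:ℕ):ℝ))) := by
  obtain ⟨C, hC, h⟩ := tl_prime l
  have hs := ((Nat.Primes.summable_rpow (r := -(3/2))).mpr (by norm_num)).mul_left C
  refine Summable.of_norm_bounded hs fun p => ?_
  have := h 1 le_rfl p
  have hp : ¬ (p:ℕ) ∈ Finset.Ioc 0 ⌊(1:ℝ)⌋₊ := by
    have := p.2.two_le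
    simp; omega
  rw [if_neg hp, zero_sub, abs_neg, one_mul, Real.one_rpow, mul_one] at this
  exact this

theorem tl_main (l : ℕ) : ∃ C > 0, ∀ x : ℝ, 1 ≤ x →
    |(∑ n ∈ Finset.Icc 1 ⌊x⌋₊, ∑ p ∈ n.primeFactors, (Nat.choose (n.factorization p + l - 1) l : ℝ)) -
      ((∑ p ∈ Finset.Ioc 0 ⌊x⌋₊ with p.Prime, (⌊x / p⌋₊ : ℝ)) +
      x * ∑' p : Nat.Primes, (1 / ((p:ℕ):ℝ) * (1 - 1 / ((p:ℕ):ℝ)) ^ (-(l:ℤ)) - 1 / ((p:ℕ):ℝ)))| ≤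
      C * x ^ (3 / 4 : ℝ) := by
  obtain ⟨C, hC, h⟩ := tl_prime l
  have hs := ((Nat.Primes.summable_rpow (r := -(3/2))).mpr (by norm_num))
  set S := ∑' p : Nat.Primes, ((p:ℕ):ℝ) ^ (-(3 / 2) : ℝ) with hS
  have hS0 : 0 ≤ S := tsum_nonneg fun p => by positivity
  refine ⟨C * S + 1, by positivity, fun x hx => ?_⟩
  have h1 := hasSum_primes_finset (Finset.Ioc 0 ⌊x⌋₊) (fun q => ∑ k ∈ Finset.range ⌊x⌋₊, (tld l k : ℝ) * ((⌊x⌋₊ / q ^ (k + 2) : ℕ) : ℝ))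
  have h2 := h1.sub ((tl_G_summable l).hasSum.mul_left x)
  have h3 := hs.hasSum.mul_left (C * x ^ (3 / 4 : ℝ))
  have h4 := h2.tsum_eq ▸ tsum_of_norm_bounded h3 (f := fun p : Nat.Primes => (if (p:ℕ) ∈ Finset.Ioc 0 ⌊x⌋₊ then
        ∑ k ∈ Finset.range ⌊x⌋₊, (tld l k : ℝ) * ((⌊x⌋₊ / (p:ℕ) ^ (k + 2) : ℕ) : ℝ) else 0) -
      x * (1 / ((p:ℕ):ℝ) * (1 - 1 / ((p:ℕ):ℝ)) ^ (-(l:ℤ)) - 1 / ((p:ℕ):ℝ))) (fun p => h x hx p)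
  have e : (∑ n ∈ Finset.Icc 1 ⌊x⌋₊, ∑ p ∈ n.primeFactors, (Nat.choose (n.factorization p + l - 1) l : ℝ)) =
      (∑ p ∈ Finset.Ioc 0 ⌊x⌋₊ with p.Prime, (⌊x / p⌋₊ : ℝ)) +
      ∑ p ∈ Finset.Ioc 0 ⌊x⌋₊ with p.Prime, ∑ k ∈ Finset.range ⌊x⌋₊, (tld l k : ℝ) * ((⌊x⌋₊ / p ^ (k + 2) : ℕ) : ℝ) := by
    have := congrArg (Nat.cast (R := ℝ)) (tl_sum l ⌊x⌋₊)
    simp only [Nat.floor_div_natCast]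
    push_cast at this
    exact_mod_cast this
  rw [e]
  rw [Real.norm_eq_abs] at h4
  have hx0 : 0 ≤ x ^ (3 / 4 : ℝ) := by positivity
  have e5 : ∀ a b c : ℝ, a + b - (a + c) = b - c := by intros; ring
  rw [e5]
  refine h4.trans ?_
  rw [← hS]
  nlinarith
end

section
open Filter Topology MeasureTheory

lemma frac_nonneg {t : ℝ} (ht : 0 ≤ t) : 0 ≤ t - (⌊t⌋₊ : ℝ) := sub_nonneg.mpr (Nat.floor_le ht)

lemma frac_le (t : ℝ) : t - (⌊t⌋₊ : ℝ) ≤ 1 := by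
  have := Nat.lt_floor_add_one t
  linarith

lemma frac_meas : Measurable (fun t : ℝ => t - (⌊t⌋₊ : ℝ)) := by
  exact measurable_id.sub (measurable_from_nat.comp Nat.measurable_floor)

lemma log_pow_integrable (k : ℕ) : IntegrableOn (fun t : ℝ => Real.log t ^ k / t ^ 2) (Set.Ioi 1) := by
  obtain ⟨C, hC, h⟩ := pow_log_le k
  have h1 := (integrableOn_Ioi_rpow_of_lt (a := -(3/2)) (c := 1) (by norm_num) (by norm_num)).const_mul (2 ^ k * C)
  refine Integrable.mono' h1 ?_ ?_
  · exact ((Real.measurable_log.pow_const k).div (measurable_id.pow_const 2)).aestronglyMeasurable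
  · rw [ae_restrict_iff' measurableSet_Ioi]
    refine Eventually.of_forall fun t ht => ?_
    have ht : (1:ℝ) < t := ht
    have ht0 : 0 < t := by linarith
    have hl := Real.log_pos ht
    rw [Real.norm_of_nonneg (by positivity)]
    have h2 := h (√t) (by rw [Real.one_le_sqrt]; exact ht.le)
    rw [Real.log_sqrt ht0.le, div_pow, div_le_iff₀ (by positivity)] at h2
    have e : t ^ (-(3/2) : ℝ) = √t / t ^ 2 := by
      rw [Real.sqrt_eq_rpow, ← Real.rpow_natCast, ← Real.rpow_sub ht0]
      norm_num
    rw [e, ← mul_div_assoc]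
    gcongr
    linarith

lemma expand_point (N : ℕ) {L u : ℝ} (hL : 0 < L) (hu : 0 ≤ u) :
    |(if u ≤ L / 2 then 1 / (L - u) else 0) - ∑ j ∈ Finset.Icc 1 N, u ^ (j - 1) / L ^ j| ≤
      (N * 2 ^ N + 2) * u ^ N / L ^ (N + 1) := by
  have hLp : 0 < L ^ (N + 1) := by positivity
  split_ifs with h
  · have hLu : 0 < L - u := by linarith
    have e : ∀ M : ℕ, 1 / (L - u) - ∑ j ∈ Finset.Icc 1 M, u ^ (j - 1) / L ^ j = u ^ M / (L ^ M * (L - u)) := by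
      intro M
      induction M with
      | zero => simp
      | succ M ih =>
        rw [Finset.sum_Icc_succ_top (by omega), ← sub_sub, ih, Nat.add_sub_cancel]
        field_simp
        ring
    rw [e, abs_of_nonneg (by positivity), div_le_div_iff₀ (by positivity) hLp]
    have h1 : L ≤ 2 * (L - u) := by linarith
    have h2 : (2:ℝ) ≤ N * 2 ^ N + 2 := by
      have : (0:ℝ) ≤ N * 2 ^ N := by positivity
      linarith
    calc u ^ N * L ^ (N + 1) = u ^ N * L ^ N * L := by ring
      _ ≤ u ^ N * L ^ N * (2 * (L - u)) := by gcongr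
      _ = 2 * (u ^ N * (L ^ N * (L - u))) := by ring
      _ ≤ (N * 2 ^ N + 2) * (u ^ N * (L ^ N * (L - u))) := mul_le_mul_of_nonneg_right h2 (by positivity)
      _ = _ := by ring
  · push Not at h
    have hu0 : 0 < u := by linarith
    rw [zero_sub, abs_neg, abs_of_nonneg (Finset.sum_nonneg fun j _ => by positivity)]
    have hb : ∀ j ∈ Finset.Icc 1 N, u ^ (j - 1) / L ^ j ≤ 2 ^ N * u ^ N / L ^ (N + 1) := by
      intro j hj
      rw [Finset.mem_Icc] at hj
      obtain ⟨i, rfl⟩ : ∃ i, j = i + 1 := ⟨j - 1, by omega⟩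
      obtain ⟨m, rfl⟩ : ∃ m, N = i + 1 + m := ⟨N - (i + 1), by omega⟩
      rw [div_le_div_iff₀ (by positivity) hLp, Nat.add_sub_cancel]
      have h1 : L ^ (m + 1) ≤ (2 * u) ^ (m + 1) := pow_le_pow_left₀ hL.le (by linarith) _
      have h2 : (2:ℝ) ^ (m + 1) ≤ 2 ^ (i + 1 + m) := pow_le_pow_right₀ (by norm_num) (by omega)
      calc u ^ i * L ^ (i + 1 + m + 1) = u ^ i * L ^ (i + 1) * L ^ (m + 1) := by ring
        _ ≤ u ^ i * L ^ (i + 1) * (2 * u) ^ (m + 1) := by gcongr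
        _ = 2 ^ (m + 1) * (u ^ (i + 1 + m) * L ^ (i + 1)) := by ring
        _ ≤ 2 ^ (i + 1 + m) * (u ^ (i + 1 + m) * L ^ (i + 1)) := mul_le_mul_of_nonneg_right h2 (by positivity)
        _ = _ := by ring
    refine (Finset.sum_le_sum hb).trans ?_
    rw [Finset.sum_const, Nat.card_Icc, Nat.add_sub_cancel, nsmul_eq_mul, ← mul_div_assoc]
    refine div_le_div_of_nonneg_right ?_ hLp.le
    have : 0 ≤ u ^ N := by positivity
    nlinarith

lemma expand_int (N : ℕ) : ∃ K > 0, ∀ x : ℝ, 16 ≤ x →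
    |(∫ t in Set.Ioc 1 (√x), (t - (⌊t⌋₊ : ℝ)) / t ^ 2 * (1 / (Real.log x - Real.log t))) -
      ∑ j ∈ Finset.Icc 1 N, (∫ t in Set.Ioi (1 : ℝ),
                (t - (⌊t⌋₊ : ℝ)) * (Real.log t) ^ (j - 1) / t ^ 2) / (Real.log x) ^ j| ≤ K / Real.log x ^ (N + 1) := by
  set I := ∫ t in Set.Ioi (1:ℝ), Real.log t ^ N / t ^ 2 with hI
  have hI0 : 0 ≤ I := setIntegral_nonneg measurableSet_Ioi fun t ht => by
    have : 0 < Real.log t := Real.log_pos ht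
    positivity
  refine ⟨(N * 2 ^ N + 2) * I + 1, by positivity, fun x hx => ?_⟩
  have hx0 : 0 < x := by linarith
  have hy4 : 4 ≤ √x := Real.le_sqrt_of_sq_le (by linarith)
  set y := √x with hy
  set L := Real.log x with hL
  have hL0 : 0 < L := Real.log_pos (by linarith)
  have hLy : Real.log y = L / 2 := Real.log_sqrt hx0.le
  let φ : ℝ → ℝ := fun t => if Real.log t ≤ L / 2 then 1 / (L - Real.log t) else 0
  have hiff : ∀ t : ℝ, 1 < t → (Real.log t ≤ L / 2 ↔ t ≤ y) := by
    intro t ht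
    rw [← hLy]
    exact Real.log_le_log_iff (by linarith) (by linarith)
  have hij : ∀ k : ℕ, IntegrableOn (fun t : ℝ => (t - (⌊t⌋₊ : ℝ)) * (Real.log t) ^ k / t ^ 2) (Set.Ioi 1) := by
    intro k
    refine Integrable.mono' (log_pow_integrable k) ?_ ?_
    · exact ((frac_meas.mul (Real.measurable_log.pow_const k)).div (measurable_id.pow_const 2)).aestronglyMeasurable
    · rw [ae_restrict_iff' measurableSet_Ioi]
      refine Eventually.of_forall fun t ht => ?_
      have ht : (1:ℝ) < t := ht
      have hl := Real.log_pos ht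
      have := frac_nonneg (by linarith : 0 ≤ t)
      have h2 := frac_le t
      rw [Real.norm_of_nonneg (by positivity)]
      gcongr
      have : 0 ≤ Real.log t ^ k := by positivity
      nlinarith
  have hφm : Measurable φ := by
    refine Measurable.ite (measurableSet_le Real.measurable_log measurable_const) ?_ measurable_const
    exact measurable_const.div (measurable_const.sub Real.measurable_log)
  have hφb : ∀ t : ℝ, |φ t| ≤ 2 / L := by
    intro t
    simp only [φ]
    split_ifs with h
    · have : 0 < L - Real.log t := by linarith
      rw [abs_of_nonneg (by positivity), div_le_div_iff₀ this hL0]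
      linarith
    · rw [abs_zero]; positivity
  have hiφ : IntegrableOn (fun t : ℝ => (t - (⌊t⌋₊ : ℝ)) / t ^ 2 * φ t) (Set.Ioi 1) := by
    refine Integrable.mono' ((log_pow_integrable 0).const_mul (2 / L)) ?_ ?_
    · exact ((frac_meas.div (measurable_id.pow_const 2)).mul hφm).aestronglyMeasurable
    · rw [ae_restrict_iff' measurableSet_Ioi]
      refine Eventually.of_forall fun t ht => ?_
      have ht : (1:ℝ) < t := ht
      have := frac_nonneg (by linarith : 0 ≤ t)
      have h2 := frac_le t
      rw [norm_mul, Real.norm_of_nonneg (by positivity), Real.norm_eq_abs, pow_zero, mul_comm]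
      gcongr
      exact hφb t
  have e1 : (∫ t in Set.Ioc 1 y, (t - (⌊t⌋₊ : ℝ)) / t ^ 2 * (1 / (L - Real.log t))) =
      ∫ t in Set.Ioi 1, (t - (⌊t⌋₊ : ℝ)) / t ^ 2 * φ t := by
    have hs : Set.Ioc 1 y ⊆ Set.Ioi 1 := fun t ht => ht.1
    rw [setIntegral_eq_of_subset_of_forall_sdiff_eq_zero measurableSet_Ioi hs (f := fun t => (t - (⌊t⌋₊ : ℝ)) / t ^ 2 * φ t)]
    · refine setIntegral_congr_fun measurableSet_Ioc fun t ht => ?_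
      simp only [φ]
      rw [if_pos ((hiff t ht.1).mpr ht.2)]
    · intro t ht
      simp only [φ]
      rw [if_neg, mul_zero]
      intro h
      exact ht.2 ⟨ht.1, (hiff t ht.1).mp h⟩
  have e2 : ∑ j ∈ Finset.Icc 1 N, (∫ t in Set.Ioi (1 : ℝ),
                (t - (⌊t⌋₊ : ℝ)) * (Real.log t) ^ (j - 1) / t ^ 2) / L ^ j =
      ∫ t in Set.Ioi (1:ℝ), ∑ j ∈ Finset.Icc 1 N, (t - (⌊t⌋₊ : ℝ)) * (Real.log t) ^ (j - 1) / t ^ 2 / L ^ j := by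
    rw [integral_finsetSum _ fun j _ => (hij (j - 1)).div_const _]
    refine Finset.sum_congr rfl fun j _ => ?_
    rw [integral_div]
  rw [e1, e2, ← integral_sub hiφ (integrable_finsetSum _ fun j _ => (hij (j - 1)).div_const _), ← Real.norm_eq_abs]
  refine (norm_integral_le_of_norm_le ((log_pow_integrable N).const_mul ((N * 2 ^ N + 2) / L ^ (N + 1))) ?_).trans ?_
  · rw [ae_restrict_iff' measurableSet_Ioi]
    refine Eventually.of_forall fun t ht => ?_
    have ht : (1:ℝ) < t := ht
    have hl := Real.log_pos ht
    have := frac_nonneg (by linarith : 0 ≤ t)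
    have h2 := frac_le t
    have e3 : (t - (⌊t⌋₊ : ℝ)) / t ^ 2 * φ t - ∑ j ∈ Finset.Icc 1 N, (t - (⌊t⌋₊ : ℝ)) * (Real.log t) ^ (j - 1) / t ^ 2 / L ^ j
      = (t - (⌊t⌋₊ : ℝ)) / t ^ 2 * (φ t - ∑ j ∈ Finset.Icc 1 N, (Real.log t) ^ (j - 1) / L ^ j) := by
      rw [mul_sub, Finset.mul_sum]
      congr 1
      refine Finset.sum_congr rfl fun j _ => ?_
      ring
    rw [e3, norm_mul, Real.norm_of_nonneg (by positivity), Real.norm_eq_abs]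
    calc (t - (⌊t⌋₊ : ℝ)) / t ^ 2 * |φ t - ∑ j ∈ Finset.Icc 1 N, (Real.log t) ^ (j - 1) / L ^ j|
        ≤ 1 / t ^ 2 * ((N * 2 ^ N + 2) * Real.log t ^ N / L ^ (N + 1)) := by
          gcongr
          exact expand_point N hL0 hl.le
      _ = _ := by ring
  · rw [integral_const_mul, ← hI, div_mul_eq_mul_div]
    gcongr
    linarith

lemma li_hasDeriv {u : ℝ} (hu : 1 < u) : HasDerivAt pntLi (1 / Real.log u) u := by
  have hc : ∀ v : ℝ, 1 < v → ContinuousAt (fun t => 1 / Real.log t) v := by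
    intro v hv
    exact continuousAt_const.div (Real.continuousAt_log (by linarith)) (Real.log_pos hv).ne'
  refine intervalIntegral.integral_hasDerivAt_right ?_ ?_ (hc u hu)
  · apply ContinuousOn.intervalIntegrable
    intro t ht
    refine (hc t ?_).continuousWithinAt
    rw [Set.mem_uIcc] at ht
    rcases ht with h | h <;> linarith [h.1]
  · exact (measurable_const.div Real.measurable_log).stronglyMeasurable.stronglyMeasurableAtFilter

lemma hyp_integral {x : ℝ} (hx : 16 ≤ x) :
    (∑ n ∈ Finset.Ioc 0 ⌊√x⌋₊, (pntLi (x / n) - pntLi (√x))) =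
      x * (Real.log (Real.log x) - Real.log (Real.log (√x)) -
        ∫ t in Set.Ioc 1 (√x), (t - (⌊t⌋₊ : ℝ)) / t ^ 2 * (1 / (Real.log x - Real.log t))) := by
  have hx0 : 0 < x := by linarith
  have hy4 : 4 ≤ √x := Real.le_sqrt_of_sq_le (by linarith)
  set y := √x with hy
  have hyy : y * y = x := Real.mul_self_sqrt hx0.le
  have hxy : x / y = y := by rw [← hyy]; field_simp
  have hyx : y < x := by nlinarith
  set L := Real.log x with hL
  have hL0 : 0 < L := Real.log_pos (by linarith)
  have hLy : Real.log y = L / 2 := Real.log_sqrt hx0.le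
  have hpos : ∀ t ∈ Set.Icc 1 y, 0 < L - Real.log t := by
    intro t ht
    have : Real.log t ≤ Real.log y := Real.log_le_log (by linarith [ht.1]) ht.2
    linarith
  let c : ℕ → ℝ := fun n => if n = 0 then 0 else 1
  have hc0 : c 0 = 0 := by simp [c]
  have hsum : ∀ t : ℝ, ∑ k ∈ Finset.Icc 0 ⌊t⌋₊, c k = ⌊t⌋₊ := by
    intro t
    rw [Finset.Icc_eq_cons_Ioc (Nat.zero_le _), Finset.sum_cons, hc0, zero_add]
    rw [Finset.sum_congr rfl (g := fun _ => (1:ℝ)) (by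
      intro n hn
      have : n ≠ 0 := by have := (Finset.mem_Ioc.mp hn).1; omega
      simp [c, this])]
    simp
  let f : ℝ → ℝ := fun t => pntLi (x / t)
  let f' : ℝ → ℝ := fun t => -(x / t ^ 2 * (1 / (L - Real.log t)))
  have hf : ∀ t ∈ Set.Icc 1 y, HasDerivAt f (f' t) t := by
    intro t ht
    have ht0 : 0 < t := by linarith [ht.1]
    have h1 : 1 < x / t := by rw [lt_div_iff₀ ht0]; linarith [ht.2]
    have h2 : HasDerivAt (fun t : ℝ => x / t) (-(x / t ^ 2)) t := by
      have := (hasDerivAt_inv ht0.ne').const_mul x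
      refine this.congr_deriv ?_
      field_simp
    refine ((li_hasDeriv h1).comp t h2).congr_deriv ?_
    simp only [f']
    rw [Real.log_div hx0.ne' ht0.ne']
    ring
  have hfc : ContinuousOn f' (Set.Icc 1 y) := by
    have a1 : ContinuousOn Real.log (Set.Icc 1 y) := fun t ht => (Real.continuousAt_log (by linarith [ht.1])).continuousWithinAt
    refine ((continuousOn_const.div (continuousOn_id.pow 2) ?_).mul (continuousOn_const.div (continuousOn_const.sub a1) ?_)).neg
    · intro t ht; have : (0:ℝ) < t := by linarith [ht.1]
      exact pow_ne_zero 2 this.ne'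
    · intro t ht; exact (hpos t ht).ne'
  have hd : ∀ t ∈ Set.Icc 1 y, deriv f t = f' t := fun t ht => (hf t ht).deriv
  have h := sum_mul_eq_sub_integral_mul₀ c hc0 y (f := f) (fun t ht => (hf t ht).differentiableAt) (by
    rw [MeasureTheory.integrableOn_congr_fun hd measurableSet_Icc]
    exact hfc.integrableOn_Icc)
  simp only [hsum] at h
  have h1 : ∑ k ∈ Finset.Icc 0 ⌊y⌋₊, f k * c k = ∑ n ∈ Finset.Ioc 0 ⌊y⌋₊, pntLi (x / n) := by
    rw [Finset.Icc_eq_cons_Ioc (Nat.zero_le _), Finset.sum_cons, hc0, mul_zero, zero_add]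
    refine Finset.sum_congr rfl fun n hn => ?_
    have : n ≠ 0 := by have := (Finset.mem_Ioc.mp hn).1; omega
    simp [c, this, f]
  rw [h1] at h
  have hint1 : IntegrableOn (fun t : ℝ => 1 / t * (1 / (L - Real.log t))) (Set.Ioc 1 y) := by
    refine (ContinuousOn.integrableOn_Icc ?_).mono_set Set.Ioc_subset_Icc_self
    have a1 : ContinuousOn Real.log (Set.Icc 1 y) := fun t ht => (Real.continuousAt_log (by linarith [ht.1])).continuousWithinAt
    refine ((continuousOn_const.div continuousOn_id ?_).mul (continuousOn_const.div (continuousOn_const.sub a1) ?_))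
    · intro t ht; have : (0:ℝ) < t := by linarith [ht.1]
      simp only [id]; positivity
    · intro t ht; exact (hpos t ht).ne'
  have hint2 : IntegrableOn (fun t : ℝ => (t - (⌊t⌋₊ : ℝ)) / t ^ 2 * (1 / (L - Real.log t))) (Set.Ioc 1 y) := by
    refine Integrable.mono' hint1 ?_ ?_
    · exact ((frac_meas.div (measurable_id.pow_const 2)).mul (measurable_const.div (measurable_const.sub Real.measurable_log))).aestronglyMeasurable
    · rw [ae_restrict_iff' measurableSet_Ioc]
      refine Eventually.of_forall fun t ht => ?_
      have ht1 : 1 ≤ t := ht.1.le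
      have h0 := hpos t ⟨ht1, ht.2⟩
      have := frac_nonneg (by linarith : 0 ≤ t)
      have h2 := frac_le t
      rw [Real.norm_of_nonneg (by positivity)]
      refine mul_le_mul_of_nonneg_right ?_ (by positivity)
      rw [div_le_div_iff₀ (by positivity) (by positivity)]
      nlinarith
  have e1 : ∫ t in Set.Ioc 1 y, deriv f t * (⌊t⌋₊ : ℝ) =
      -x * ((∫ t in Set.Ioc 1 y, 1 / t * (1 / (L - Real.log t))) -
        ∫ t in Set.Ioc 1 y, (t - (⌊t⌋₊ : ℝ)) / t ^ 2 * (1 / (L - Real.log t))) := by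
    rw [← integral_sub hint1 hint2, ← integral_const_mul]
    refine setIntegral_congr_fun measurableSet_Ioc fun t ht => ?_
    have ht0 : 0 < t := by linarith [ht.1]
    have h0 := hpos t ⟨ht.1.le, ht.2⟩
    simp only [hd t ⟨ht.1.le, ht.2⟩, f']
    field_simp
    ring
  have e2 : ∫ t in Set.Ioc 1 y, 1 / t * (1 / (L - Real.log t)) = Real.log L - Real.log (L / 2) := by
    rw [← intervalIntegral.integral_of_le (by linarith)]
    rw [intervalIntegral.integral_eq_sub_of_hasDerivAt (f := fun t => -Real.log (L - Real.log t))]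
    · rw [hLy, Real.log_one, sub_zero]
      ring_nf
    · intro t ht
      rw [Set.uIcc_of_le (by linarith)] at ht
      have ht0 : 0 < t := by linarith [ht.1]
      have h0 := hpos t ht
      refine (((Real.hasDerivAt_log ht0.ne').const_sub L).log h0.ne').neg.congr_deriv ?_
      field_simp
    · rw [intervalIntegrable_iff_integrableOn_Ioc_of_le (by linarith)]
      exact hint1
  rw [e1, e2] at h
  rw [Finset.sum_sub_distrib, h, hLy]
  simp only [f, hxy]
  simp
  ring
end

section
open Filter Topology MeasureTheory

lemma hyp_nat (X Y : ℕ) (h1 : Y * Y ≤ X) (h2 : X < (Y + 1) * (Y + 1)) :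
    ∑ p ∈ Finset.Ioc 0 X with p.Prime, X / p =
      ∑ p ∈ Finset.Ioc 0 Y with p.Prime, X / p +
      ∑ n ∈ Finset.Ioc 0 Y, ((Finset.Ioc Y (X / n)).filter Nat.Prime).card := by
  have hYX : Y ≤ X := by nlinarith
  have hd : Finset.Ioc 0 X = Finset.Ioc 0 Y ∪ Finset.Ioc Y X :=
    (Finset.Ioc_union_Ioc_eq_Ioc (Nat.zero_le _) hYX).symm
  rw [hd, Finset.filter_union, Finset.sum_union]
  swap
  · refine Finset.disjoint_filter_filter ?_
    rw [Finset.disjoint_left]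
    intro a ha hb
    rw [Finset.mem_Ioc] at ha hb
    omega
  congr 1
  have e1 : ∀ p ∈ (Finset.Ioc Y X).filter Nat.Prime, X / p = ∑ n ∈ Finset.Ioc 0 Y, if n * p ≤ X then 1 else 0 := by
    intro p hp
    rw [Finset.mem_filter, Finset.mem_Ioc] at hp
    have hp0 : 0 < p := hp.2.pos
    rw [← Finset.card_filter]
    have : (Finset.Ioc 0 Y).filter (fun n => n * p ≤ X) = Finset.Ioc 0 (X / p) := by
      ext n
      rw [Finset.mem_filter, Finset.mem_Ioc, Finset.mem_Ioc, Nat.le_div_iff_mul_le hp0]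
      constructor
      · rintro ⟨⟨a, b⟩, c⟩; exact ⟨a, c⟩
      · rintro ⟨a, c⟩
        refine ⟨⟨a, ?_⟩, c⟩
        by_contra hcon
        have : (Y + 1) * (Y + 1) ≤ n * p := Nat.mul_le_mul (by omega) (by omega)
        omega
    rw [this]
    simp
  rw [Finset.sum_congr rfl e1, Finset.sum_comm]
  refine Finset.sum_congr rfl fun n hn => ?_
  rw [Finset.mem_Ioc] at hn
  rw [← Finset.card_filter]
  congr 1
  ext p
  simp only [Finset.mem_filter, Finset.mem_Ioc, Nat.le_div_iff_mul_le hn.1]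
  constructor
  · rintro ⟨⟨⟨a, b⟩, c⟩, d⟩
    exact ⟨⟨a, by rw [mul_comm]; exact d⟩, c⟩
  · rintro ⟨⟨a, b⟩, c⟩
    refine ⟨⟨⟨a, ?_⟩, c⟩, by rw [mul_comm]; exact b⟩
    exact (Nat.le_mul_of_pos_right p hn.1).trans b

lemma hyp_card (X Y n : ℕ) (h1 : Y * Y ≤ X) (hn : n ∈ Finset.Ioc 0 Y) :
    (((Finset.Ioc Y (X / n)).filter Nat.Prime).card : ℝ) =
      ((Finset.Ioc 0 (X / n)).filter Nat.Prime).card - ((Finset.Ioc 0 Y).filter Nat.Prime).card := by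
  rw [Finset.mem_Ioc] at hn
  have hY : Y ≤ X / n := by
    rw [Nat.le_div_iff_mul_le hn.1]
    exact (Nat.mul_le_mul_left Y hn.2).trans h1
  rw [← Finset.Ioc_union_Ioc_eq_Ioc (Nat.zero_le _) hY, Finset.filter_union, Finset.card_union_of_disjoint]
  · push_cast; ring
  · refine Finset.disjoint_filter_filter ?_
    rw [Finset.disjoint_left]
    intro a ha hb
    rw [Finset.mem_Ioc] at ha hb
    omega

lemma hyp_real {x : ℝ} (hx : 16 ≤ x) :
    (∑ p ∈ Finset.Ioc 0 ⌊x⌋₊ with p.Prime, (⌊x / p⌋₊ : ℝ)) =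
      (∑ p ∈ Finset.Ioc 0 ⌊√x⌋₊ with p.Prime, (⌊x / p⌋₊ : ℝ)) +
      ∑ n ∈ Finset.Ioc 0 ⌊√x⌋₊, ((((Finset.Ioc 0 ⌊x / n⌋₊).filter Nat.Prime).card : ℝ) -
        ((Finset.Ioc 0 ⌊√x⌋₊).filter Nat.Prime).card) := by
  have hx0 : 0 ≤ x := by linarith
  have hyy : √x * √x = x := Real.mul_self_sqrt hx0
  have hy0 := Real.sqrt_nonneg x
  have h1 : ⌊√x⌋₊ * ⌊√x⌋₊ ≤ ⌊x⌋₊ := by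
    rw [Nat.le_floor_iff hx0]
    push_cast
    have := Nat.floor_le hy0
    have h0 : (0:ℝ) ≤ ⌊√x⌋₊ := by positivity
    nlinarith
  have h2 : ⌊x⌋₊ < (⌊√x⌋₊ + 1) * (⌊√x⌋₊ + 1) := by
    rw [Nat.floor_lt hx0]
    push_cast
    have := Nat.lt_floor_add_one (√x)
    nlinarith
  have h := congrArg (Nat.cast (R := ℝ)) (hyp_nat _ _ h1 h2)
  simp only [Nat.floor_div_natCast]
  rw [Nat.cast_add, Nat.cast_sum, Nat.cast_sum, Nat.cast_sum, Finset.sum_congr rfl (hyp_card _ _ · h1)] at h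
  exact h

lemma sqrt_le_log (k : ℕ) : ∃ C > 0, ∀ x : ℝ, 16 ≤ x → √x ≤ C * (x / Real.log x ^ k) := by
  obtain ⟨C, hC, h⟩ := pow_log_le k
  refine ⟨2 ^ k * C, by positivity, fun x hx => ?_⟩
  have hx0 : 0 < x := by linarith
  have hL : 0 < Real.log x := Real.log_pos (by linarith)
  have h2 := h (√x) (by rw [Real.one_le_sqrt]; linarith)
  rw [Real.log_sqrt hx0.le, div_pow, div_le_iff₀ (by positivity)] at h2
  rw [← mul_div_assoc, le_div_iff₀ (by positivity)]
  have hyy : √x * √x = x := Real.mul_self_sqrt hx0.le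
  have := mul_le_mul_of_nonneg_left h2 (Real.sqrt_nonneg x)
  calc _ ≤ _ := this
    _ = 2 ^ k * C * (√x * √x) := by ring
    _ = _ := by rw [hyy]

lemma log_16 {x : ℝ} (hx : 16 ≤ x) : 2 ≤ Real.log x := by
  have h1 : Real.log 16 ≤ Real.log x := Real.log_le_log (by norm_num) hx
  have h2 : Real.log 16 = 4 * Real.log 2 := by
    rw [show (16:ℝ) = 2 ^ 4 by norm_num, Real.log_pow]; norm_num
  have := Real.log_two_gt_d9
  linarith

lemma harm_le {x : ℝ} (hx : 16 ≤ x) : ∑ n ∈ Finset.Ioc 0 ⌊√x⌋₊, 1 / (n:ℝ) ≤ Real.log x := by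
  have hx0 : 0 < x := by linarith
  have hy4 : 4 ≤ √x := Real.le_sqrt_of_sq_le (by linarith)
  have h1 := harmonic_le_one_add_log ⌊√x⌋₊
  have h2 : ((harmonic ⌊√x⌋₊ : ℚ) : ℝ) = ∑ n ∈ Finset.Ioc 0 ⌊√x⌋₊, 1 / (n:ℝ) := by
    rw [harmonic_eq_sum_Icc]
    push_cast
    refine Finset.sum_congr rfl fun n _ => by rw [one_div]
  have h3 : Real.log (⌊√x⌋₊:ℝ) ≤ Real.log (√x) := by
    refine Real.log_le_log ?_ (Nat.floor_le (by linarith))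
    have : 4 ≤ ⌊√x⌋₊ := Nat.le_floor (by exact_mod_cast hy4)
    have : (4:ℝ) ≤ ⌊√x⌋₊ := by exact_mod_cast this
    linarith
  rw [Real.log_sqrt hx0.le] at h3
  have := log_16 hx
  linarith

lemma part_one (k : ℕ) : ∃ C > 0, ∀ x : ℝ, 16 ≤ x →
    |(∑ p ∈ Finset.Ioc 0 ⌊√x⌋₊ with p.Prime, (⌊x / p⌋₊ : ℝ)) -
      x * (Real.log (Real.log (√x)) + (Real.eulerMascheroniConstant + cstH 0))| ≤ C * (x / Real.log x ^ (k + 1)) := by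
  obtain ⟨C1, hC1, h1⟩ := mertens_full k
  obtain ⟨C2, hC2, h2⟩ := sqrt_le_log (k + 1)
  refine ⟨C1 * 2 ^ (k + 1) + C2, by positivity, fun x hx => ?_⟩
  have hx0 : 0 < x := by linarith
  have hy4 : 4 ≤ √x := Real.le_sqrt_of_sq_le (by linarith)
  have hL := log_16 hx
  have a := h1 (√x) (by linarith)
  set y := √x
  set Mc := Real.eulerMascheroniConstant + cstH 0
  set P := ∑ p ∈ Finset.Ioc 0 ⌊y⌋₊ with p.Prime, 1 / (p:ℝ)
  rw [Real.log_sqrt hx0.le] at a ⊢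
  have b : |(∑ p ∈ Finset.Ioc 0 ⌊y⌋₊ with p.Prime, (⌊x / p⌋₊ : ℝ)) - x * P| ≤ y := by
    rw [Finset.mul_sum, ← Finset.sum_sub_distrib]
    refine (Finset.abs_sum_le_sum_abs _ _).trans ?_
    have : ∀ p ∈ (Finset.Ioc 0 ⌊y⌋₊).filter Nat.Prime, |(⌊x / p⌋₊ : ℝ) - x * (1 / (p:ℝ))| ≤ 1 := by
      intro p _
      have f1 := frac_nonneg (t := x / p) (by positivity)
      have f2 := frac_le (x / p)
      rw [abs_le, mul_one_div]
      constructor <;> linarith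
    refine (Finset.sum_le_sum this).trans ?_
    rw [Finset.sum_const, nsmul_eq_mul, mul_one]
    have h3 : ((Finset.Ioc 0 ⌊y⌋₊).filter Nat.Prime).card ≤ ⌊y⌋₊ := by
      refine (Finset.card_filter_le _ _).trans ?_
      simp
    have h4 : (((Finset.Ioc 0 ⌊y⌋₊).filter Nat.Prime).card : ℝ) ≤ ⌊y⌋₊ := by exact_mod_cast h3
    exact h4.trans (Nat.floor_le (by linarith))
  have c := h2 x hx
  have d : |x * P - x * (Real.log (Real.log x / 2) + Mc)| ≤ C1 * 2 ^ (k + 1) * (x / Real.log x ^ (k + 1)) := by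
    rw [← mul_sub, abs_mul, abs_of_pos hx0, ← sub_sub]
    refine (mul_le_mul_of_nonneg_left a hx0.le).trans (le_of_eq ?_)
    rw [div_pow]
    field_simp
  refine (abs_sub_le _ (x * P) _).trans ?_
  linarith

lemma part_two (k : ℕ) : ∃ C > 0, ∀ x : ℝ, 16 ≤ x →
    |(∑ n ∈ Finset.Ioc 0 ⌊√x⌋₊, ((((Finset.Ioc 0 ⌊x / n⌋₊).filter Nat.Prime).card : ℝ) -
        ((Finset.Ioc 0 ⌊√x⌋₊).filter Nat.Prime).card)) -
      ∑ n ∈ Finset.Ioc 0 ⌊√x⌋₊, (pntLi (x / n) - pntLi (√x))| ≤ C * (x / Real.log x ^ (k + 1)) := by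
  obtain ⟨C, hC, h⟩ := pi_asymp (k + 2)
  refine ⟨2 * C * 2 ^ (k + 2), by positivity, fun x hx => ?_⟩
  have hx0 : 0 < x := by linarith
  have hy4 : 4 ≤ √x := Real.le_sqrt_of_sq_le (by linarith)
  have hL := log_16 hx
  have hH := harm_le hx
  set y := √x with hy
  have hyy : y * y = x := Real.mul_self_sqrt hx0.le
  have hLy : Real.log y = Real.log x / 2 := Real.log_sqrt hx0.le
  set L := Real.log x
  rw [← Finset.sum_sub_distrib]
  refine (Finset.abs_sum_le_sum_abs _ _).trans ?_
  have key : ∀ z : ℝ, y ≤ z → |(((Finset.Ioc 0 ⌊z⌋₊).filter Nat.Prime).card : ℝ) - pntLi z| ≤ C * z / (L / 2) ^ (k + 2) := by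
    intro z hz
    refine (h z (by linarith)).trans ?_
    have : L / 2 ≤ Real.log z := by rw [← hLy]; exact Real.log_le_log (by linarith) hz
    have hz0 : 0 < z := by linarith
    gcongr
  have hb : ∀ n ∈ Finset.Ioc 0 ⌊y⌋₊, |((((Finset.Ioc 0 ⌊x / n⌋₊).filter Nat.Prime).card : ℝ) -
        ((Finset.Ioc 0 ⌊y⌋₊).filter Nat.Prime).card) - (pntLi (x / n) - pntLi y)| ≤
      2 * C * x / (L / 2) ^ (k + 2) * (1 / (n:ℝ)) := by
    intro n hn
    rw [Finset.mem_Ioc] at hn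
    have hn0 : (0:ℝ) < n := by exact_mod_cast hn.1
    have hny : (n:ℝ) ≤ y := (Nat.cast_le.mpr hn.2).trans (Nat.floor_le (by linarith))
    have hz : y ≤ x / n := by
      rw [le_div_iff₀ hn0, ← hyy]
      gcongr
    have k1 := key _ hz
    have k2 := key y le_rfl
    have k3 : C * y / (L / 2) ^ (k + 2) ≤ C * (x / n) / (L / 2) ^ (k + 2) := by gcongr
    have e : 2 * C * x / (L / 2) ^ (k + 2) * (1 / (n:ℝ)) = C * (x / n) / (L / 2) ^ (k + 2) + C * (x / n) / (L / 2) ^ (k + 2) := by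
      ring
    rw [e, sub_sub_sub_comm]
    refine (abs_sub _ _).trans ?_
    linarith
  refine (Finset.sum_le_sum hb).trans ?_
  rw [← Finset.mul_sum]
  have hL0 : 0 < L := by linarith
  calc _ ≤ 2 * C * x / (L / 2) ^ (k + 2) * L := mul_le_mul_of_nonneg_left hH (by positivity)
    _ = _ := by
      rw [div_pow]
      field_simp
      ring

theorem omega_main (N : ℕ) : ∃ C > 0, ∀ x : ℝ, 16 ≤ x →
    |(∑ p ∈ Finset.Ioc 0 ⌊x⌋₊ with p.Prime, (⌊x / p⌋₊ : ℝ)) -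
      x * (Real.log (Real.log x) + (Real.eulerMascheroniConstant + cstH 0) -
        ∑ j ∈ Finset.Icc 1 N, (∫ t in Set.Ioi (1 : ℝ),
                (t - (⌊t⌋₊ : ℝ)) * (Real.log t) ^ (j - 1) / t ^ 2) / (Real.log x) ^ j)| ≤
      C * (x / Real.log x ^ (N + 1)) := by
  obtain ⟨C1, hC1, h1⟩ := part_one N
  obtain ⟨C2, hC2, h2⟩ := part_two N
  obtain ⟨C3, hC3, h3⟩ := expand_int N
  refine ⟨C1 + C2 + C3, by positivity, fun x hx => ?_⟩
  have a1 := h1 x hx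
  have a2 := h2 x hx
  have a3 := h3 x hx
  have hx0 : 0 < x := by linarith
  rw [hyp_integral hx] at a2
  rw [hyp_real hx]
  set S := ∑ j ∈ Finset.Icc 1 N, (∫ t in Set.Ioi (1 : ℝ),
                (t - (⌊t⌋₊ : ℝ)) * (Real.log t) ^ (j - 1) / t ^ 2) / (Real.log x) ^ j
  set J := ∫ t in Set.Ioc 1 (√x), (t - (⌊t⌋₊ : ℝ)) / t ^ 2 * (1 / (Real.log x - Real.log t))
  have a4 : |x * (J - S)| ≤ C3 * (x / Real.log x ^ (N + 1)) := by
    rw [abs_mul, abs_of_pos hx0]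
    refine (mul_le_mul_of_nonneg_left a3 hx0.le).trans (le_of_eq ?_)
    ring
  rw [abs_le] at *
  constructor <;> nlinarith
end

lemma rpow_le_log (k : ℕ) : ∃ C > 0, ∀ x : ℝ, 16 ≤ x → x ^ (3 / 4 : ℝ) ≤ C * (x / Real.log x ^ k) := by
  obtain ⟨C, hC, h⟩ := pow_log_le k
  refine ⟨4 ^ k * C, by positivity, fun x hx => ?_⟩
  have hx0 : 0 < x := by linarith
  have hL : 0 < Real.log x := Real.log_pos (by linarith)
  have h2 := h (x ^ (1 / 4 : ℝ)) (Real.one_le_rpow (by linarith) (by norm_num))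
  rw [Real.log_rpow hx0, one_div_mul_eq_div, div_pow, div_le_iff₀ (by positivity)] at h2
  rw [← mul_div_assoc, le_div_iff₀ (by positivity)]
  have e : x ^ (3 / 4 : ℝ) * x ^ (1 / 4 : ℝ) = x := by
    rw [← Real.rpow_add hx0]; norm_num
  calc _ ≤ _ := mul_le_mul_of_nonneg_left h2 (by positivity : 0 ≤ x ^ (3 / 4 : ℝ))
    _ = 4 ^ k * C * (x ^ (3 / 4 : ℝ) * x ^ (1 / 4 : ℝ)) := by ring
    _ = _ := by rw [e]

theorem stmt_10 (l : ℕ) (N : ℕ) (hN : 1 ≤ N) :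
    Summable (fun p : Nat.Primes =>
      |Real.log (1 - 1 / ((p : ℕ) : ℝ)) +
        (1 / ((p : ℕ) : ℝ)) * (1 - 1 / ((p : ℕ) : ℝ)) ^ (-(l : ℤ))|) ∧
    ∃ c > (0 : ℝ), ∃ x₀ : ℝ, 3 ≤ x₀ ∧ ∀ x ≥ x₀,
      |(∑ n ∈ Finset.Icc 1 ⌊x⌋₊, ∑ p ∈ n.primeFactors,
          ((Nat.choose (n.factorization p + l - 1) l : ℝ))) -
        (x * Real.log (Real.log x) +
          (Real.eulerMascheroniConstant +
            ∑' p : Nat.Primes,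
              (Real.log (1 - 1 / ((p : ℕ) : ℝ)) +
                (1 / ((p : ℕ) : ℝ)) * (1 - 1 / ((p : ℕ) : ℝ)) ^ (-(l : ℤ)))) * x +
          x * ∑ j ∈ Finset.Icc 1 N,
            (-∫ t in Set.Ioi (1 : ℝ),
                (t - (⌊t⌋₊ : ℝ)) * (Real.log t) ^ (j - 1) / t ^ 2) /
              (Real.log x) ^ j)| ≤
        c * x / (Real.log x) ^ (N + 1) := by
  have hfun : (fun p : Nat.Primes => Real.log (1 - 1 / ((p : ℕ) : ℝ)) +
        (1 / ((p : ℕ) : ℝ)) * (1 - 1 / ((p : ℕ) : ℝ)) ^ (-(l : ℤ))) =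
      fun p : Nat.Primes => (Real.log (1 - ((p:ℕ):ℝ) ^ (-1 - (0:ℝ))) + ((p:ℕ):ℝ) ^ (-1 - (0:ℝ))) +
        (1 / ((p:ℕ):ℝ) * (1 - 1 / ((p:ℕ):ℝ)) ^ (-(l:ℤ)) - 1 / ((p:ℕ):ℝ)) := by
    funext p
    rw [sub_zero, Real.rpow_neg_one, ← one_div]
    ring
  have hsm := (cstH_summable le_rfl).add (tl_G_summable l)
  refine ⟨?_, ?_⟩
  · rw [← hfun] at hsm
    exact hsm.abs
  have htsum : ∑' p : Nat.Primes, (Real.log (1 - 1 / ((p : ℕ) : ℝ)) +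
        (1 / ((p : ℕ) : ℝ)) * (1 - 1 / ((p : ℕ) : ℝ)) ^ (-(l : ℤ))) = cstH 0 +
      ∑' p : Nat.Primes, (1 / ((p:ℕ):ℝ) * (1 - 1 / ((p:ℕ):ℝ)) ^ (-(l:ℤ)) - 1 / ((p:ℕ):ℝ)) := by
    rw [hfun, (cstH_summable le_rfl).tsum_add (tl_G_summable l), cstH]
  rw [htsum]
  obtain ⟨C1, hC1, h1⟩ := omega_main N
  obtain ⟨C2, hC2, h2⟩ := tl_main l
  obtain ⟨C3, hC3, h3⟩ := rpow_le_log (N + 1)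
  refine ⟨C1 + C2 * C3, by positivity, 16, by norm_num, fun x hx => ?_⟩
  have a1 := h1 x hx
  have a2 := h2 x (by linarith)
  have a3 := mul_le_mul_of_nonneg_left (h3 x hx) hC2.le
  have e : ∑ j ∈ Finset.Icc 1 N, (-∫ t in Set.Ioi (1 : ℝ),
                (t - (⌊t⌋₊ : ℝ)) * (Real.log t) ^ (j - 1) / t ^ 2) / (Real.log x) ^ j =
      -∑ j ∈ Finset.Icc 1 N, (∫ t in Set.Ioi (1 : ℝ),
                (t - (⌊t⌋₊ : ℝ)) * (Real.log t) ^ (j - 1) / t ^ 2) / (Real.log x) ^ j := by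
    rw [← Finset.sum_neg_distrib]
    refine Finset.sum_congr rfl fun j _ => ?_
    rw [neg_div]
  rw [e, mul_div_assoc]
  rw [abs_le] at *
  constructor <;> nlinarith
end

section
/- Let f : ℕ → ℂ be in the class F₀ and let k ≥ 2 be a fixed integer. Then Σ_{n₁,…,n_k ≤ x} f(gcd(n₁,…,n_k)) = D_{f,k}·x^k + R(x), where D_{f,k} = Σ_p (1 − 1/p^k)·Σ_{ν=1}^{∞} f(p^ν)/p^{νk} (the sum over all primes, absolutely convergent), and where R(x) = O(x^{k−1}) as x → ∞ if k ≥ 3, and R(x) = O(x·log log x) as x → ∞ if k = 2. -/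
lemma aux_tel (f : ℕ → ℂ) (h1 : f 1 = 0) (p n : ℕ) (hp : p.Prime) (hn : n ≠ 0) :
    ∑ v ∈ Finset.range n, (if p ^ (v + 1) ∣ n then f (p ^ (v + 1)) - f (p ^ v) else 0)
      = f (p ^ n.factorization p) := by
  have hlt : n.factorization p < n := Nat.factorization_lt p hn
  have h2 := Finset.sum_range_sub (fun v => f (p ^ v)) (n.factorization p)
  simp only [pow_zero, h1, sub_zero] at h2
  rw [← h2, ← Finset.sum_filter]
  refine Finset.sum_congr ?_ (fun _ _ => rfl)
  ext v
  simp only [Finset.mem_filter, Finset.mem_range]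
  rw [hp.pow_dvd_iff_le_factorization hn]
  omega

lemma aux_fac (f : ℕ → ℂ) (h1 : f 1 = 0)
    (hadd : ∀ m n : ℕ, Nat.Coprime m n → f (m * n) = f m + f n) (n : ℕ) (hn : n ≠ 0) :
    f n = ∑ p ∈ (Finset.range (n+1)).filter Nat.Prime, f (p ^ n.factorization p) := by
  have h := Nat.multiplicative_factorization (fun n => Multiplicative.ofAdd (f n))
    (fun x y h => by simp [hadd x y h, ofAdd_add]) (by simp [h1]) hn
  have h' : f n = n.factorization.sum fun p k => f (p ^ k) := by
    apply_fun Multiplicative.toAdd at h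
    simpa [Finsupp.prod, Finsupp.sum, toAdd_prod] using h
  rw [h', Finsupp.sum]
  refine Finset.sum_subset ?_ ?_
  · intro p hp
    simp only [Nat.support_factorization, Nat.mem_primeFactors] at hp
    simp only [Finset.mem_filter, Finset.mem_range]
    exact ⟨by have := Nat.le_of_dvd (Nat.pos_of_ne_zero hn) hp.2.1; omega, hp.1⟩
  · intro p _ hp
    simp only [Finsupp.mem_support_iff, not_not] at hp
    simp [hp, h1]

lemma aux_hasSum (f : ℕ → ℂ) (h1 : f 1 = 0)
    (hadd : ∀ m n : ℕ, Nat.Coprime m n → f (m * n) = f m + f n) (n : ℕ) (hn : n ≠ 0) :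
    HasSum (fun z : Nat.Primes × ℕ => if (z.1 : ℕ) ^ (z.2 + 1) ∣ n then
      f ((z.1 : ℕ) ^ (z.2 + 1)) - f ((z.1 : ℕ) ^ z.2) else 0) (f n) := by
  let P : Finset Nat.Primes := Finset.subtype Nat.Prime (Finset.range (n+1))
  have key : f n = ∑ z ∈ P ×ˢ Finset.range n, if (z.1 : ℕ) ^ (z.2 + 1) ∣ n then
      f ((z.1 : ℕ) ^ (z.2 + 1)) - f ((z.1 : ℕ) ^ z.2) else 0 := by
    rw [Finset.sum_product, aux_fac f h1 hadd n hn, ← Finset.sum_subtype_eq_sum_filter]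
    refine Finset.sum_congr rfl fun p _ => ?_
    exact (aux_tel f h1 p n p.2 hn).symm
  rw [key]
  apply hasSum_sum_of_ne_finset_zero
  rintro ⟨p, v⟩ hz
  simp only
  rw [if_neg]
  intro hd
  apply hz
  have hle := Nat.le_of_dvd (Nat.pos_of_ne_zero hn) hd
  have h3 : v + 1 < (p : ℕ) ^ (v+1) := Nat.lt_pow_self p.2.one_lt
  have h4 : (p : ℕ) ≤ (p : ℕ) ^ (v+1) := Nat.le_self_pow (by omega) _
  exact Finset.mem_product.2 ⟨Finset.mem_subtype.2 (Finset.mem_range.2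
    (show (p : ℕ) < n + 1 by omega)), Finset.mem_range.2 (by omega)⟩

lemma aux_count (k N q : ℕ) :
    ((Fintype.piFinset (fun _ : Fin k => Finset.Icc 1 N)).filter
      (fun n => q ∣ Finset.univ.gcd n)).card = (N / q) ^ k := by
  have : (Fintype.piFinset (fun _ : Fin k => Finset.Icc 1 N)).filter
      (fun n => q ∣ Finset.univ.gcd n) =
      Fintype.piFinset (fun _ : Fin k => (Finset.Ioc 0 N).filter (q ∣ ·)) := by
    ext n
    simp only [Finset.mem_filter, Fintype.mem_piFinset, Finset.dvd_gcd_iff, Finset.mem_univ,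
      true_imp_iff, Finset.mem_Icc, Finset.mem_Ioc]
    constructor
    · rintro ⟨a, b⟩ i
      exact ⟨⟨(a i).1, (a i).2⟩, b i⟩
    · intro a
      exact ⟨fun i => ⟨(a i).1.1, (a i).1.2⟩, fun i => (a i).2⟩
  rw [this, Fintype.card_piFinset]
  simp [Nat.Ioc_filter_dvd_card_eq_div]

lemma aux_S (f : ℕ → ℂ) (h1 : f 1 = 0)
    (hadd : ∀ m n : ℕ, Nat.Coprime m n → f (m * n) = f m + f n) (k N : ℕ) (hk : 0 < k) :
    HasSum (fun z : Nat.Primes × ℕ =>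
      (f ((z.1 : ℕ) ^ (z.2 + 1)) - f ((z.1 : ℕ) ^ z.2)) *
        (((N / (z.1 : ℕ) ^ (z.2 + 1) : ℕ) : ℂ)) ^ k)
      (∑ n ∈ Fintype.piFinset (fun _ : Fin k => Finset.Icc 1 N), f (Finset.univ.gcd n)) := by
  have := hasSum_sum (s := Fintype.piFinset (fun _ : Fin k => Finset.Icc 1 N))
    (fun n hn => aux_hasSum f h1 hadd (Finset.univ.gcd n) (by
      rw [Ne, Finset.gcd_eq_zero_iff]
      intro h
      have := Fintype.mem_piFinset.1 hn ⟨0, hk⟩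
      rw [h _ (Finset.mem_univ _)] at this
      simp at this))
  convert this using 2 with z
  rw [← Finset.sum_filter, Finset.sum_const, aux_count, nsmul_eq_mul, mul_comm]
  push_cast
  rfl

lemma aux_pow (x : ℝ) (hx : 0 ≤ x) (q k : ℕ) :
    |((⌊x⌋₊ / q : ℕ) : ℝ) ^ k - (x / q) ^ k| ≤ k * (x / q) ^ (k - 1) := by
  rw [← Nat.floor_div_natCast]
  have hy : 0 ≤ x / q := by positivity
  generalize x / (q : ℝ) = y at hy
  have h1 := Nat.floor_le hy
  have h2 := Nat.lt_floor_add_one y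
  refine (abs_pow_sub_pow_le _ _ _).trans ?_
  have h3 : |(⌊y⌋₊ : ℝ) - y| ≤ 1 := by rw [abs_le]; constructor <;> linarith
  have h4 : max |(⌊y⌋₊ : ℝ)| |y| = y := by
    rw [abs_of_nonneg hy, abs_of_nonneg (by positivity)]; exact max_eq_right h1
  rw [h4]
  have : 0 ≤ (k : ℝ) * y ^ (k-1) := by positivity
  rw [mul_assoc]
  nlinarith

/-! Mertens type bound -/
lemma aux_mert_step (J : ℕ) (hJ : 1 ≤ J) :
    ∑ p ∈ (Finset.Ico (2^J) (2^(J+1))).filter Nat.Prime, (1 / (p : ℝ)) ≤ 4 / J := by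
  set s := (Finset.Ico (2^J) (2^(J+1))).filter Nat.Prime with hs
  have h1 : (2^J) ^ s.card ≤ ∏ p ∈ s, p := by
    apply Finset.pow_card_le_prod
    intro p hp
    simp [hs] at hp
    exact hp.1.1
  have h2 : ∏ p ∈ s, p ≤ primorial (2^(J+1)) := by
    apply Finset.prod_le_prod_of_subset_of_one_le'
    · intro p hp
      simp [hs] at hp ⊢
      exact ⟨by omega, hp.2⟩
    · intro p hp _
      simp at hp
      exact hp.2.one_lt.le
  have h3 := primorial_le_four_pow (2^(J+1))
  have h4 : 2 ^ (J * s.card) ≤ 2 ^ (2 * 2^(J+1)) := by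
    rw [pow_mul, pow_mul]; exact h1.trans (h2.trans h3)
  have h5 : J * s.card ≤ 2 * 2^(J+1) := (Nat.pow_le_pow_iff_right (by norm_num)).1 h4
  have h6 : (J : ℝ) * s.card ≤ 2 * 2^(J+1) := by exact_mod_cast h5
  have h7 : ∑ p ∈ s, (1 / (p : ℝ)) ≤ s.card • (1 / (2:ℝ)^J) := by
    apply Finset.sum_le_card_nsmul
    intro p hp
    simp [hs] at hp
    apply one_div_le_one_div_of_le (by positivity)
    exact_mod_cast hp.1.1
  refine h7.trans ?_
  have : (0:ℝ) < J := by exact_mod_cast hJ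
  rw [nsmul_eq_mul, mul_one_div, div_le_div_iff₀ (by positivity) this]
  rw [pow_succ] at h6
  linarith

lemma aux_mert (J : ℕ) :
    ∑ p ∈ (Finset.range (2^(J+1))).filter Nat.Prime, (1 / (p : ℝ)) ≤ 4 * (harmonic J : ℝ) := by
  induction J with
  | zero =>
    have : (Finset.range (2^(0+1))).filter Nat.Prime = ∅ := by decide
    rw [this]; simp
  | succ J ih =>
    have hsub : (Finset.range (2^(J+1+1))).filter Nat.Prime =
      (Finset.range (2^(J+1))).filter Nat.Prime ∪
        (Finset.Ico (2^(J+1)) (2^(J+1+1))).filter Nat.Prime := by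
      rw [← Finset.filter_union]
      congr 1
      ext x
      have : 2^(J+1) ≤ 2^(J+1+1) := Nat.pow_le_pow_right (by norm_num) (by omega)
      simp only [Finset.mem_range, Finset.mem_union, Finset.mem_Ico]
      omega
    rw [hsub, Finset.sum_union]
    · rw [harmonic_succ]
      have := aux_mert_step (J+1) (by omega)
      push_cast at this ⊢
      rw [mul_add, ← div_eq_mul_inv]
      linarith
    · rw [Finset.disjoint_left]
      intro a ha hb
      simp at ha hb
      omega

lemma aux_mertens (x : ℝ) (hx : 16 ≤ x) :
    ∑ p ∈ (Finset.range (⌊x⌋₊ + 1)).filter Nat.Prime, (1 / (p : ℝ)) ≤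
      4 * (1 + Real.log 2 + Real.log (Real.log x)) := by
  set N := ⌊x⌋₊ with hN
  have hN16 : 16 ≤ N := Nat.le_floor (by exact_mod_cast hx)
  have hNx : (N : ℝ) ≤ x := Nat.floor_le (by linarith)
  have hlt := Nat.lt_pow_succ_log_self (b := 2) (by norm_num) N
  have hle := Nat.pow_log_le_self 2 (x := N) (by omega)
  set J := Nat.log 2 N with hJ
  have hJ0 : 0 < J := Nat.log_pos (by norm_num) (by omega)
  have h1 : ∑ p ∈ (Finset.range (N + 1)).filter Nat.Prime, (1 / (p : ℝ)) ≤
      ∑ p ∈ (Finset.range (2^(J+1))).filter Nat.Prime, (1 / (p : ℝ)) := by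
    apply Finset.sum_le_sum_of_subset_of_nonneg
    · apply Finset.filter_subset_filter
      intro a ha
      simp only [Finset.mem_range] at ha ⊢
      exact lt_of_lt_of_le ha hlt
    · intros; positivity
  have h2 := aux_mert J
  have h3 := harmonic_le_one_add_log J
  have h4 : (J : ℝ) * Real.log 2 ≤ Real.log x := by
    rw [← Real.log_pow]
    apply Real.log_le_log (by positivity)
    refine le_trans ?_ hNx
    exact_mod_cast hle
  have h5 := Real.log_two_gt_d9
  have hlx : 0 < Real.log x := Real.log_pos (by linarith)
  have hJr : (0:ℝ) < J := by exact_mod_cast hJ0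
  have h6 : (J : ℝ) ≤ 2 * Real.log x := by nlinarith
  have h7 : Real.log J ≤ Real.log 2 + Real.log (Real.log x) := by
    rw [← Real.log_mul (by norm_num) hlx.ne']
    exact Real.log_le_log hJr h6
  linarith

lemma aux_bound (f : ℕ → ℂ) (h1 : f 1 = 0)
    (hp1 : ∀ p : ℕ, p.Prime → f p = 1)
    (hbound : ∃ (l : ℕ) (K : ℝ), ∀ p : ℕ, p.Prime → ∀ ν : ℕ, 2 ≤ ν →
      ‖f (p ^ ν)‖ ≤ K * (ν : ℝ) ^ l) :
    ∃ (l : ℕ) (C : ℝ), 0 < C ∧ ∀ p : ℕ, p.Prime → ∀ ν : ℕ,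
      ‖f (p ^ (ν + 1))‖ ≤ C * ((ν : ℝ) + 1) ^ l ∧
      ‖f (p ^ (ν + 1)) - f (p ^ ν)‖ ≤ C * ((ν : ℝ) + 1) ^ l := by
  obtain ⟨l, K, hK⟩ := hbound
  have hA : ∀ p : ℕ, p.Prime → ∀ ν : ℕ, ‖f (p ^ (ν + 1))‖ ≤ (|K| + 1) * ((ν : ℝ) + 1) ^ l := by
    intro p hp ν
    rcases Nat.eq_zero_or_pos ν with rfl | h
    · simp [hp1 p hp]
    · refine (hK p hp (ν+1) (by omega)).trans ?_
      push_cast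
      gcongr
      linarith [le_abs_self K]
  refine ⟨l, 2 * (|K| + 1), by positivity, fun p hp ν => ⟨?_, ?_⟩⟩
  · refine (hA p hp ν).trans ?_
    gcongr
    linarith [abs_nonneg K]
  · refine (norm_sub_le _ _).trans ?_
    have h2 : ‖f (p ^ ν)‖ ≤ (|K| + 1) * ((ν : ℝ) + 1) ^ l := by
      rcases ν with _ | ν
      · simp [h1]; positivity
      · refine (hA p hp ν).trans ?_
        push_cast
        gcongr
        linarith
    linarith [hA p hp ν]

lemma aux_base (l : ℕ) : Summable (fun z : Nat.Primes × ℕ =>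
    (1 / ((z.1 : ℕ) : ℝ) ^ 2) * (((z.2 : ℝ) + 1) ^ l * (1 / 2) ^ z.2)) := by
  have ha : Summable (fun p : Nat.Primes => 1 / ((p : ℕ) : ℝ) ^ 2) :=
    (Real.summable_one_div_nat_pow.2 (by norm_num : 1 < 2)).comp_injective
      (Subtype.val_injective)
  have hb : Summable (fun n : ℕ => ((n : ℝ) + 1) ^ l * (1 / 2 : ℝ) ^ n) := by
    have h := summable_pow_mul_geometric_of_norm_lt_one (R := ℝ) l (r := 1/2)
      (by norm_num)
    have h2 := ((summable_nat_add_iff 1).2 h).mul_left 2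
    refine h2.congr fun n => ?_
    push_cast
    rw [pow_succ]; ring
  exact ha.mul_of_nonneg hb (fun p => by positivity) (fun n => by positivity)

lemma aux_sum (l m : ℕ) (hm : 2 ≤ m) : Summable (fun z : Nat.Primes × ℕ =>
    ((z.2 : ℝ) + 1) ^ l / ((z.1 : ℕ) : ℝ) ^ ((z.2 + 1) * m)) := by
  refine Summable.of_nonneg_of_le (fun z => by positivity) (fun z => ?_) (aux_base l)
  obtain ⟨p, v⟩ := z
  simp only
  have hp : (2 : ℝ) ≤ (p : ℕ) := by exact_mod_cast p.2.two_le
  have h : ((p : ℕ) : ℝ) ^ 2 * 2 ^ v ≤ ((p : ℕ) : ℝ) ^ ((v + 1) * m) := by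
    calc ((p : ℕ) : ℝ) ^ 2 * 2 ^ v ≤ ((p : ℕ) : ℝ) ^ 2 * (p : ℕ) ^ v := by gcongr
      _ = ((p : ℕ) : ℝ) ^ (2 + v) := by rw [pow_add]
      _ ≤ _ := pow_le_pow_right₀ (by linarith) (by nlinarith)
  calc ((v : ℝ) + 1) ^ l / ((p : ℕ) : ℝ) ^ ((v + 1) * m)
      ≤ ((v : ℝ) + 1) ^ l / (((p : ℕ) : ℝ) ^ 2 * 2 ^ v) := by gcongr
    _ = _ := by rw [one_div_pow]; field_simp

lemma aux_sum2 (l : ℕ) : Summable (fun z : Nat.Primes × ℕ =>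
    if z.2 = 0 then 0 else ((z.2 : ℝ) + 1) ^ l / ((z.1 : ℕ) : ℝ) ^ (z.2 + 1)) := by
  refine Summable.of_nonneg_of_le (fun z => by split_ifs <;> positivity) (fun z => ?_)
    ((aux_base l).mul_left 2)
  obtain ⟨p, v⟩ := z
  simp only
  split_ifs with hv
  · positivity
  obtain ⟨w, rfl⟩ := Nat.exists_eq_succ_of_ne_zero hv
  have hp : (2 : ℝ) ≤ (p : ℕ) := by exact_mod_cast p.2.two_le
  have h : ((p : ℕ) : ℝ) ^ 2 * 2 ^ w ≤ ((p : ℕ) : ℝ) ^ (w.succ + 1) := by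
    calc ((p : ℕ) : ℝ) ^ 2 * 2 ^ w ≤ ((p : ℕ) : ℝ) ^ 2 * (p : ℕ) ^ w := by gcongr
      _ = _ := by rw [← pow_add]; congr 1; omega
  calc ((w.succ : ℝ) + 1) ^ l / ((p : ℕ) : ℝ) ^ (w.succ + 1)
      ≤ ((w.succ : ℝ) + 1) ^ l / (((p : ℕ) : ℝ) ^ 2 * 2 ^ w) := by gcongr
    _ = _ := by rw [one_div_pow, Nat.succ_eq_add_one, pow_succ 2 w]; field_simp

lemma aux_D (f : ℕ → ℂ) (h1 : f 1 = 0) (P : ℂ) (p : ℕ)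
    (hs : Summable (fun v : ℕ => f (p ^ (v + 1)) * P ^ (v + 1))) :
    (1 - P) * ∑' v : ℕ, f (p ^ (v + 1)) * P ^ (v + 1) =
      ∑' v : ℕ, (f (p ^ (v + 1)) - f (p ^ v)) * P ^ (v + 1) := by
  have hs2 : Summable (fun v : ℕ => f (p ^ v) * P ^ (v + 1)) := by
    rw [← summable_nat_add_iff 1]
    refine (hs.mul_left P).congr fun v => ?_
    rw [pow_succ P (v+1)]; ring
  have h2 : ∑' v : ℕ, f (p ^ v) * P ^ (v + 1) = P * ∑' v : ℕ, f (p ^ (v + 1)) * P ^ (v + 1) := by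
    rw [hs2.tsum_eq_zero_add, ← tsum_mul_left]
    simp only [pow_zero, h1, zero_mul, zero_add]
    refine tsum_congr fun v => ?_
    rw [pow_succ P (v+1)]; ring
  simp_rw [sub_mul]
  rw [hs.tsum_sub hs2, h2, one_mul]

/-- the tail over primes for `k = 2` -/
lemma aux_h (x : ℝ) (hx : 16 ≤ x) (u : Finset Nat.Primes) :
    ∑ p ∈ u, |((⌊x⌋₊ / (p : ℕ) : ℕ) : ℝ) ^ 2 - (x / (p : ℕ)) ^ 2| ≤
      8 * x * (1 + Real.log 2 + Real.log (Real.log x)) + 2 * x := by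
  have hm := aux_mertens x hx
  have hN : ⌊x⌋₊ ≠ 0 := by
    have : 16 ≤ ⌊x⌋₊ := Nat.le_floor (by exact_mod_cast hx)
    omega
  have hNx : x < (⌊x⌋₊ : ℝ) + 1 := Nat.lt_floor_add_one x
  have e1 : ∑ p ∈ u, |((⌊x⌋₊ / (p : ℕ) : ℕ) : ℝ) ^ 2 - (x / (p : ℕ)) ^ 2| =
      ∑ p ∈ u.map ⟨fun p : Nat.Primes => (p : ℕ), Nat.Primes.coe_nat_injective⟩,
        |((⌊x⌋₊ / p : ℕ) : ℝ) ^ 2 - (x / p) ^ 2| := by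
    rw [Finset.sum_map]; rfl
  rw [e1]
  set s : Finset ℕ := u.map ⟨fun p : Nat.Primes => (p : ℕ), Nat.Primes.coe_nat_injective⟩ with hs
  have hsp : ∀ p ∈ s, p.Prime := by
    intro p hp
    rw [hs] at hp
    obtain ⟨a, _, rfl⟩ := Finset.mem_map.1 hp
    exact a.2
  rw [← Finset.sum_filter_add_sum_filter_not s (fun p => p ≤ ⌊x⌋₊)]
  apply add_le_add
  · calc _ ≤ ∑ p ∈ s.filter (fun p => p ≤ ⌊x⌋₊), 2 * x * (1 / (p : ℝ)) := by
          apply Finset.sum_le_sum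
          intro p _
          have := aux_pow x (by linarith) p 2
          norm_num at this ⊢
          rw [← div_eq_mul_inv, mul_div_assoc]; exact this
      _ ≤ ∑ p ∈ (Finset.range (⌊x⌋₊ + 1)).filter Nat.Prime, 2 * x * (1 / (p : ℝ)) := by
          apply Finset.sum_le_sum_of_subset_of_nonneg
          · intro p hp
            simp only [Finset.mem_filter, Finset.mem_range] at hp ⊢
            exact ⟨by omega, hsp p hp.1⟩
          · intros; positivity
      _ ≤ _ := by
          rw [← Finset.mul_sum]
          nlinarith
  · set M := s.sup id + ⌊x⌋₊ with hM
    calc _ ≤ ∑ p ∈ s.filter (fun p => ¬ p ≤ ⌊x⌋₊), x ^ 2 * ((p : ℝ) ^ 2)⁻¹ := by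
          apply Finset.sum_le_sum
          intro p hp
          simp only [Finset.mem_filter] at hp
          rw [Nat.div_eq_of_lt (by omega)]
          rw [div_pow, ← div_eq_mul_inv]
          have : 0 ≤ x ^ 2 / (p : ℝ) ^ 2 := by positivity
          simp [abs_of_nonneg this]
      _ ≤ ∑ p ∈ Finset.Ioc ⌊x⌋₊ M, x ^ 2 * ((p : ℝ) ^ 2)⁻¹ := by
          apply Finset.sum_le_sum_of_subset_of_nonneg
          · intro p hp
            simp only [Finset.mem_filter, Finset.mem_Ioc] at hp ⊢
            have := Finset.le_sup (f := id) hp.1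
            simp only [id] at this
            exact ⟨by omega, by omega⟩
          · intros; positivity
      _ ≤ x ^ 2 * (⌊x⌋₊ : ℝ)⁻¹ := by
          rw [← Finset.mul_sum]
          have := sum_Ioc_inv_sq_le_sub (α := ℝ) hN (n := M) (by omega)
          have h0 : 0 ≤ (M : ℝ)⁻¹ := by positivity
          gcongr
          linarith
      _ ≤ 2 * x := by
          have : (0:ℝ) < ⌊x⌋₊ := by positivity
          rw [← div_eq_mul_inv, div_le_iff₀ this]
          nlinarith

theorem stmt_11 (f : ℕ → ℂ)
    (hadd : ∀ m n : ℕ, Nat.Coprime m n → f (m * n) = f m + f n)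
    (hp1 : ∀ p : ℕ, p.Prime → f p = 1)
    (hbound : ∃ (l : ℕ) (K : ℝ), ∀ p : ℕ, p.Prime → ∀ ν : ℕ, 2 ≤ ν →
      ‖f (p ^ ν)‖ ≤ K * (ν : ℝ) ^ l)
    (k : ℕ) (hk : 2 ≤ k) :
    Summable (fun p : Nat.Primes =>
      ‖(1 - 1 / ((p : ℕ) : ℂ) ^ k) *
        ∑' ν : ℕ, f ((p : ℕ) ^ (ν + 1)) / ((p : ℕ) : ℂ) ^ ((ν + 1) * k)‖) ∧
    ((3 ≤ k →
      ∃ c > (0 : ℝ), ∃ x₀ : ℝ, 3 ≤ x₀ ∧ ∀ x ≥ x₀,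
        ‖(∑ n ∈ Fintype.piFinset (fun _ : Fin k => Finset.Icc 1 ⌊x⌋₊),
            f (Finset.univ.gcd n)) -
          (∑' p : Nat.Primes, (1 - 1 / ((p : ℕ) : ℂ) ^ k) *
              ∑' ν : ℕ, f ((p : ℕ) ^ (ν + 1)) / ((p : ℕ) : ℂ) ^ ((ν + 1) * k)) *
            (x : ℂ) ^ k‖ ≤ c * x ^ (k - 1)) ∧
     (k = 2 →
      ∃ c > (0 : ℝ), ∃ x₀ : ℝ, 3 ≤ x₀ ∧ ∀ x ≥ x₀,
        ‖(∑ n ∈ Fintype.piFinset (fun _ : Fin k => Finset.Icc 1 ⌊x⌋₊),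
            f (Finset.univ.gcd n)) -
          (∑' p : Nat.Primes, (1 - 1 / ((p : ℕ) : ℂ) ^ k) *
              ∑' ν : ℕ, f ((p : ℕ) ^ (ν + 1)) / ((p : ℕ) : ℂ) ^ ((ν + 1) * k)) *
            (x : ℂ) ^ k‖ ≤ c * x * Real.log (Real.log x))) := by
  have h1 : f 1 = 0 := by simpa using hadd 1 1 (by norm_num)
  obtain ⟨l, C, hC, hb⟩ := aux_bound f h1 hp1 hbound
  set g : Nat.Primes × ℕ → ℂ := fun z => f ((z.1 : ℕ) ^ (z.2 + 1)) - f ((z.1 : ℕ) ^ z.2) with hg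
  have hgb : ∀ z, ‖g z‖ ≤ C * ((z.2 : ℝ) + 1) ^ l := fun z => (hb z.1 z.1.2 z.2).2
  -- summability of the main series
  have hsumN : Summable (fun z : Nat.Primes × ℕ =>
      ‖g z * (1 / ((z.1 : ℕ) : ℂ) ^ k) ^ (z.2 + 1)‖) := by
    refine Summable.of_nonneg_of_le (fun z => norm_nonneg _) (fun z => ?_)
      ((aux_sum l k hk).mul_left C)
    rw [norm_mul, norm_pow, norm_div, norm_pow, Complex.norm_natCast, norm_one, one_div_pow,
      ← pow_mul, mul_comm k, mul_one_div, ← mul_div_assoc]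
    gcongr
    exact hgb z
  have hsumf : Summable (fun z : Nat.Primes × ℕ =>
      f ((z.1 : ℕ) ^ (z.2 + 1)) * (1 / ((z.1 : ℕ) : ℂ) ^ k) ^ (z.2 + 1)) := by
    refine Summable.of_norm_bounded ((aux_sum l k hk).mul_left C) (fun z => ?_)
    rw [norm_mul, norm_pow, norm_div, norm_pow, Complex.norm_natCast, norm_one, one_div_pow,
      ← pow_mul, mul_comm k, mul_one_div, ← mul_div_assoc]
    gcongr
    exact (hb z.1 z.1.2 z.2).1
  have hterm : ∀ p : Nat.Primes, (1 - 1 / ((p : ℕ) : ℂ) ^ k) *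
        ∑' ν : ℕ, f ((p : ℕ) ^ (ν + 1)) / ((p : ℕ) : ℂ) ^ ((ν + 1) * k) =
      ∑' ν : ℕ, g (p, ν) * (1 / ((p : ℕ) : ℂ) ^ k) ^ (ν + 1) := by
    intro p
    have hsf : Summable (fun v : ℕ => f ((p : ℕ) ^ (v + 1)) *
        (1 / ((p : ℕ) : ℂ) ^ k) ^ (v + 1)) := hsumf.prod_factor p
    have hD := aux_D f h1 (1 / ((p : ℕ) : ℂ) ^ k) (p : ℕ) hsf
    simp only [hg]
    rw [← hD]
    congr 1
    refine tsum_congr fun v => ?_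
    rw [one_div_pow, ← pow_mul, mul_comm k, mul_one_div]
  simp_rw [hterm]
  rw [← hsumN.of_norm.tsum_prod]
  have hmain : ∀ x : ℝ, HasSum (fun z : Nat.Primes × ℕ => g z *
      (((((⌊x⌋₊ / (z.1 : ℕ) ^ (z.2 + 1) : ℕ) : ℝ) ^ k -
        (x / ((z.1 : ℕ) ^ (z.2 + 1) : ℕ)) ^ k : ℝ)) : ℂ))
      ((∑ n ∈ Fintype.piFinset (fun _ : Fin k => Finset.Icc 1 ⌊x⌋₊),
            f (Finset.univ.gcd n)) -
        (∑' z : Nat.Primes × ℕ, g z * (1 / ((z.1 : ℕ) : ℂ) ^ k) ^ (z.2 + 1)) * (x : ℂ) ^ k) := by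
    intro x
    have := (aux_S f h1 hadd k ⌊x⌋₊ (by omega)).sub
      (hsumN.of_norm.hasSum.mul_right ((x : ℂ) ^ k))
    refine (congrArg (fun F => HasSum F _) (funext fun z => ?_)).mpr this
    push_cast
    rw [div_pow, one_div_pow, ← pow_mul, ← pow_mul, mul_comm k]
    simp only [hg]
    ring
  refine ⟨?_, ?_, ?_⟩
  · refine Summable.of_nonneg_of_le (fun p => norm_nonneg _) (fun p => ?_) hsumN.prod
    exact norm_tsum_le_tsum_norm (hsumN.prod_factor p)
  · intro hk3
    have hs := aux_sum l (k - 1) (by omega)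
    set A := ∑' z : Nat.Primes × ℕ,
      ((z.2 : ℝ) + 1) ^ l / ((z.1 : ℕ) : ℝ) ^ ((z.2 + 1) * (k - 1)) with hA
    have hA0 : 0 ≤ A := tsum_nonneg fun z => by positivity
    refine ⟨C * k * A + 1, by positivity, 16, by norm_num, fun x hx => ?_⟩
    have hx0 : 0 ≤ x := by linarith
    have h2 := tsum_of_norm_bounded (hs.hasSum.mul_left (C * k * x ^ (k - 1)))
      (f := fun z : Nat.Primes × ℕ => g z *
      (((((⌊x⌋₊ / (z.1 : ℕ) ^ (z.2 + 1) : ℕ) : ℝ) ^ k -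
        (x / ((z.1 : ℕ) ^ (z.2 + 1) : ℕ)) ^ k : ℝ)) : ℂ)) (fun z => by
        rw [norm_mul, Complex.norm_real, Real.norm_eq_abs]
        have h3 := aux_pow x hx0 ((z.1 : ℕ) ^ (z.2 + 1)) k
        calc _ ≤ C * ((z.2 : ℝ) + 1) ^ l * (k * (x / ((z.1 : ℕ) ^ (z.2 + 1) : ℕ)) ^ (k - 1)) :=
              mul_le_mul (hgb z) h3 (abs_nonneg _) (by positivity)
          _ = _ := by
              push_cast
              rw [div_pow, ← pow_mul]
              ring)
    rw [(hmain x).tsum_eq] at h2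
    refine h2.trans ?_
    have : 0 ≤ x ^ (k - 1) := by positivity
    rw [← hA]
    nlinarith
  · rintro rfl
    have hs := aux_sum2 l
    set A := ∑' z : Nat.Primes × ℕ,
      (if z.2 = 0 then 0 else ((z.2 : ℝ) + 1) ^ l / ((z.1 : ℕ) : ℝ) ^ (z.2 + 1)) with hA
    have hA0 : 0 ≤ A := tsum_nonneg fun z => by split_ifs <;> positivity
    have hl2 : 0 < Real.log 2 := Real.log_pos (by norm_num)
    refine ⟨C * (8 * (2 + Real.log 2) + 2) + C * 2 * A, by positivity, 16, by norm_num,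
      fun x hx => ?_⟩
    have hx0 : 0 ≤ x := by linarith
    set h : Nat.Primes → ℝ := fun p =>
      |((⌊x⌋₊ / (p : ℕ) : ℕ) : ℝ) ^ 2 - (x / (p : ℕ)) ^ 2| with hh
    have hh0 : 0 ≤ h := fun p => abs_nonneg _
    have hsh : Summable h := summable_of_sum_le hh0 (aux_h x hx)
    have hth : ∑' p, h p ≤ 8 * x * (1 + Real.log 2 + Real.log (Real.log x)) + 2 * x :=
      Real.tsum_le_of_sum_le hh0 (aux_h x hx)
    have hB : HasSum (fun z : Nat.Primes × ℕ => h z.1 * (if z.2 = 0 then 1 else 0))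
        (∑' p, h p) := by
      have hd : HasSum (fun n : ℕ => if n = 0 then (1:ℝ) else 0) 1 := hasSum_ite_eq 0 1
      have := hsh.hasSum.mul hd (hsh.mul_of_nonneg hd.summable hh0
        (fun n => by simp only [Pi.zero_apply]; split_ifs <;> norm_num))
      rwa [mul_one] at this
    have h2 := tsum_of_norm_bounded
      ((hB.mul_left C).add (hs.hasSum.mul_left (C * 2 * x)))
      (f := fun z : Nat.Primes × ℕ => g z *
      (((((⌊x⌋₊ / (z.1 : ℕ) ^ (z.2 + 1) : ℕ) : ℝ) ^ 2 -
        (x / ((z.1 : ℕ) ^ (z.2 + 1) : ℕ)) ^ 2 : ℝ)) : ℂ)) (fun z => by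
        rw [norm_mul, Complex.norm_real, Real.norm_eq_abs]
        obtain ⟨p, v⟩ := z
        rcases Nat.eq_zero_or_pos v with rfl | hv
        · have := hgb (p, 0)
          simp only [Nat.cast_zero, zero_add, one_pow, mul_one] at this
          simp only [zero_add, pow_one, if_true, mul_one, mul_zero, add_zero]
          exact mul_le_mul_of_nonneg_right this (abs_nonneg _)
        · have h3 := aux_pow x hx0 ((p : ℕ) ^ (v + 1)) 2
          rw [if_neg (by simp; omega), if_neg (by simp; omega)]
          calc _ ≤ C * ((v : ℝ) + 1) ^ l * ((2:ℕ) * (x / ((p : ℕ) ^ (v + 1) : ℕ)) ^ (2 - 1)) :=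
                mul_le_mul (hgb (p, v)) h3 (abs_nonneg _) (by positivity)
            _ = _ := by
                push_cast
                norm_num
                ring)
    rw [(hmain x).tsum_eq] at h2
    refine h2.trans ?_
    have hlog : 1 ≤ Real.log (Real.log x) := by
      have e := Real.exp_one_lt_d9
      have l2 := Real.log_two_gt_d9
      have h16 : Real.log 16 = 4 * Real.log 2 := by
        rw [show (16:ℝ) = 2 ^ 4 by norm_num, Real.log_pow]; norm_num
      have hle : Real.log 16 ≤ Real.log x := Real.log_le_log (by norm_num) hx
      rw [Real.le_log_iff_exp_le (by linarith)]
      linarith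
    rw [← hA]
    generalize Real.log (Real.log x) = L at hlog hth ⊢
    have e1 : ∑' p, h p ≤ (8 * (2 + Real.log 2) + 2) * (x * L) := by
      refine hth.trans ?_
      have : x ≤ x * L := by nlinarith
      nlinarith [mul_le_mul_of_nonneg_left this hl2.le]
    have e2 : C * 2 * x * A ≤ C * 2 * A * (x * L) := by
      have : x ≤ x * L := by nlinarith
      calc C * 2 * x * A = C * 2 * A * x := by ring
        _ ≤ _ := by gcongr
    nlinarith [mul_le_mul_of_nonneg_left e1 hC.le]
end
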